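/- Let G be a multigraph embedded in a surface of Euler genus g without crossings, where each face is bounded by a cycle, and let d ≥ 3 be an integer. Then G^{(d)} has a layered H-partition (P, L) with width at most max{2g⌊d/2⌋, d + 3⌊d/2⌋ − 3}, such that H is planar with treewidth at most 3. -/

import Mathlib

/-!
Common definitions: multigraphs, combinatorial (cellular) surface embeddings,
Euler genus, framed graphs, strong products, treewidth, partitions and layerings.
-/

/-- A multigraph on vertex type `V` with edge type `E`, given by its endpoints map. -/
structure Multigraph (V E : Type) where
  ends : E → Sym2 V

namespace Multigraph

variable {V E F : Type}

/-- The simple graph underlying a multigraph. -/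
def simple (G : Multigraph V E) : SimpleGraph V where
  Adj u v := u ≠ v ∧ ∃ e, G.ends e = s(u, v)
  symm := by
    constructor
    rintro u v ⟨hne, e, he⟩
    exact ⟨hne.symm, e, he.trans Sym2.eq_swap⟩
  loopless := by constructor; rintro u ⟨hne, -⟩; exact hne rfl

/-- The simple graph on `V` whose edges are the edges of `G` lying in `S`. -/
def simpleOn (G : Multigraph V E) (S : Set E) : SimpleGraph V where
  Adj u v := u ≠ v ∧ ∃ e ∈ S, G.ends e = s(u, v)
  symm := by
    constructor
    rintro u v ⟨hne, e, heS, he⟩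
    exact ⟨hne.symm, e, heS, he.trans Sym2.eq_swap⟩
  loopless := by constructor; rintro u ⟨hne, -⟩; exact hne rfl

/-- A multigraph is simple: no loops and no parallel edges. -/
def IsSimple (G : Multigraph V E) : Prop :=
  (∀ e, ¬ (G.ends e).IsDiag) ∧ Function.Injective G.ends

/-- A set `S` of edges of `G` forms a spanning tree of `G`. -/
def IsSpanningTree (G : Multigraph V E) (S : Set E) : Prop :=
  (G.simpleOn S).IsTree ∧ (∀ e ∈ S, ¬ (G.ends e).IsDiag) ∧
    ∀ e ∈ S, ∀ e' ∈ S, G.ends e = G.ends e' → e = e'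

/-- A closed walk in a multigraph, recorded as periodic sequences of vertices and
edges: the walk visits `vtx 0, vtx 1, …, vtx (len - 1)` and returns to
`vtx len = vtx 0`, traversing the edge `edge i` between `vtx i` and `vtx (i+1)`. -/
structure CWalk (G : Multigraph V E) where
  len : ℕ
  len_pos : 0 < len
  vtx : ℕ → V
  edge : ℕ → E
  vtx_per : ∀ i, vtx (i + len) = vtx i
  edge_per : ∀ i, edge (i + len) = edge i
  compat : ∀ i, G.ends (edge i) = s(vtx i, vtx (i + 1))

namespace CWalk

variable {G : Multigraph V E}

/-- The vertex `v` lies on the closed walk `W`. -/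
def HasVtx (W : G.CWalk) (v : V) : Prop := ∃ i, i < W.len ∧ W.vtx i = v

/-- The edge `e` lies on the closed walk `W`. -/
def HasEdge (W : G.CWalk) (e : E) : Prop := ∃ i, i < W.len ∧ W.edge i = e

/-- The closed walk `W` is a cycle: it repeats no vertex and no edge. -/
def IsCycle (W : G.CWalk) : Prop :=
  (∀ i j, i < W.len → j < W.len → W.vtx i = W.vtx j → i = j) ∧
  (∀ i j, i < W.len → j < W.len → W.edge i = W.edge j → i = j)

end CWalk

/-- `p = (f, i)` is an occurrence of the edge `e` in the family `bd` of closed walks: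
the walk of face `f` traverses `e` at position `i`. -/
def IsOcc {G : Multigraph V E} (bd : F → G.CWalk) (e : E) (p : F × ℕ) : Prop :=
  p.2 < (bd p.1).len ∧ (bd p.1).edge p.2 = e

/-- `c = (f, i)` is a corner of the vertex `v`: the walk of face `f` visits `v`
at position `i`. -/
def IsCorner {G : Multigraph V E} (bd : F → G.CWalk) (v : V) (c : F × ℕ) : Prop :=
  c.2 < (bd c.1).len ∧ (bd c.1).vtx c.2 = v

/-- The corner `c` is one of the two end corners of the edge occurrence `p`. -/
def EndOf {G : Multigraph V E} (bd : F → G.CWalk) (c p : F × ℕ) : Prop :=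
  c.1 = p.1 ∧ (c.2 = p.2 ∨ c.2 = (p.2 + 1) % (bd p.1).len)

/-- Two corners of `v` are linked if they are end corners (at `v`) of the two
distinct occurrences of a common edge; this is the edge-to-edge gluing relation
around the vertex `v`. -/
def CornerLinked {G : Multigraph V E} (bd : F → G.CWalk) (v : V) (c c' : F × ℕ) : Prop :=
  IsCorner bd v c ∧ IsCorner bd v c' ∧
    ∃ (e : E) (p p' : F × ℕ), p ≠ p' ∧ IsOcc bd e p ∧ IsOcc bd e p' ∧
      EndOf bd c p ∧ EndOf bd c' p'

/-- A combinatorial (cellular) embedding of a connected multigraph `G` in a closed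
surface, with face set `F`: every face is given by its closed boundary walk, every
edge of `G` is traversed exactly twice in total by the boundary walks, and the link
of every vertex is connected (so the embedding is in a genuine surface, with no
pinch points). -/
structure Embedding (G : Multigraph V E) (F : Type) where
  boundary : F → G.CWalk
  conn : G.simple.Connected
  edge_twice : ∀ e : E, {p : F × ℕ | IsOcc boundary e p}.ncard = 2
  link_conn : ∀ (v : V) (c c' : F × ℕ), IsCorner boundary v c → IsCorner boundary v c' →
    Relation.EqvGen (CornerLinked boundary v) c c'

/-- The Euler genus `2 - (|V| - |E| + |F|)` of an embedding, via Euler's formula. -/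
noncomputable def Embedding.eulerGenus {G : Multigraph V E} {F : Type}
    (_ : Embedding G F) : ℤ :=
  2 - ((Nat.card V : ℤ) - Nat.card E + Nat.card F)

/-- The simple graph underlying the framed multigraph `G^{(d)}`: two distinct
vertices are adjacent iff they are joined by an edge of `G` or lie on a common
face of length at most `d` (in which case `G^{(d)}` has a chord between them). -/
def framedGraph {G : Multigraph V E} {F : Type} (emb : Embedding G F) (d : ℕ) :
    SimpleGraph V where
  Adj u v := u ≠ v ∧ ((∃ e, G.ends e = s(u, v)) ∨
    ∃ f, (emb.boundary f).len ≤ d ∧ (emb.boundary f).HasVtx u ∧ (emb.boundary f).HasVtx v)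
  symm := by
    constructor
    rintro u v ⟨hne, (⟨e, he⟩ | ⟨f, h1, h2, h3⟩)⟩
    · exact ⟨hne.symm, Or.inl ⟨e, he.trans Sym2.eq_swap⟩⟩
    · exact ⟨hne.symm, Or.inr ⟨f, h1, h3, h2⟩⟩
  loopless := by constructor; rintro u ⟨hne, -⟩; exact hne rfl

end Multigraph

namespace SimpleGraph

/-- `G` is contained in `X`: `G` is isomorphic to a subgraph of `X`. -/
def IsContainedIn {α β : Type} (G : SimpleGraph α) (X : SimpleGraph β) : Prop :=
  ∃ f : G →g X, Function.Injective f

/-- The strong product of two simple graphs. -/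
def strongProd {α β : Type} (G : SimpleGraph α) (H : SimpleGraph β) :
    SimpleGraph (α × β) where
  Adj x y := x ≠ y ∧ (x.1 = y.1 ∨ G.Adj x.1 y.1) ∧ (x.2 = y.2 ∨ H.Adj x.2 y.2)
  symm := by
    constructor
    rintro x y ⟨hne, h1, h2⟩
    exact ⟨hne.symm, h1.imp Eq.symm (fun h => G.symm.symm _ _ h), h2.imp Eq.symm (fun h => H.symm.symm _ _ h)⟩
  loopless := by constructor; rintro x ⟨hne, -⟩; exact hne rfl

end SimpleGraph

/-- `G` has treewidth at most `k`: it has a tree-decomposition with all bags of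
size at most `k + 1`. -/
def TreewidthLE {α : Type} (G : SimpleGraph α) (k : ℕ) : Prop :=
  ∃ (ι : Type) (T : SimpleGraph ι) (B : ι → Set α),
    T.IsTree ∧
    (∀ v, ∃ i, v ∈ B i) ∧
    (∀ u v, G.Adj u v → ∃ i, u ∈ B i ∧ v ∈ B i) ∧
    (∀ v, (T.induce {i | v ∈ B i}).Connected) ∧
    ∀ i, (B i).encard ≤ (k : ℕ∞) + 1

/-- `G` has Euler genus at most `g`: `G` is (isomorphic to) a subgraph of a
multigraph having a combinatorial embedding of Euler genus at most `g`. -/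
def HasEulerGenusLE {α : Type} (G : SimpleGraph α) (g : ℕ) : Prop :=
  ∃ (V' E' F' : Type), Finite V' ∧ Finite E' ∧ Finite F' ∧
    ∃ (M : Multigraph V' E') (emb : M.Embedding F'),
      emb.eulerGenus ≤ (g : ℤ) ∧ G.IsContainedIn M.simple

/-- A planar graph: a graph of Euler genus `0`. -/
def IsPlanar {α : Type} (G : SimpleGraph α) : Prop := HasEulerGenusLE G 0

/-- An apex graph: deleting some vertex leaves a planar graph. -/
def IsApex {α : Type} (G : SimpleGraph α) : Prop :=
  ∃ v : α, IsPlanar (G.induce {w | w ≠ v})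

/-- `A` indexes a partition of the vertices of `G` into nonempty parts `A x`, and the
quotient of `G` by this partition is (isomorphic to) `H`, via the indexing: this is an
`H`-partition of `G`. -/
def IsHPartition {α W : Type} (G : SimpleGraph α) (H : SimpleGraph W) (A : W → Set α) : Prop :=
  (∀ x, (A x).Nonempty) ∧ (∀ v, ∃! x, v ∈ A x) ∧
    ∀ x y, x ≠ y → (H.Adj x y ↔ ∃ u ∈ A x, ∃ v ∈ A y, G.Adj u v)

/-- `(L 0, L 1, …)` is a layering of `G`: an ordered partition of the vertices such
that every edge joins vertices in the same or in consecutive layers. -/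
def IsLayering {α : Type} (G : SimpleGraph α) (L : ℕ → Set α) : Prop :=
  (∀ v, ∃! j, v ∈ L j) ∧
    ∀ u v, G.Adj u v → ∀ i j, u ∈ L i → v ∈ L j → i ≤ j + 1 ∧ j ≤ i + 1

/-- `b` lies on every walk from `a` to `c` in `T` (for a tree: `b` is on the unique
`a`–`c` path). -/
def BtwIn {α : Type} (T : SimpleGraph α) (a b c : α) : Prop :=
  ∀ p : T.Walk a c, b ∈ p.support

/-- `Q` is the vertex set of a vertical path in the tree `T` rooted at `r` with upper
end `w` and lower end `u`: `w` lies on the path from `r` to `u`, and `Q` is the set of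
vertices of the `w`–`u` path. -/
def IsVerticalPathBtw {α : Type} (T : SimpleGraph α) (r : α) (Q : Set α) (w u : α) : Prop :=
  BtwIn T r w u ∧ Q = {x | BtwIn T w x u}

/-- `Q` is the vertex set of a vertical path in the tree `T` rooted at `r`. -/
def IsVerticalPath {α : Type} (T : SimpleGraph α) (r : α) (Q : Set α) : Prop :=
  ∃ w u, IsVerticalPathBtw T r Q w u

/-- `Y` is the union of at most `k` vertical paths in the tree `T` rooted at `r`. -/
def IsUnionOfVPaths {α : Type} (T : SimpleGraph α) (r : α) (k : ℕ) (Y : Set α) : Prop :=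
  ∃ m, m ≤ k ∧ ∃ Q : Fin m → Set α, (∀ i, IsVerticalPath T r (Q i)) ∧ Y = ⋃ i, Q i

open Classical in
theorem tri_parity {κ : Type} (c : Fin 3 → κ) (p q : κ) (hpq : p ≠ q) :
    (∑ i, if s(c i, c (i+1)) = s(p, q) then (1 : ZMod 2) else 0) =
      if Function.Injective c ∧ (∃ i, c i = p) ∧ (∃ i, c i = q) then 1 else 0 := by
  have hinj : Function.Injective c ↔ c 0 ≠ c 1 ∧ c 1 ≠ c 2 ∧ c 0 ≠ c 2 := by
    constructor
    · intro h
      refine ⟨fun e => ?_, fun e => ?_, fun e => ?_⟩ <;> exact absurd (h e) (by decide)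
    · rintro ⟨h1, h2, h3⟩ i j hij
      fin_cases i <;> fin_cases j <;> simp_all
  simp only [hinj, Fin.sum_univ_three]
  simp only [Fin.exists_fin_succ, Fin.exists_fin_zero, Sym2.eq_iff]
  have e0 : (0 : Fin 3) + 1 = 1 := rfl
  have e1 : (1 : Fin 3) + 1 = 2 := rfl
  have e2 : (2 : Fin 3) + 1 = 0 := rfl
  have f1 : Fin.succ (0 : Fin 2) = 1 := rfl
  have f2 : Fin.succ (Fin.succ (0 : Fin 1)) = 2 := rfl
  simp only [e0, e1, e2, f1, f2]
  have h2 : (1 : ZMod 2) + 1 = 0 := by decide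
  generalize c 0 = x
  generalize c 1 = y
  generalize c 2 = w
  by_cases a1 : x = p <;> by_cases a2 : x = q <;> by_cases b1 : y = p <;> by_cases b2 : y = q <;>
    by_cases c1 : w = p <;> by_cases c2 : w = q <;> 
    first
    | (exfalso; apply hpq; simp_all; done)
    | (subst_vars; simp_all [eq_comm]; done)
    | grind

open Classical in
theorem tri_count {κ : Type} (c : Fin 3 → κ) :
    (∑ i, if c i ≠ c (i+1) then 1 else 0) = (if ∃ i, c i ≠ c (i+1) then 2 else 0) +
      if Function.Injective c then 1 else 0 := by
  have hinj : Function.Injective c ↔ c 0 ≠ c 1 ∧ c 1 ≠ c 2 ∧ c 0 ≠ c 2 := by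
    constructor
    · intro h
      refine ⟨fun e => ?_, fun e => ?_, fun e => ?_⟩ <;> exact absurd (h e) (by decide)
    · rintro ⟨h1, h2, h3⟩ i j hij
      fin_cases i <;> fin_cases j <;> simp_all
  simp only [hinj, Fin.sum_univ_three]
  simp only [Fin.exists_fin_succ, Fin.exists_fin_zero]
  have e0 : (0 : Fin 3) + 1 = 1 := rfl
  have e1 : (1 : Fin 3) + 1 = 2 := rfl
  have e2 : (2 : Fin 3) + 1 = 0 := rfl
  have f1 : Fin.succ (0 : Fin 2) = 1 := rfl
  have f2 : Fin.succ (Fin.succ (0 : Fin 1)) = 2 := rfl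
  simp only [e0, e1, e2, f1, f2]
  generalize c 0 = x
  generalize c 1 = y
  generalize c 2 = w
  by_cases a1 : x = y <;> by_cases a2 : y = w <;> by_cases b1 : w = x <;> simp_all [eq_comm]

namespace FLP
open Classical

structure Cx (W E T : Type) where
  vt : T → Fin 3 → W
  ed : T → Fin 3 → E
  ends : E → Sym2 W
  hends : ∀ t i, ends (ed t i) = s(vt t i, vt t (i+1))
  two : ∀ e, ∃ p q : T × Fin 3, p ≠ q ∧ ∀ s : T × Fin 3, ed s.1 s.2 = e ↔ s = p ∨ s = q
  coh : ∀ D : E → ZMod 2, (∀ t, ∑ i, D (ed t i) = 0) → (∀ e, (ends e).IsDiag → D e = 0) →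
    ∃ φ : W → ZMod 2, ∀ t i, D (ed t i) = φ (vt t i) + φ (vt t (i+1))

variable {W E T : Type}

theorem sum_sides_aux [Fintype E] [Fintype T] {M : Type} [AddCommMonoid M] (ed : T → Fin 3 → E)
    (two : ∀ e, ∃ p q : T × Fin 3, p ≠ q ∧ ∀ s : T × Fin 3, ed s.1 s.2 = e ↔ s = p ∨ s = q)
    (g : E → M) :
    ∑ t, ∑ i, g (ed t i) = ∑ e, (g e + g e) := by
  rw [← Fintype.sum_prod_type' (fun t i => g (ed t i))]
  rw [← Finset.sum_fiberwise Finset.univ (fun s : T × Fin 3 => ed s.1 s.2)]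
  refine Finset.sum_congr rfl fun e _ => ?_
  obtain ⟨p, q, hpq, h⟩ := two e
  have : Finset.univ.filter (fun s : T × Fin 3 => ed s.1 s.2 = e) = {p, q} := by
    ext s; simp [h]
  rw [this, Finset.sum_pair hpq, (h p).2 (Or.inl rfl), (h q).2 (Or.inr rfl)]

namespace Cx
variable (X : Cx W E T)

def R (u v : W) : Prop := ∃ t i j, X.vt t i = u ∧ X.vt t j = v
def Cn (S : Set W) : Prop := S.Nonempty ∧ ∀ p : W → Prop,
  (∀ u ∈ S, ∀ v ∈ S, X.R u v → p u → p v) → ∀ x ∈ S, ∀ y ∈ S, p x → p y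
def Ad (S S' : Set W) : Prop := ∃ u ∈ S, ∃ v ∈ S', X.R u v

variable {X}
theorem R.symm {u v : W} (h : X.R u v) : X.R v u := by
  obtain ⟨t, i, j, h1, h2⟩ := h; exact ⟨t, j, i, h2, h1⟩
theorem Ad.symm {u v : Set W} (h : X.Ad u v) : X.Ad v u := by
  obtain ⟨t, i, j, h1, h2⟩ := h; exact ⟨j, h1, t, i, h2.symm⟩

theorem R.cases {u v : W} (h : X.R u v) : u = v ∨ ∃ t i, (X.vt t i = u ∧ X.vt t (i+1) = v) ∨
    (X.vt t i = v ∧ X.vt t (i+1) = u) := by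
  obtain ⟨t, i, j, h1, h2⟩ := h
  have : i = j ∨ j = i + 1 ∨ i = j + 1 := by clear h1 h2; revert i j; decide
  rcases this with rfl | rfl | rfl
  · left; rw [← h1, h2]
  · right; exact ⟨t, i, Or.inl ⟨h1, h2⟩⟩
  · right; exact ⟨t, j, Or.inr ⟨h2, h1⟩⟩

theorem sum_sides [Fintype E] [Fintype T] {M : Type} [AddCommMonoid M] (X : Cx W E T) (g : E → M) :
    ∑ t, ∑ i, g (X.ed t i) = ∑ e, (g e + g e) := sum_sides_aux X.ed X.two g

theorem exists_side (X : Cx W E T) (e : E) : ∃ t i, X.ed t i = e := by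
  obtain ⟨p, q, _, h⟩ := X.two e
  exact ⟨p.1, p.2, (h p).2 (Or.inl rfl)⟩

theorem zadd_self (a : ZMod 2) : a + a = 0 := by revert a; decide
theorem zeq_of_add {a b : ZMod 2} (h : a + b = 0) : a = b := by revert a b; decide

theorem Cn.eq {S : Set W} (h : X.Cn S) {α : Type} (φ : W → α)
    (hφ : ∀ u ∈ S, ∀ v ∈ S, X.R u v → φ u = φ v) {x y : W} (hx : x ∈ S) (hy : y ∈ S) :
    φ x = φ y :=
  h.2 (fun w => φ x = φ w) (fun u hu v hv r e => e.trans (hφ u hu v hv r)) x hx y hy rfl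

/-- number of tricoloured triangles -/
noncomputable def tau [Fintype T] (X : Cx W E T) {κ : Type} (col : W → κ) : ℕ :=
  (Finset.univ.filter fun t => Function.Injective (col ∘ X.vt t)).card

theorem phi_const {κ : Type} (X : Cx W E T) (col : W → κ) (D : E → ZMod 2)
    (hD : ∀ t i, col (X.vt t i) = col (X.vt t (i+1)) → D (X.ed t i) = 0)
    (φ : W → ZMod 2) (hφ : ∀ t i, D (X.ed t i) = φ (X.vt t i) + φ (X.vt t (i+1)))
    {S : Set W} (hS : X.Cn S) (k : κ) (hk : ∀ w ∈ S, col w = k) {x y : W} (hx : x ∈ S)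
    (hy : y ∈ S) : φ x = φ y := by
  refine hS.eq φ ?_ hx hy
  intro u hu v hv r
  rcases r.cases with rfl | ⟨t, i, ⟨rfl, rfl⟩ | ⟨rfl, rfl⟩⟩
  · rfl
  · exact zeq_of_add (by rw [← hφ, hD t i (by rw [hk _ hu, hk _ hv])])
  · exact (zeq_of_add (by rw [← hφ, hD t i (by rw [hk _ hu, hk _ hv])])).symm

theorem E1 [Fintype E] [Fintype T] {κ : Type} [Fintype κ] (X : Cx W E T) (col : W → κ)
    (hk : 2 ≤ Fintype.card κ) (hc : ∀ k, X.Cn {w | col w = k}) :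
    X.tau col + 4 ≤ 2 * Fintype.card κ := by
  set bic : E → Prop := fun e => ¬ ((X.ends e).map col).IsDiag with hbic
  have hb : ∀ t i, bic (X.ed t i) ↔ col (X.vt t i) ≠ col (X.vt t (i+1)) := by
    intro t i; simp [hbic, X.hends]
  set BT : T → Prop := fun t => ∃ i, col (X.vt t i) ≠ col (X.vt t (i+1)) with hBT
  have hcount : 2 * Fintype.card {e // bic e} = 2 * Fintype.card {t // BT t} + X.tau col := by
    have h1 := X.sum_sides (fun e => if bic e then (1:ℕ) else 0)
    simp only [hb] at h1
    have h2 : ∀ t, (∑ i, if col (X.vt t i) ≠ col (X.vt t (i+1)) then 1 else 0) = _ :=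
      fun t => tri_count (col ∘ X.vt t)
    simp only [h2, Finset.sum_add_distrib] at h1
    rw [Fintype.card_subtype, Fintype.card_subtype, Finset.card_filter, Finset.card_filter, tau,
      Finset.card_filter]
    rw [two_mul, ← h1, Finset.mul_sum]
    congr 1
    refine Finset.sum_congr rfl fun t _ => ?_
    simp only [hBT, Function.comp]
    split_ifs <;> rfl
  by_cases hne : ∃ t, BT t
  swap
  · have : Fintype.card {t // BT t} = 0 := by
      rw [Fintype.card_eq_zero_iff]; exact ⟨fun t => hne ⟨t.1, t.2⟩⟩
    have h0 : X.tau col = 0 := by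
      rw [tau, Finset.card_eq_zero, Finset.filter_eq_empty_iff]
      intro t _ hi
      exact hne ⟨t, 0, fun e => absurd (hi (a₁ := 0) (a₂ := 0+1) e) (by decide)⟩
    omega
  let Δ : (E → ZMod 2) →ₗ[ZMod 2] (T → ZMod 2) :=
    LinearMap.pi fun t => ∑ i, LinearMap.proj (X.ed t i)
  have hΔ : ∀ x t, Δ x t = ∑ i, x (X.ed t i) := by intro x t; simp [Δ]
  let ext : ({e // bic e} → ZMod 2) →ₗ[ZMod 2] (E → ZMod 2) :=
    Function.ExtendByZero.linearMap (ZMod 2) Subtype.val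
  have hext1 : ∀ x (e : {e // bic e}), ext x e = x e := by
    intro x e; exact Subtype.val_injective.extend_apply _ _ _
  have hext0 : ∀ x e, ¬ bic e → ext x e = 0 := by
    intro x e he
    exact Function.extend_apply' _ _ _ (by rintro ⟨a, rfl⟩; exact he a.2)
  let δ : ({e // bic e} → ZMod 2) →ₗ[ZMod 2] ({t // BT t} → ZMod 2) :=
    (LinearMap.funLeft (ZMod 2) (ZMod 2) Subtype.val) ∘ₗ Δ ∘ₗ ext
  have hδ : ∀ x t, δ x t = ∑ i, ext x (X.ed t.1 i) := by
    intro x t; rw [← hΔ]; rfl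
  have hz : ∀ x t, ¬ BT t → ∑ i, ext x (X.ed t i) = 0 := by
    intro x t ht
    refine Finset.sum_eq_zero fun i _ => hext0 _ _ ?_
    rw [hb]; exact fun h => ht ⟨i, h⟩
  let s : ({t // BT t} → ZMod 2) →ₗ[ZMod 2] ZMod 2 := ∑ t, LinearMap.proj t
  have hs : ∀ x, s x = ∑ t, x t := by intro x; simp [s]
  have hr1 : LinearMap.range δ ≤ LinearMap.ker s := by
    rintro _ ⟨x, rfl⟩
    rw [LinearMap.mem_ker, hs]
    simp only [hδ]
    have h1 := X.sum_sides (ext x)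
    simp only [zadd_self, Finset.sum_const_zero] at h1
    rw [← h1]
    rw [← Finset.sum_subtype (Finset.univ.filter BT) (by simp)
      (fun t => ∑ i, ext x (X.ed t i))]
    refine Finset.sum_subset (Finset.subset_univ _) fun t _ ht => hz x t ?_
    simpa using ht
  have hr2 : Module.finrank (ZMod 2) (LinearMap.range δ) + 1 ≤ Fintype.card {t // BT t} := by
    have h1 := Submodule.finrank_mono hr1
    have h2 := LinearMap.finrank_range_add_finrank_ker s
    have h3 : LinearMap.range s = ⊤ := by
      rw [LinearMap.range_eq_top]
      intro a
      obtain ⟨t, ht⟩ := hne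
      refine ⟨Pi.single ⟨t, ht⟩ a, ?_⟩
      rw [hs]; simp
    rw [h3, finrank_top, Module.finrank_self, Module.finrank_fintype_fun_eq_card] at h2
    omega
  have hab : ∀ e, ∃ ab : W × W, X.ends e = s(ab.1, ab.2) := by
    intro e
    induction h : X.ends e with
    | _ a b => exact ⟨(a, b), rfl⟩
  choose ab hab using hab
  let Ψ : (κ → ZMod 2) →ₗ[ZMod 2] ({e // bic e} → ZMod 2) :=
    LinearMap.pi fun e =>
      LinearMap.proj (R := ZMod 2) (φ := fun _ : κ => ZMod 2) (col (ab e.1).1) +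
      LinearMap.proj (R := ZMod 2) (φ := fun _ : κ => ZMod 2) (col (ab e.1).2)
  have hΨ : ∀ y e, Ψ y e = y (col (ab e.1).1) + y (col (ab e.1).2) := by intro y e; simp [Ψ]
  have hψr : Module.finrank (ZMod 2) (LinearMap.range Ψ) + 1 ≤ Fintype.card κ := by
    have h2 := LinearMap.finrank_range_add_finrank_ker Ψ
    rw [Module.finrank_fintype_fun_eq_card] at h2
    have h3 : 1 ≤ Module.finrank (ZMod 2) (LinearMap.ker Ψ) := by
      rw [Submodule.one_le_finrank_iff]
      intro h0
      have : (fun _ => 1 : κ → ZMod 2) ∈ LinearMap.ker Ψ := by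
        rw [LinearMap.mem_ker]; ext e; rw [hΨ]; exact zadd_self _
      rw [h0, Submodule.mem_bot] at this
      obtain ⟨k⟩ : Nonempty κ := Fintype.card_pos_iff.1 (by omega)
      exact one_ne_zero (congrFun this k)
    omega
  have hkr : LinearMap.ker δ ≤ LinearMap.range Ψ := by
    intro x hx
    rw [LinearMap.mem_ker] at hx
    obtain ⟨φ, hφ⟩ := X.coh (ext x) (by
      intro t
      by_cases ht : BT t
      · have := congrFun hx ⟨t, ht⟩
        rw [hδ] at this; exact this
      · exact hz x t ht) (by
      intro e he
      refine hext0 _ _ fun hbe => hbe ?_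
      revert he
      induction X.ends e with
      | _ a b => simp only [Sym2.mk_isDiag_iff, Sym2.map_mk]; rintro rfl; rfl)
    have hconst : ∀ u v, col u = col v → φ u = φ v := by
      intro u v huv
      refine X.phi_const col (ext x) ?_ φ hφ (hc (col v)) (col v) (fun _ h => h) huv rfl
      intro t i h
      exact hext0 _ _ (by rw [hb]; exact fun h' => h' h)
    choose rep hrep using fun k => (hc k).1
    refine ⟨fun k => φ (rep k), ?_⟩
    ext e
    rw [hΨ, hconst (rep _) _ (hrep _), hconst (rep _) _ (hrep _)]
    obtain ⟨t, i, hti⟩ := X.exists_side e.1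
    rw [← hext1 x e, ← hti, hφ t i]
    have := X.hends t i
    rw [hab] at this
    rcases Sym2.eq_iff.1 this with ⟨h1, h2⟩ | ⟨h1, h2⟩
    · rw [h1, h2]
    · rw [h1, h2, add_comm]
  have h1 := LinearMap.finrank_range_add_finrank_ker δ
  have h2 := Submodule.finrank_mono hkr
  rw [Module.finrank_fintype_fun_eq_card] at h1
  omega
end Cx
end FLP

namespace FLP
open Classical
namespace Cx
variable {W E T : Type} {X : Cx W E T}

noncomputable def tau2 [Fintype T] (X : Cx W E T) {κ : Type} (col : W → κ) (p q : κ) : ℕ :=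
  (Finset.univ.filter fun t => Function.Injective (col ∘ X.vt t) ∧
    (∃ i, (col ∘ X.vt t) i = p) ∧ (∃ i, (col ∘ X.vt t) i = q)).card

theorem tau2_even [Fintype E] [Fintype T] {κ : Type} (X : Cx W E T) (col : W → κ) (p q : κ)
    (hpq : p ≠ q) : Even (X.tau2 col p q) := by
  rw [← ZMod.natCast_eq_zero_iff_even, tau2, Finset.card_filter]
  push_cast
  rw [Finset.sum_congr rfl (fun t _ => (tri_parity (col ∘ X.vt t) p q hpq).symm)]
  have := X.sum_sides (fun e => if (X.ends e).map col = s(p, q) then (1 : ZMod 2) else 0)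
  simp only [zadd_self, Finset.sum_const_zero, X.hends, Sym2.map_mk] at this
  exact this

theorem E3 [Fintype E] [Fintype T] {κ : Type} (X : Cx W E T) (col : W → κ) (p q l : κ)
    (hpq : p ≠ q) (hpl : p ≠ l) (hql : q ≠ l) (cp : X.Cn {w | col w = p})
    (cq : X.Cn {w | col w = q}) (cl : X.Cn {w | col w = l})
    (apq : X.Ad {w | col w = p} {w | col w = q})
    (apl : X.Ad {w | col w = p} {w | col w = l})
    (aql : X.Ad {w | col w = q} {w | col w = l}) : 2 ≤ X.tau2 col p q := by
  have hev := X.tau2_even col p q hpq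
  by_contra hlt
  have h0 : X.tau2 col p q = 0 := by
    obtain ⟨m, hm⟩ := hev; omega
  rw [tau2, Finset.card_eq_zero, Finset.filter_eq_empty_iff] at h0
  set D : E → ZMod 2 := fun e => if (X.ends e).map col = s(p, q) then (1 : ZMod 2) else 0 with hD
  have hDt : ∀ t i, D (X.ed t i) =
      if s(col (X.vt t i), col (X.vt t (i+1))) = s(p, q) then 1 else 0 := by
    intro t i; simp only [hD, X.hends, Sym2.map_mk]
  obtain ⟨φ, hφ⟩ := X.coh D (by
    intro t
    simp only [hDt]
    refine (tri_parity (col ∘ X.vt t) p q hpq).trans ?_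
    rw [if_neg (h0 (Finset.mem_univ t))]) (by
    intro e
    simp only [hD]
    intro he
    refine if_neg ?_
    revert he
    induction X.ends e with
    | _ a b =>
      simp only [Sym2.mk_isDiag_iff, Sym2.map_mk]; rintro rfl
      intro h
      rcases Sym2.eq_iff.1 h with ⟨h1, h2⟩ | ⟨h1, h2⟩
      · exact hpq (h1.symm.trans h2)
      · exact hpq (h2.symm.trans h1))
  have hmono : ∀ t i, col (X.vt t i) = col (X.vt t (i+1)) → D (X.ed t i) = 0 := by
    intro t i h
    rw [hDt, if_neg]
    rw [h]
    intro h
    rcases Sym2.eq_iff.1 h with ⟨h1, h2⟩ | ⟨h1, h2⟩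
    · exact hpq (h1.symm.trans h2)
    · exact hpq (h2.symm.trans h1)
  have key : ∀ a b, a ≠ b → X.Ad {w | col w = a} {w | col w = b} → ∃ u v, col u = a ∧ col v = b ∧
      (if s(a, b) = s(p, q) then (1 : ZMod 2) else 0) = φ u + φ v := by
    rintro a b hab ⟨u, hu, v, hv, r⟩
    simp only [Set.mem_ofPred_eq] at hu hv
    rcases r.cases with rfl | ⟨t, i, ⟨rfl, rfl⟩ | ⟨rfl, rfl⟩⟩
    · exact absurd (hu.symm.trans hv) hab
    · refine ⟨_, _, hu, hv, ?_⟩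
      rw [← hφ, hDt, hu, hv]
    · refine ⟨_, _, hu, hv, ?_⟩
      rw [add_comm, ← hφ, hDt, hu, hv, Sym2.eq_swap]
  obtain ⟨u1, v1, hu1, hv1, e1⟩ := key p q hpq apq
  obtain ⟨u2, v2, hu2, hv2, e2⟩ := key p l hpl apl
  obtain ⟨u3, v3, hu3, hv3, e3⟩ := key q l hql aql
  rw [if_pos rfl] at e1
  rw [if_neg (by rw [Sym2.eq_iff]; grind)] at e2 e3
  have cst : ∀ k, X.Cn {w | col w = k} → ∀ {x y : W}, col x = k → col y = k → φ x = φ y :=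
    fun k hk x y hx hy => X.phi_const col D hmono φ hφ hk k (fun _ h => h) hx hy
  rw [cst p cp hu1 hu2, cst q cq hv1 hu3, zeq_of_add e2.symm, zeq_of_add e3.symm,
    cst l cl hv2 hv3, zadd_self] at e1
  exact one_ne_zero e1

theorem Cn.insert {S : Set W} (h : X.Cn S) {u v : W} (hu : u ∈ S) (r : X.R u v) :
    X.Cn (insert v S) := by
  refine ⟨⟨v, Or.inl rfl⟩, fun p hp => ?_⟩
  have h1 : ∀ x ∈ S, ∀ y ∈ S, p x → p y :=
    h.2 p fun a ha b hb => hp a (Or.inr ha) b (Or.inr hb)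
  have h2 : p u → p v := hp u (Or.inr hu) v (Or.inl rfl) r
  have h3 : p v → p u := hp v (Or.inl rfl) u (Or.inr hu) r.symm
  rintro x (rfl | hx) y (rfl | hy) px
  · exact px
  · exact h1 u hu y hy (h3 px)
  · exact h2 (h1 x hx u hu px)
  · exact h1 x hx y hy px

theorem Cn.cross {S : Set W} (h : X.Cn S) (p : W → Prop) {x y : W} (hx : x ∈ S) (hy : y ∈ S)
    (px : p x) (py : ¬ p y) : ∃ u ∈ S, ∃ v ∈ S, X.R u v ∧ p u ∧ ¬ p v := by
  by_contra hc
  push Not at hc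
  exact py (h.2 p (fun u hu v hv r pu => hc u hu v hv r pu) x hx y hy px)

theorem extend_col [Finite W] {κ : Type} (hU : X.Cn Set.univ) (k0 : κ) (n : ℕ) :
    ∀ col : W → Option κ, (∀ k, X.Cn {w | col w = some k}) → {w | col w = none}.ncard = n →
    ∃ c : W → κ, (∀ k, X.Cn {w | c w = k}) ∧ ∀ w k, col w = some k → c w = k := by
  induction n with
  | zero =>
    intro col hc h0
    rw [Set.ncard_eq_zero (Set.toFinite _)] at h0
    have h1 : ∀ w, col w ≠ none := fun w hw => by
      have : w ∈ {w | col w = none} := hw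
      rw [h0] at this; exact this
    choose c hcc using fun w => Option.ne_none_iff_exists'.1 (h1 w)
    refine ⟨c, fun k => ?_, fun w k h => ?_⟩
    · have : {w | c w = k} = {w | col w = some k} := by ext w; simp [hcc]
      rw [this]; exact hc k
    · rw [hcc] at h; exact Option.some.inj h
  | succ n ih =>
    intro col hc hn
    obtain ⟨y, hy⟩ : {w | col w = none}.Nonempty := by
      rw [← Set.ncard_pos (Set.toFinite _)]; omega
    obtain ⟨x, hx⟩ := (hc k0).1
    obtain ⟨u, -, v, -, r, pu, pv⟩ := hU.cross (fun w => col w ≠ none) (Set.mem_univ x)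
      (Set.mem_univ y) (by rw [Set.mem_ofPred_eq] at hx; rw [hx]; simp) (by simpa using hy)
    simp only [ne_eq, not_not] at pv
    obtain ⟨k, hk⟩ := Option.ne_none_iff_exists'.1 pu
    obtain ⟨c, h1, h2⟩ := ih (Function.update col v (some k)) (by
      intro l
      by_cases hl : l = k
      · subst hl
        have : {w | Function.update col v (some l) w = some l} = Insert.insert v {w | col w = some l} := by
          ext w
          by_cases hw : w = v
          · subst hw; simp
          · simp [hw]
        rw [this]
        exact (hc l).insert hk r
      · have : {w | Function.update col v (some k) w = some l} = {w | col w = some l} := by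
          ext w
          by_cases hw : w = v
          · subst hw; simp [pv, Ne.symm hl]
          · simp [hw]
        rw [this]; exact hc l) (by
      have : {w | Function.update col v (some k) w = none} = {w | col w = none} \ {v} := by
        ext w
        by_cases hw : w = v
        · subst hw; simp
        · simp [hw]
      rw [this, Set.ncard_sdiff_singleton_of_mem (show v ∈ {w | col w = none} from pv), hn]; rfl)
    refine ⟨c, h1, fun w l hw => h2 w l ?_⟩
    have : w ≠ v := by rintro rfl; rw [pv] at hw; cases hw
    simp [this, hw]

theorem extend_sets [Finite W] {κ : Type} [Nonempty κ] (hU : X.Cn Set.univ) (P : κ → Set W)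
    (hP : ∀ k, X.Cn (P k)) (hd : ∀ k l w, w ∈ P k → w ∈ P l → k = l) :
    ∃ c : W → κ, (∀ k, X.Cn {w | c w = k}) ∧ ∀ k, ∀ w ∈ P k, c w = k := by
  set col : W → Option κ := fun w => if h : ∃ k, w ∈ P k then some h.choose else none with hcol
  have h1 : ∀ w k, col w = some k ↔ w ∈ P k := by
    intro w k
    by_cases h : ∃ k, w ∈ P k
    · simp only [hcol, dif_pos h, Option.some.injEq]
      exact ⟨fun e => e ▸ h.choose_spec, fun hk => hd _ _ _ h.choose_spec hk⟩
    · simp only [hcol, dif_neg h]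
      exact ⟨fun e => (by cases e), fun hk => absurd ⟨k, hk⟩ h⟩
  obtain ⟨c, hc, h2⟩ := extend_col hU (Classical.arbitrary κ) _ col (fun k => by
    have : {w | col w = some k} = P k := by ext w; exact h1 w k
    rw [this]; exact hP k) rfl
  exact ⟨c, hc, fun k w hw => h2 w k ((h1 w k).2 hw)⟩

theorem Ad.mono {S S' Q Q' : Set W} (h : X.Ad S S') (h1 : S ⊆ Q) (h2 : S' ⊆ Q') : X.Ad Q Q' := by
  obtain ⟨u, hu, v, hv, r⟩ := h
  exact ⟨u, h1 hu, v, h2 hv, r⟩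

theorem pair_count [Fintype T] {κ : Type} [Fintype κ] [DecidableEq κ] (col : W → κ)
    (S : Finset (κ × κ)) (m : ℕ)
    (hm : ∀ a b c : κ, a ≠ b → b ≠ c → a ≠ c → (S.filter fun pq => (a = pq.1 ∨ b = pq.1 ∨ c = pq.1) ∧
      (a = pq.2 ∨ b = pq.2 ∨ c = pq.2)).card ≤ m)
    (h2 : ∀ pq ∈ S, 2 ≤ X.tau2 col pq.1 pq.2) : 2 * S.card ≤ m * X.tau col := by
  calc 2 * S.card = ∑ pq ∈ S, 2 := by simp [mul_comm]
    _ ≤ ∑ pq ∈ S, X.tau2 col pq.1 pq.2 := Finset.sum_le_sum h2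
    _ = ∑ t, ∑ pq ∈ S, if Function.Injective (col ∘ X.vt t) ∧
    (∃ i, (col ∘ X.vt t) i = pq.1) ∧ (∃ i, (col ∘ X.vt t) i = pq.2) then 1 else 0 := by
        simp only [tau2, Finset.card_filter]
        rw [Finset.sum_comm]
        refine Finset.sum_congr rfl fun t _ => Finset.sum_congr rfl fun pq _ => ?_
        congr
    _ ≤ ∑ t, if Function.Injective (col ∘ X.vt t) then m else 0 := by
        refine Finset.sum_le_sum fun t _ => ?_
        by_cases h : Function.Injective (col ∘ X.vt t)
        · simp only [h, true_and, if_true]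
          rw [← Finset.card_filter]
          refine le_trans (le_of_eq ?_) (hm (col (X.vt t 0)) (col (X.vt t 1)) (col (X.vt t 2))
            (fun e => absurd (h e) (by decide)) (fun e => absurd (h e) (by decide))
            (fun e => absurd (h e) (by decide)))
          congr 1
          ext pq
          simp [Fin.exists_fin_succ]
        · simp [h]
    _ = m * X.tau col := by
        rw [tau, Finset.card_filter, Finset.mul_sum]
        refine Finset.sum_congr rfl fun t _ => ?_
        split_ifs <;> simp

theorem K5 [Finite W] [Fintype E] [Fintype T] (hU : X.Cn Set.univ) (P : Fin 5 → Set W)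
    (hP : ∀ k, X.Cn (P k)) (hd : ∀ k l w, w ∈ P k → w ∈ P l → k = l)
    (ha : ∀ k l, k ≠ l → X.Ad (P k) (P l)) : False := by
  obtain ⟨c, hc, hs⟩ := extend_sets hU P hP hd
  have h1 := X.E1 c (by simp) hc
  have ha' : ∀ k l, k ≠ l → X.Ad {w | c w = k} {w | c w = l} :=
    fun k l h => (ha k l h).mono (hs k) (hs l)
  have h2 := pair_count (X := X) c (Finset.univ.filter fun pq : Fin 5 × Fin 5 => pq.1 < pq.2) 3
    (by decide) (by
      rintro ⟨p, q⟩ hpq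
      simp only [Finset.mem_filter, Finset.mem_univ, true_and] at hpq
      have : ∃ l, p ≠ l ∧ q ≠ l := by revert p q; decide
      obtain ⟨l, h1, h2⟩ := this
      exact X.E3 c p q l hpq.ne h1 h2 (hc p) (hc q) (hc l) (ha' _ _ hpq.ne) (ha' _ _ h1) (ha' _ _ h2))
  have h3 : (Finset.univ.filter fun pq : Fin 5 × Fin 5 => pq.1 < pq.2).card = 10 := by decide
  simp only [Fintype.card_fin] at h1
  omega

theorem K33 [Finite W] [Fintype E] [Fintype T] (hU : X.Cn Set.univ) (P : Fin 6 → Set W)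
    (hP : ∀ k, X.Cn (P k)) (hd : ∀ k l w, w ∈ P k → w ∈ P l → k = l)
    (ha : ∀ k l, k ≠ l → k < 3 → X.Ad (P k) (P l)) : False := by
  obtain ⟨c, hc, hs⟩ := extend_sets hU P hP hd
  have h1 := X.E1 c (by simp) hc
  have ha' : ∀ k l, k ≠ l → k < 3 → X.Ad {w | c w = k} {w | c w = l} :=
    fun k l h h' => (ha k l h h').mono (hs k) (hs l)
  have h2 := pair_count (X := X) c (Finset.univ.filter fun pq : Fin 6 × Fin 6 => pq.1 < 3 ∧ 3 ≤ pq.2) 2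
    (by decide) (by
      rintro ⟨p, q⟩ hpq
      simp only [Finset.mem_filter, Finset.mem_univ, true_and] at hpq
      have : ∃ l, p ≠ l ∧ q ≠ l ∧ l < 3 := by revert p q; decide
      obtain ⟨l, h1, h2, h3⟩ := this
      have hne : p ≠ q := by rintro rfl; exact absurd hpq.1 (not_lt.2 hpq.2)
      exact X.E3 c p q l hne h1 h2 (hc p) (hc q) (hc l) (ha' _ _ hne hpq.1) (ha' _ _ h1 hpq.1)
        (ha' _ _ h2.symm h3).symm)
  have h3 : (Finset.univ.filter fun pq : Fin 6 × Fin 6 => pq.1 < 3 ∧ 3 ≤ pq.2).card = 9 := by decide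
  simp only [Fintype.card_fin] at h1
  omega
end Cx
end FLP

namespace FLP
open Classical
namespace Cx
variable {W E T : Type} {X : Cx W E T}

theorem inj_miss (c : Fin 3 → Fin 4) (hc : Function.Injective c) (p q : Fin 4) (hpq : p ≠ q) :
    (if (∃ i, c i = p) ∧ (∃ i, c i = q) then 1 else 0) =
    ∑ l, if (∀ i, c i ≠ l) ∧ l ≠ p ∧ l ≠ q then 1 else 0 := by
  have key : ∀ x y z : Fin 4, x ≠ y → y ≠ z → x ≠ z → ∀ p q : Fin 4, p ≠ q →
    (if (x = p ∨ y = p ∨ z = p) ∧ (x = q ∨ y = q ∨ z = q) then 1 else 0) =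
    ∑ l, if (x ≠ l ∧ y ≠ l ∧ z ≠ l) ∧ l ≠ p ∧ l ≠ q then 1 else 0 := by decide
  have := key (c 0) (c 1) (c 2) (fun e => absurd (hc e) (by decide))
    (fun e => absurd (hc e) (by decide)) (fun e => absurd (hc e) (by decide)) p q hpq
  convert this using 2
  · simp [Fin.exists_fin_succ]
  · simp [Fin.forall_fin_succ]

theorem sperner [Finite W] [Fintype E] [Fintype T] (hU : X.Cn Set.univ) (A : Fin 3 → Set W)
    (C : Set W) (hA : ∀ i, X.Cn (A i)) (hC : X.Cn C)
    (hd : ∀ k l w, w ∈ A k → w ∈ A l → k = l) (hdC : ∀ k w, w ∈ A k → w ∉ C)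
    (ha : ∀ k l, k ≠ l → X.Ad (A k) (A l)) (haC : ∀ k, X.Ad (A k) C)
    (hN : ∀ u ∈ C, ∀ v, X.R u v → v ∈ C ∨ ∃ i, v ∈ A i) (χ : W → Fin 3)
    (hχ : ∀ i, ∀ w ∈ A i, χ w = i) :
    ∃ t, (∃ i, X.vt t i ∈ C) ∧ ∀ c, ∃ i, χ (X.vt t i) = c := by
  set P : Fin 4 → Set W := Fin.lastCases C A with hPdef
  have hPc : ∀ i : Fin 3, P i.castSucc = A i := fun i => by simp [hPdef]
  have hPl : P (Fin.last 3) = C := by rw [hPdef]; exact Fin.lastCases_last (motive := fun _ => Set W)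
  obtain ⟨c, hc, hs⟩ := extend_sets hU P
    (by intro k; induction k using Fin.lastCases with
        | last => rw [hPl]; exact hC
        | cast i => rw [hPc]; exact hA i)
    (by
      intro k l w
      induction k using Fin.lastCases with
      | last => 
        induction l using Fin.lastCases with
        | last => intros; rfl
        | cast j => rw [hPl, hPc]; intro h1 h2; exact absurd h1 (hdC _ _ h2)
      | cast i => 
        induction l using Fin.lastCases with
        | last => rw [hPl, hPc]; intro h1 h2; exact absurd h2 (hdC _ _ h1)
        | cast j => rw [hPc, hPc]; intro h1 h2; rw [hd _ _ _ h1 h2])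
  have hcA : ∀ i, ∀ w ∈ A i, c w = i.castSucc := fun i w hw => hs _ w (by rw [hPc]; exact hw)
  have hcC : ∀ w, c w = Fin.last 3 ↔ w ∈ C := by
    intro w
    refine ⟨fun h => ?_, fun h => hs _ w (by rw [hPl]; exact h)⟩
    by_contra hw
    obtain ⟨x, hx⟩ := hC.1
    obtain ⟨u, hu, v, hv, r, pu, pv⟩ := (hc (Fin.last 3)).cross (fun w => w ∈ C)
      (hs _ x (by rw [hPl]; exact hx)) h hx hw
    rcases hN u pu v r with h' | ⟨i, hi⟩
    · exact pv h'
    · have h1 := hcA i v hi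
      have h2 : c v = Fin.last 3 := hv
      rw [h2] at h1
      exact absurd h1 (Fin.castSucc_lt_last i).ne'
  have ha' : ∀ k l, k ≠ l → X.Ad {w | c w = k} {w | c w = l} := by
    intro k l hkl
    refine Ad.mono (S := P k) (S' := P l) ?_ (hs k) (hs l)
    induction k using Fin.lastCases with
      | last => 
        induction l using Fin.lastCases with
        | last => exact absurd rfl hkl
        | cast j => rw [hPl, hPc]; exact (haC j).symm
      | cast i => 
        induction l using Fin.lastCases with
        | last => rw [hPl, hPc]; exact haC i
        | cast j => rw [hPc, hPc]; exact ha i j (fun h => hkl (by rw [h]))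
  have htau := X.E1 c (by simp) hc
  simp only [Fintype.card_fin] at htau
  have h2 : ∀ p q, p ≠ q → 2 ≤ X.tau2 c p q := by
    intro p q hpq
    have : ∃ l, p ≠ l ∧ q ≠ l := by clear * -; revert p q; decide
    obtain ⟨l, h1, h2⟩ := this
    exact X.E3 c p q l hpq h1 h2 (hc p) (hc q) (hc l) (ha' _ _ hpq) (ha' _ _ h1) (ha' _ _ h2)
  set n : Fin 4 → ℕ := fun l => (Finset.univ.filter fun t => Function.Injective (c ∘ X.vt t) ∧
    ∀ i, (c ∘ X.vt t) i ≠ l).card with hn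
  have hpair : ∀ p q, p ≠ q → X.tau2 c p q = ∑ l, if l ≠ p ∧ l ≠ q then n l else 0 := by
    intro p q hpq
    have : ∀ l, (if l ≠ p ∧ l ≠ q then n l else 0) = ∑ t, if Function.Injective (c ∘ X.vt t) then
        (if (∀ i, (c ∘ X.vt t) i ≠ l) ∧ l ≠ p ∧ l ≠ q then 1 else 0) else 0 := by
      intro l
      by_cases h : l ≠ p ∧ l ≠ q
      · rw [if_pos h]
        simp only [hn, Finset.card_filter]
        refine Finset.sum_congr rfl fun t _ => ?_
        by_cases h1 : Function.Injective (c ∘ X.vt t) <;> simp [h1, h.1, h.2]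
      · simp [h]
    simp only [this]
    rw [Finset.sum_comm, tau2, Finset.card_filter]
    refine Finset.sum_congr rfl fun t _ => ?_
    by_cases h1 : Function.Injective (c ∘ X.vt t)
    · simp only [h1, true_and, if_true]
      exact inj_miss _ h1 p q hpq
    · simp [h1]
  have htot : X.tau c = ∑ l, n l := by
    rw [tau, Finset.card_filter]
    simp only [hn, Finset.card_filter]
    rw [Finset.sum_comm]
    refine Finset.sum_congr rfl fun t _ => ?_
    by_cases h1 : Function.Injective (c ∘ X.vt t)
    · simp only [h1, true_and, if_true]
      have key : ∀ x y z : Fin 4, x ≠ y → y ≠ z → x ≠ z → 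
        1 = ∑ l, if (x ≠ l ∧ y ≠ l ∧ z ≠ l) then 1 else 0 := by decide
      have := key ((c ∘ X.vt t) 0) ((c ∘ X.vt t) 1) ((c ∘ X.vt t) 2)
        (fun e => absurd (h1 e) (by decide))
        (fun e => absurd (h1 e) (by decide)) (fun e => absurd (h1 e) (by decide))
      convert this using 3
      simp [Fin.forall_fin_succ]
    · simp [h1]
  have hn3 : n 3 = 1 := by
    have e01 := h2 0 1 (by decide)
    have e02 := h2 0 2 (by decide)
    have e03 := h2 0 3 (by decide)
    have e12 := h2 1 2 (by decide)
    have e13 := h2 1 3 (by decide)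
    have e23 := h2 2 3 (by decide)
    rw [hpair _ _ (by decide), Fin.sum_univ_four] at e01 e02 e03 e12 e13 e23
    rw [htot, Fin.sum_univ_four] at htau
    simp at e01 e02 e03 e12 e13 e23
    clear_value n
    omega
  -- recolour
  have hlt : ∀ w, c w ≠ Fin.last 3 → ∃ j : Fin 3, j.castSucc = c w := by
    intro w h
    exact Fin.exists_castSucc_eq.2 h
  set c' : W → Fin 3 := fun w => if h : c w ≠ Fin.last 3 then (hlt w h).choose else χ w with hc'
  have hc'1 : ∀ w, w ∉ C → (c' w).castSucc = c w := by
    intro w hw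
    have h : c w ≠ Fin.last 3 := fun h => hw ((hcC w).1 h)
    simp only [hc', dif_pos h]
    exact (hlt w h).choose_spec
  have hc'2 : ∀ w, w ∈ C → c' w = χ w := by
    intro w hw
    have h : ¬ (c w ≠ Fin.last 3) := fun h => h ((hcC w).2 hw)
    simp only [hc', dif_neg h]
  have hev := X.tau2_even c' 0 1 (by decide)
  have hsurj : ∀ t, Function.Injective (c' ∘ X.vt t) → ∀ k, ∃ i, (c' ∘ X.vt t) i = k :=
    fun t ht => Finite.surjective_of_injective ht
  by_contra hcon
  have : X.tau2 c' 0 1 = n 3 := by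
    simp only [tau2, hn]
    congr 1
    ext t
    simp only [Finset.mem_filter, Finset.mem_univ, true_and]
    constructor
    · rintro ⟨hi, -, -⟩
      by_cases ht : ∃ i, X.vt t i ∈ C
      · exfalso
        refine hcon ⟨t, ht, fun k => ?_⟩
        obtain ⟨i, hi⟩ := hsurj t hi k
        refine ⟨i, hi ▸ ?_⟩
        by_cases hiC : X.vt t i ∈ C
        · exact (hc'2 _ hiC).symm
        · obtain ⟨j, hj⟩ := ht
          rcases hN _ hj (X.vt t i) ⟨t, j, i, rfl, rfl⟩ with h | ⟨l, hl⟩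
          · exact absurd h hiC
          · rw [hχ l _ hl]
            apply Fin.castSucc_injective
            rw [Function.comp, hc'1 _ hiC, hcA l _ hl]
      · push Not at ht
        refine ⟨fun i j hij => hi ?_, fun i h => ht i ((hcC _).1 h)⟩
        apply Fin.castSucc_injective
        simp only [Function.comp] at hij ⊢
        rw [hc'1 _ (ht i), hc'1 _ (ht j), hij]
    · rintro ⟨hi, h3⟩
      have ht : ∀ i, X.vt t i ∉ C := fun i h => h3 i ((hcC _).2 h)
      have : Function.Injective (c' ∘ X.vt t) := fun i j hij => hi (by
        simp only [Function.comp] at hij ⊢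
        rw [← hc'1 _ (ht i), ← hc'1 _ (ht j), hij])
      exact ⟨this, hsurj t this 0, hsurj t this 1⟩
  rw [this, hn3] at hev
  exact absurd hev (by decide)
end Cx
end FLP

namespace FLP
open Classical

section
variable {V' Fc E' : Type}
def EO (c p : Fc × Fin 3) : Prop := c.1 = p.1 ∧ (c.2 = p.2 ∨ c.2 = p.2 + 1)
def Lk (tri : Fc → Fin 3 → V') (ed : Fc → Fin 3 → E') (c c' : Fc × Fin 3) : Prop :=
  tri c.1 c.2 = tri c'.1 c'.2 ∧ ∃ p p' : Fc × Fin 3, p ≠ p' ∧ ed p.1 p.2 = ed p'.1 p'.2 ∧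
    EO c p ∧ EO c' p'

structure Sph (tri : Fc → Fin 3 → V') (ed : Fc → Fin 3 → E') : Prop where
  hends : ∃ ends : E' → Sym2 V', ∀ t i, ends (ed t i) = s(tri t i, tri t (i+1))
  two : ∀ e, ∃ p q : Fc × Fin 3, p ≠ q ∧ ∀ s : Fc × Fin 3, ed s.1 s.2 = e ↔ s = p ∨ s = q
  link : ∀ c c' : Fc × Fin 3, tri c.1 c.2 = tri c'.1 c'.2 → Relation.EqvGen (Lk tri ed) c c'
  conn : ∀ p : V' → Prop, (∀ φ i j, p (tri φ i) → p (tri φ j)) → ∀ x y, p x → p y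
  euler : Nat.card V' + Nat.card Fc = Nat.card E' + 2

def Sphere (tri : Fc → Fin 3 → V') : Prop :=
  Finite V' ∧ Finite Fc ∧ ∃ E' : Type, Finite E' ∧ ∃ ed : Fc → Fin 3 → E', Sph tri ed

def MA (tri : Fc → Fin 3 → V') (p q : V') : Prop := ∃ φ i j, tri φ i = p ∧ tri φ j = q

theorem Lk.of_edge {tri : Fc → Fin 3 → V'} {ed : Fc → Fin 3 → E'} {c c' : Fc × Fin 3}
   (h : tri c.1 c.2 = tri c'.1 c'.2) (p p' : Fc × Fin 3) (h1 : p ≠ p')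
   (h2 : ed p.1 p.2 = ed p'.1 p'.2) (h3 : EO c p) (h4 : EO c' p') : Lk tri ed c c' :=
  ⟨h, p, p', h1, h2, h3, h4⟩

theorem sphere_init : Sphere (fun (_ : Fin 2) (i : Fin 3) => i) := by
  refine ⟨inferInstance, inferInstance, Fin 3, inferInstance, fun _ i => i, ?_, ?_, ?_, ?_, ?_⟩
  · exact ⟨fun i => s(i, i+1), fun _ _ => rfl⟩
  · intro e
    refine ⟨(0, e), (1, e), by simp, ?_⟩
    rintro ⟨a, b⟩
    simp only [Prod.mk.injEq]
    have : a = 0 ∨ a = 1 := by clear * -; revert a; decide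
    rcases this with rfl | rfl <;> simp
  · rintro ⟨a, i⟩ ⟨b, j⟩ h
    simp only at h
    subst h
    by_cases hab : a = b
    · subst hab; exact Relation.EqvGen.refl _
    · exact Relation.EqvGen.rel _ _ (Lk.of_edge rfl (a, i) (b, i) (by simp [hab]) rfl ⟨rfl, Or.inl rfl⟩ ⟨rfl, Or.inl rfl⟩)
  · intro p hp x y
    exact hp 0 x y
  · simp

/-- generic transfer of links -/
theorem link_transfer {V₂ Fc₂ E₂ : Type} {tri : Fc → Fin 3 → V'} {ed : Fc → Fin 3 → E'}
    {tri₂ : Fc₂ → Fin 3 → V₂} {ed₂ : Fc₂ → Fin 3 → E₂} (ι : V' → V₂) (m mp : Fc × Fin 3 → Fc₂ × Fin 3)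
    (hmp : Function.Injective mp)
    (he : ∀ p q, ed p.1 p.2 = ed q.1 q.2 → ed₂ (mp p).1 (mp p).2 = ed₂ (mp q).1 (mp q).2)
    (hc : ∀ c p, EO c p → ∃ c₂, EO c₂ (mp p) ∧ Relation.EqvGen (Lk tri₂ ed₂) (m c) c₂ ∧
      tri₂ c₂.1 c₂.2 = ι (tri c.1 c.2)) {c c' : Fc × Fin 3}
    (h : Relation.EqvGen (Lk tri ed) c c') : Relation.EqvGen (Lk tri₂ ed₂) (m c) (m c') := by
  induction h with
  | rel c c' h =>
    obtain ⟨h0, p, p', h1, h2, h3, h4⟩ := h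
    obtain ⟨c₂, a1, a2, a3⟩ := hc c p h3
    obtain ⟨c₂', b1, b2, b3⟩ := hc c' p' h4
    refine a2.trans _ _ _ (Relation.EqvGen.trans _ _ _ (Relation.EqvGen.rel _ _ ?_) b2.symm)
    exact Lk.of_edge (by rw [a3, b3, h0]) (mp p) (mp p') (hmp.ne h1) (he _ _ h2) a1 b1
  | refl => exact Relation.EqvGen.refl _
  | symm _ _ _ ih => exact ih.symm
  | trans _ _ _ _ _ ih1 ih2 => exact ih1.trans _ _ _ ih2

/-- Operation A: stack a vertex into face φ0 -/
def triA (tri : Fc → Fin 3 → V') (φ0 : Fc) : {φ // φ ≠ φ0} ⊕ Fin 3 → Fin 3 → Option V'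
  | .inl φ, i => some (tri φ i)
  | .inr j, i => if i = 0 then some (tri φ0 j) else if i = 1 then some (tri φ0 (j+1)) else none
def edA (ed : Fc → Fin 3 → E') (φ0 : Fc) : {φ // φ ≠ φ0} ⊕ Fin 3 → Fin 3 → E' ⊕ Fin 3
  | .inl φ, i => .inl (ed φ i)
  | .inr j, i => if i = 0 then .inl (ed φ0 j) else if i = 1 then .inr (j+1) else .inr j

theorem fin3_cases (i : Fin 3) : i = 0 ∨ i = 1 ∨ i = 2 := by revert i; decide

noncomputable def mpA (φ0 : Fc) (p : Fc × Fin 3) : ({φ // φ ≠ φ0} ⊕ Fin 3) × Fin 3 :=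
  if h : p.1 = φ0 then (.inr p.2, 0) else (.inl ⟨p.1, h⟩, p.2)
theorem mpA_0 (φ0 : Fc) (i : Fin 3) : mpA φ0 (φ0, i) = (.inr i, 0) := dif_pos rfl
theorem mpA_1 (φ0 : Fc) (φ : Fc) (h : φ ≠ φ0) (i : Fin 3) : mpA φ0 (φ, i) = (.inl ⟨φ, h⟩, i) :=
  dif_neg h
theorem mpA_inj (φ0 : Fc) : Function.Injective (mpA φ0) := by
  rintro ⟨φ, i⟩ ⟨ψ, j⟩ hij
  by_cases h1 : φ = φ0 <;> by_cases h2 : ψ = φ0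
  · subst h1; subst h2; rw [mpA_0, mpA_0] at hij; cases hij; rfl
  · subst h1; rw [mpA_0, mpA_1 _ _ h2] at hij; cases hij
  · subst h2; rw [mpA_0, mpA_1 _ _ h1] at hij; cases hij
  · rw [mpA_1 _ _ h1, mpA_1 _ _ h2] at hij; cases hij; rfl
theorem mpA_e (ed : Fc → Fin 3 → E') (φ0 : Fc) (p : Fc × Fin 3) :
    edA ed φ0 (mpA φ0 p).1 (mpA φ0 p).2 = .inl (ed p.1 p.2) := by
  obtain ⟨φ, i⟩ := p
  by_cases h1 : φ = φ0
  · subst h1; rw [mpA_0]; simp [edA]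
  · rw [mpA_1 _ _ h1]; simp [edA]
theorem mpA_t (tri : Fc → Fin 3 → V') (φ0 : Fc) (p : Fc × Fin 3) :
    triA tri φ0 (mpA φ0 p).1 (mpA φ0 p).2 = some (tri p.1 p.2) := by
  obtain ⟨φ, i⟩ := p
  by_cases h1 : φ = φ0
  · subst h1; rw [mpA_0]; simp [triA]
  · rw [mpA_1 _ _ h1]; simp [triA]

theorem sphere_A {tri : Fc → Fin 3 → V'} (h : Sphere tri) (φ0 : Fc) : Sphere (triA tri φ0) := by
  obtain ⟨fV, fF, E', fE, ed, hends, two, link, conn, euler⟩ := h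
  refine ⟨inferInstance, inferInstance, E' ⊕ Fin 3, inferInstance, edA ed φ0, ?_, ?_, ?_, ?_, ?_⟩
  · obtain ⟨ends, hends⟩ := hends
    refine ⟨Sum.elim (fun e => (ends e).map some) (fun j => s(some (tri φ0 j), none)), ?_⟩
    rintro (φ | j) i
    · simp [edA, triA, hends]
    · rcases fin3_cases i with rfl | rfl | rfl
      · simp [edA, triA, hends]
      · simp [edA, triA]
      · simp [edA, triA]
  all_goals
    have mpe := mpA_e ed φ0
    have mpinj := mpA_inj φ0
    have mp0 := mpA_0 φ0
    have mp1 := mpA_1 φ0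
    have mpt := mpA_t tri φ0
    set mp := mpA φ0
  · rintro (e | j)
    · obtain ⟨p, q, hpq, h⟩ := two e
      refine ⟨mp p, mp q, mpinj.ne hpq, ?_⟩
      intro s
      constructor
      · intro hs
        have : ∃ s0, s = mp s0 := by
          obtain ⟨φ | j, i⟩ := s
          · exact ⟨(φ.1, i), by rw [mp1 _ φ.2]⟩
          · rcases fin3_cases i with rfl | rfl | rfl
            · exact ⟨(φ0, j), (mp0 j).symm⟩
            · simp [edA] at hs
            · simp [edA] at hs
        obtain ⟨s0, rfl⟩ := this
        rw [mpe] at hs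
        rcases (h s0).1 (Sum.inl_injective hs) with rfl | rfl <;> simp
      · rintro (rfl | rfl) <;> rw [mpe]
        · rw [(h p).2 (Or.inl rfl)]
        · rw [(h q).2 (Or.inr rfl)]
    · refine ⟨(.inr j, 2), (.inr (j+2), 1), by simp, ?_⟩
      rintro ⟨φ | k, i⟩
      · simp [edA]
      · clear * -
        rcases fin3_cases i with rfl | rfl | rfl
        · simp [edA]
        · simp [edA]; revert j k; decide
        · simp [edA]
  · have sp : ∀ j : Fin 3, Relation.EqvGen (Lk (triA tri φ0) (edA ed φ0)) (.inr j, 1) (.inr (j+1), 0) := by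
      intro j
      refine Relation.EqvGen.rel _ _ (Lk.of_edge (by simp [triA]) (.inr j, 1) (.inr (j+1), 2) (by simp) (by simp [edA]) ?_ ?_)
      · exact ⟨rfl, Or.inl rfl⟩
      · exact ⟨rfl, Or.inr rfl⟩
    have sq : ∀ j : Fin 3, Relation.EqvGen (Lk (triA tri φ0) (edA ed φ0)) (.inr j, 2) (.inr (j+1), 2) := by
      intro j
      refine Relation.EqvGen.rel _ _ (Lk.of_edge (by simp [triA]) (.inr j, 1) (.inr (j+1), 2) (by simp) (by simp [edA]) ?_ ?_)
      · exact ⟨rfl, Or.inr rfl⟩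
      · exact ⟨rfl, Or.inl rfl⟩
    have tr : ∀ {c c' : Fc × Fin 3}, Relation.EqvGen (Lk tri ed) c c' →
        Relation.EqvGen (Lk (triA tri φ0) (edA ed φ0)) (mp c) (mp c') := by
      intro c c' h
      refine link_transfer some mp mp mpinj (fun p q h => by rw [mpe, mpe, h]) ?_ h
      rintro ⟨φ, i⟩ ⟨ψ, j⟩ ⟨h1, h2⟩
      simp only at h1 h2
      subst h1
      by_cases h : φ = φ0
      · subst h
        rcases h2 with rfl | rfl
        · exact ⟨mp (φ, i), ⟨rfl, Or.inl rfl⟩, Relation.EqvGen.refl _, mpt _⟩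
        · refine ⟨(.inr j, 1), ?_, ?_, ?_⟩
          · rw [mp0]; exact ⟨rfl, Or.inr rfl⟩
          · rw [mp0]; exact (sp j).symm
          · simp [triA]
      · refine ⟨mp (φ, i), ?_, Relation.EqvGen.refl _, mpt _⟩
        rw [mp1 _ h, mp1 _ h]; exact ⟨rfl, h2⟩
    have rep : ∀ c : ({φ // φ ≠ φ0} ⊕ Fin 3) × Fin 3, triA tri φ0 c.1 c.2 ≠ none → ∃ c0,
        Relation.EqvGen (Lk (triA tri φ0) (edA ed φ0)) c (mp c0) ∧
        triA tri φ0 c.1 c.2 = some (tri c0.1 c0.2) := by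
      rintro ⟨φ | j, i⟩ hc
      · refine ⟨(φ.1, i), ?_, by simp [triA]⟩
        rw [mp1 _ φ.2]; exact Relation.EqvGen.refl _
      · rcases fin3_cases i with rfl | rfl | rfl
        · exact ⟨(φ0, j), by rw [mp0]; exact Relation.EqvGen.refl _, by simp [triA]⟩
        · exact ⟨(φ0, j+1), by rw [mp0]; exact sp j, by simp [triA]⟩
        · simp [triA] at hc
    intro c c' hcc
    by_cases hn : triA tri φ0 c.1 c.2 = none
    · have hn' := hcc.symm.trans hn
      have key : ∀ c : ({φ // φ ≠ φ0} ⊕ Fin 3) × Fin 3, triA tri φ0 c.1 c.2 = none →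
          Relation.EqvGen (Lk (triA tri φ0) (edA ed φ0)) c (.inr 0, 2) := by
        rintro ⟨φ | j, i⟩ hc
        · simp [triA] at hc
        · rcases fin3_cases i with rfl | rfl | rfl
          · simp [triA] at hc
          · simp [triA] at hc
          · rcases fin3_cases j with rfl | rfl | rfl
            · exact Relation.EqvGen.refl _
            · exact (sq 0).symm
            · exact sq 2
      exact (key c hn).trans _ _ _ (key c' hn').symm
    · obtain ⟨c0, h1, h2⟩ := rep c hn
      obtain ⟨c1, h3, h4⟩ := rep c' (by rw [← hcc]; exact hn)
      refine h1.trans _ _ _ (Relation.EqvGen.trans _ _ _ (tr (link _ _ ?_)) h3.symm)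
      rw [h2, h4] at hcc
      exact Option.some.inj hcc
  · intro p hp
    have f : ∀ j, (p (some (tri φ0 j)) ↔ p none) ∧ (p (some (tri φ0 (j+1))) ↔ p none) := by
      intro j
      exact ⟨⟨hp (.inr j) 0 2, hp (.inr j) 2 0⟩, ⟨hp (.inr j) 1 2, hp (.inr j) 2 1⟩⟩
    have h1 : ∀ x y, p (some x) → p (some y) := by
      refine conn (fun v => p (some v)) ?_
      intro φ i j hi
      by_cases h : φ = φ0
      · subst h; exact (f j).1.2 ((f i).1.1 hi)
      · exact hp (.inl ⟨φ, h⟩) i j hi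
    rintro (_ | x) (_ | y) h
    · exact h
    · exact h1 (tri φ0 0) y ((f 0).1.2 h)
    · exact (f 0).1.1 (h1 x _ h)
    · exact h1 x y h
  · have : Nat.card {φ // φ ≠ φ0} + 1 = Nat.card Fc := by
      have := Fintype.ofFinite Fc
      rw [Nat.card_eq_fintype_card, Nat.card_eq_fintype_card, Fintype.card_subtype_compl, Fintype.card_subtype_eq]
      have : 0 < Fintype.card Fc := Fintype.card_pos_iff.2 ⟨φ0⟩
      omega
    rw [Nat.card_sum, Nat.card_sum, Nat.card_eq_fintype_card (α := Fin 3), Fintype.card_fin,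
      Finite.card_option]
    omega
end
end FLP

namespace FLP
open Classical

section
variable {V' Fc E' : Type}
/-- Operation B: open the side `(φ0,i0)` -/
def triB (tri : Fc → Fin 3 → V') (φ0 : Fc) (i0 : Fin 3) : Fc ⊕ Fin 2 → Fin 3 → Option V'
  | .inl φ, i => some (tri φ i)
  | .inr _, i => if i = 0 then some (tri φ0 i0) else if i = 1 then some (tri φ0 (i0+1)) else none
noncomputable def edB (ed : Fc → Fin 3 → E') (φ0 : Fc) (i0 : Fin 3) :
    Fc ⊕ Fin 2 → Fin 3 → E' ⊕ Fin 3
  | .inl φ, i => if (φ, i) = (φ0, i0) then .inr 0 else .inl (ed φ i)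
  | .inr k, i => if i = 0 then (if k = 0 then .inl (ed φ0 i0) else .inr 0) else
      if i = 1 then .inr 2 else .inr 1
noncomputable def mpB (φ0 : Fc) (i0 : Fin 3) (p : Fc × Fin 3) : (Fc ⊕ Fin 2) × Fin 3 :=
  if p = (φ0, i0) then (.inr 0, 0) else (.inl p.1, p.2)

theorem mpB_0 (φ0 : Fc) (i0 : Fin 3) : mpB φ0 i0 (φ0, i0) = (.inr 0, 0) := if_pos rfl
theorem mpB_1 (φ0 : Fc) (i0 : Fin 3) (p : Fc × Fin 3) (h : p ≠ (φ0, i0)) :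
    mpB φ0 i0 p = (.inl p.1, p.2) := if_neg h
theorem mpB_inj (φ0 : Fc) (i0 : Fin 3) : Function.Injective (mpB φ0 i0) := by
  intro p q hij
  by_cases h1 : p = (φ0, i0) <;> by_cases h2 : q = (φ0, i0)
  · rw [h1, h2]
  · subst h1; rw [mpB_0, mpB_1 _ _ _ h2] at hij; cases hij
  · subst h2; rw [mpB_0, mpB_1 _ _ _ h1] at hij; cases hij
  · rw [mpB_1 _ _ _ h1, mpB_1 _ _ _ h2] at hij
    simp only [Prod.mk.injEq, Sum.inl.injEq] at hij
    exact Prod.ext hij.1 hij.2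
theorem mpB_e (ed : Fc → Fin 3 → E') (φ0 : Fc) (i0 : Fin 3) (p : Fc × Fin 3) :
    edB ed φ0 i0 (mpB φ0 i0 p).1 (mpB φ0 i0 p).2 = .inl (ed p.1 p.2) := by
  by_cases h1 : p = (φ0, i0)
  · subst h1; rw [mpB_0]; simp [edB]
  · rw [mpB_1 _ _ _ h1]; simp only [edB]; rw [if_neg h1]

theorem sphere_B {tri : Fc → Fin 3 → V'} (h : Sphere tri) (φ0 : Fc) (i0 : Fin 3) :
    Sphere (triB tri φ0 i0) := by
  obtain ⟨fV, fF, E', fE, ed, hends, two, link, conn, euler⟩ := h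
  refine ⟨inferInstance, inferInstance, E' ⊕ Fin 3, inferInstance, edB ed φ0 i0, ?_, ?_, ?_, ?_, ?_⟩
  · obtain ⟨ends, hends⟩ := hends
    refine ⟨Sum.elim (fun e => (ends e).map some) (fun j =>
      if j = 0 then s(some (tri φ0 i0), some (tri φ0 (i0 + 1))) else
      if j = 1 then s(some (tri φ0 i0), none) else s(some (tri φ0 (i0 + 1)), none)), ?_⟩
    rintro (φ | j) i
    · by_cases h : (φ, i) = (φ0, i0)
      · simp only [edB, if_pos h]
        cases h
        simp [triB]
      · simp only [edB, if_neg h]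
        simp [triB, hends]
    · have hj : j = 0 ∨ j = 1 := by clear * -; revert j; decide
      rcases fin3_cases i with rfl | rfl | rfl <;> rcases hj with rfl | rfl <;>
        simp [edB, triB, hends]
  all_goals
    have mpe := mpB_e ed φ0 i0
    have mpinj := mpB_inj φ0 i0
    have mp0 := mpB_0 φ0 i0
    have mp1 := mpB_1 φ0 i0
    set mp := mpB φ0 i0
  · rintro (e | j)
    · obtain ⟨p, q, hpq, h⟩ := two e
      refine ⟨mp p, mp q, mpinj.ne hpq, ?_⟩
      intro s
      constructor
      · intro hs
        have : ∃ s0, s = mp s0 := by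
          obtain ⟨φ | j, i⟩ := s
          · by_cases h : (φ, i) = (φ0, i0)
            · simp only [edB, if_pos h] at hs; cases hs
            · exact ⟨(φ, i), by rw [mp1 _ h]⟩
          · have hj : j = 0 ∨ j = 1 := by clear * -; revert j; decide
            rcases fin3_cases i with rfl | rfl | rfl <;> rcases hj with rfl | rfl
            · exact ⟨_, mp0.symm⟩
            all_goals simp [edB] at hs
        obtain ⟨s0, rfl⟩ := this
        rw [mpe] at hs
        rcases (h s0).1 (Sum.inl_injective hs) with rfl | rfl <;> simp
      · rintro (rfl | rfl) <;> rw [mpe]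
        · rw [(h p).2 (Or.inl rfl)]
        · rw [(h q).2 (Or.inr rfl)]
    · rcases fin3_cases j with rfl | rfl | rfl
      · refine ⟨(.inl φ0, i0), (.inr 1, 0), by simp, ?_⟩
        rintro ⟨φ | k, i⟩
        · by_cases h : (φ, i) = (φ0, i0)
          · simp only [edB, if_pos h]; cases h; simp
          · simp only [edB, if_neg h]; simpa using h
        · have hj : k = 0 ∨ k = 1 := by clear * -; revert k; decide
          rcases fin3_cases i with rfl | rfl | rfl <;> rcases hj with rfl | rfl <;> simp [edB]
      · refine ⟨(.inr 0, 2), (.inr 1, 2), by simp, ?_⟩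
        rintro ⟨φ | k, i⟩
        · by_cases h : (φ, i) = (φ0, i0)
          · simp only [edB, if_pos h]; simp
          · simp only [edB, if_neg h]; simp
        · have hj : k = 0 ∨ k = 1 := by clear * -; revert k; decide
          rcases fin3_cases i with rfl | rfl | rfl <;> rcases hj with rfl | rfl <;> simp [edB]
      · refine ⟨(.inr 0, 1), (.inr 1, 1), by simp, ?_⟩
        rintro ⟨φ | k, i⟩
        · by_cases h : (φ, i) = (φ0, i0)
          · simp only [edB, if_pos h]; simp
          · simp only [edB, if_neg h]; simp
        · have hj : k = 0 ∨ k = 1 := by clear * -; revert k; decide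
          rcases fin3_cases i with rfl | rfl | rfl <;> rcases hj with rfl | rfl <;> simp [edB]
  · have q0 : Relation.EqvGen (Lk (triB tri φ0 i0) (edB ed φ0 i0)) (.inl φ0, i0) (.inr 1, 0) :=
      Relation.EqvGen.rel _ _ (Lk.of_edge (by simp [triB]) (.inl φ0, i0) (.inr 1, 0) (by simp)
        (by simp [edB]) ⟨rfl, Or.inl rfl⟩ ⟨rfl, Or.inl rfl⟩)
    have q1 : Relation.EqvGen (Lk (triB tri φ0 i0) (edB ed φ0 i0)) (.inl φ0, i0 + 1) (.inr 1, 1) :=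
      Relation.EqvGen.rel _ _ (Lk.of_edge (by simp [triB]) (.inl φ0, i0) (.inr 1, 0) (by simp)
        (by simp [edB]) ⟨rfl, Or.inr rfl⟩ ⟨rfl, Or.inr rfl⟩)
    have r0 : Relation.EqvGen (Lk (triB tri φ0 i0) (edB ed φ0 i0)) (.inr 1, 0) (.inr 0, 0) :=
      Relation.EqvGen.rel _ _ (Lk.of_edge (by simp [triB]) (.inr 1, 2) (.inr 0, 2) (by simp)
        (by simp [edB]) ⟨rfl, Or.inr rfl⟩ ⟨rfl, Or.inr rfl⟩)
    have r1 : Relation.EqvGen (Lk (triB tri φ0 i0) (edB ed φ0 i0)) (.inr 1, 1) (.inr 0, 1) :=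
      Relation.EqvGen.rel _ _ (Lk.of_edge (by simp [triB]) (.inr 1, 1) (.inr 0, 1) (by simp)
        (by simp [edB]) ⟨rfl, Or.inl rfl⟩ ⟨rfl, Or.inl rfl⟩)
    have r2 : Relation.EqvGen (Lk (triB tri φ0 i0) (edB ed φ0 i0)) (.inr 1, 2) (.inr 0, 2) :=
      Relation.EqvGen.rel _ _ (Lk.of_edge (by simp [triB]) (.inr 1, 2) (.inr 0, 2) (by simp)
        (by simp [edB]) ⟨rfl, Or.inl rfl⟩ ⟨rfl, Or.inl rfl⟩)
    set m : Fc × Fin 3 → (Fc ⊕ Fin 2) × Fin 3 := fun p => (.inl p.1, p.2) with hm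
    have tr : ∀ {c c' : Fc × Fin 3}, Relation.EqvGen (Lk tri ed) c c' →
        Relation.EqvGen (Lk (triB tri φ0 i0) (edB ed φ0 i0)) (m c) (m c') := by
      intro c c' h
      refine link_transfer some m mp mpinj (fun p q h => by rw [mpe, mpe, h]) ?_ h
      rintro ⟨φ, i⟩ ⟨ψ, j⟩ ⟨h1, h2⟩
      simp only at h1 h2
      subst h1
      by_cases h : (φ, j) = (φ0, i0)
      · cases h
        rcases h2 with rfl | rfl
        · refine ⟨(.inr 0, 0), ?_, q0.trans _ _ _ r0, by simp [triB]⟩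
          rw [mp0]; exact ⟨rfl, Or.inl rfl⟩
        · refine ⟨(.inr 0, 1), ?_, q1.trans _ _ _ r1, by simp [triB]⟩
          rw [mp0]; exact ⟨rfl, Or.inr rfl⟩
      · refine ⟨m (φ, i), ?_, Relation.EqvGen.refl _, by simp [triB, hm]⟩
        rw [mp1 _ h]; exact ⟨rfl, h2⟩
    have rep : ∀ c : (Fc ⊕ Fin 2) × Fin 3, triB tri φ0 i0 c.1 c.2 ≠ none → ∃ c0,
        Relation.EqvGen (Lk (triB tri φ0 i0) (edB ed φ0 i0)) c (m c0) ∧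
        triB tri φ0 i0 c.1 c.2 = some (tri c0.1 c0.2) := by
      rintro ⟨φ | j, i⟩ hc
      · exact ⟨(φ, i), Relation.EqvGen.refl _, by simp [triB]⟩
      · have hj : j = 0 ∨ j = 1 := by clear * -; revert j; decide
        rcases fin3_cases i with rfl | rfl | rfl
        · refine ⟨(φ0, i0), ?_, by simp [triB]⟩
          rcases hj with rfl | rfl
          · exact (q0.trans _ _ _ r0).symm
          · exact q0.symm
        · refine ⟨(φ0, i0+1), ?_, by simp [triB]⟩
          rcases hj with rfl | rfl
          · exact (q1.trans _ _ _ r1).symm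
          · exact q1.symm
        · simp [triB] at hc
    intro c c' hcc
    by_cases hn : triB tri φ0 i0 c.1 c.2 = none
    · have hn' := hcc.symm.trans hn
      have key : ∀ c : (Fc ⊕ Fin 2) × Fin 3, triB tri φ0 i0 c.1 c.2 = none →
          Relation.EqvGen (Lk (triB tri φ0 i0) (edB ed φ0 i0)) c (.inr 0, 2) := by
        rintro ⟨φ | j, i⟩ hc
        · simp [triB] at hc
        · have hj : j = 0 ∨ j = 1 := by clear * -; revert j; decide
          rcases fin3_cases i with rfl | rfl | rfl
          · simp [triB] at hc
          · simp [triB] at hc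
          · rcases hj with rfl | rfl
            · exact Relation.EqvGen.refl _
            · exact r2
      exact (key c hn).trans _ _ _ (key c' hn').symm
    · obtain ⟨c0, h1, h2⟩ := rep c hn
      obtain ⟨c1, h3, h4⟩ := rep c' (by rw [← hcc]; exact hn)
      refine h1.trans _ _ _ (Relation.EqvGen.trans _ _ _ (tr (link _ _ ?_)) h3.symm)
      rw [h2, h4] at hcc
      exact Option.some.inj hcc
  · intro p hp
    have f : p (some (tri φ0 i0)) ↔ p none := ⟨hp (.inr 0) 0 2, hp (.inr 0) 2 0⟩
    have h1 : ∀ x y, p (some x) → p (some y) :=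
      conn (fun v => p (some v)) fun φ i j hi => hp (.inl φ) i j hi
    rintro (_ | x) (_ | y) h
    · exact h
    · exact h1 _ y (f.2 h)
    · exact f.1 (h1 x _ h)
    · exact h1 x y h
  · rw [Nat.card_sum, Nat.card_sum, Nat.card_eq_fintype_card (α := Fin 3),
      Nat.card_eq_fintype_card (α := Fin 2), Fintype.card_fin, Fintype.card_fin,
      Finite.card_option]
    omega

def c3 (n : ℕ) : Fin 3 := ⟨n % 3, Nat.mod_lt _ (by norm_num)⟩
theorem c3_succ (n : ℕ) : c3 (n + 1) = c3 n + 1 := by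
  apply Fin.ext; simp [c3, Fin.val_add]

theorem sphere_planar {tri : Fc → Fin 3 → V'} (h : Sphere tri) [Nonempty V'] {α : Type}
    (H : SimpleGraph α) (f : α → V') (hf : Function.Injective f)
    (hH : ∀ a b, H.Adj a b → MA tri (f a) (f b)) : IsPlanar H := by
  obtain ⟨fV, fF, E', fE, ed, ⟨ends, hends⟩, two, link, conn, euler⟩ := h
  let M : Multigraph V' E' := ⟨ends⟩
  have hcast : ∀ i : ℕ, c3 (i + 3) = c3 i := fun i => by
    apply Fin.ext; simp [c3]
  let bd : Fc → M.CWalk := fun φ =>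
    { len := 3, len_pos := by norm_num, vtx := fun n => tri φ (c3 n),
      edge := fun n => ed φ (c3 n),
      vtx_per := fun i => by rw [hcast], edge_per := fun i => by rw [hcast],
      compat := fun i => by rw [c3_succ]; exact hends φ _ }
  have hadj : ∀ φ i j, tri φ i ≠ tri φ j → M.simple.Adj (tri φ i) (tri φ j) := by
    intro φ i j hne
    refine ⟨hne, ?_⟩
    have : i = j ∨ j = i + 1 ∨ i = j + 1 := by clear * -; revert i j; decide
    rcases this with rfl | rfl | rfl
    · exact absurd rfl hne
    · exact ⟨ed φ i, hends φ i⟩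
    · exact ⟨ed φ j, (hends φ j).trans Sym2.eq_swap⟩
  have hval : ∀ i : Fin 3, c3 i.val = i := fun i => by
    apply Fin.ext; simp [c3]
  have hval' : ∀ i : ℕ, i < 3 → ((c3 i) : ℕ) = i := fun i hi => by
    simp [c3, Nat.mod_eq_of_lt hi]
  let emb : M.Embedding Fc :=
    { boundary := bd
      conn := by
        refine SimpleGraph.Connected.mk fun x y => ?_
        refine conn (fun w => M.simple.Reachable x w) ?_ x y (SimpleGraph.Reachable.refl _)
        intro φ i j hi
        by_cases h : tri φ i = tri φ j
        · simpa [← h] using hi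
        · exact hi.trans (hadj φ i j h).reachable
      edge_twice := by
        intro e
        obtain ⟨p, q, hpq, h⟩ := two e
        have : {s : Fc × ℕ | Multigraph.IsOcc bd e s} = {(p.1, (p.2 : ℕ)), (q.1, (q.2 : ℕ))} := by
          ext ⟨φ, n⟩
          simp only [Set.mem_ofPred_eq, Multigraph.IsOcc, Set.mem_insert_iff, Set.mem_singleton_iff]
          constructor
          · rintro ⟨h1, h2⟩
            have h1 : n < 3 := h1
            have := (h (φ, (c3 n))).1 h2
            rcases this with h3 | h3
            · left; rw [← h3]; simp [hval' n h1, Nat.mod_eq_of_lt h1]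
            · right; rw [← h3]; simp [hval' n h1, Nat.mod_eq_of_lt h1]
          · rintro (h3 | h3) <;> cases h3
            · refine ⟨p.2.2, ?_⟩
              show ed p.1 _ = e
              rw [hval]; exact (h p).2 (Or.inl rfl)
            · refine ⟨q.2.2, ?_⟩
              show ed q.1 _ = e
              rw [hval]; exact (h q).2 (Or.inr rfl)
        rw [this, Set.ncard_pair]
        intro h
        apply hpq
        simp only [Prod.mk.injEq] at h
        exact Prod.ext h.1 (Fin.ext h.2)
      link_conn := by
        rintro v ⟨φ, i⟩ ⟨ψ, j⟩ ⟨h1, h2⟩ ⟨h3, h4⟩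
        have h1 : i < 3 := h1
        have h3 : j < 3 := h3
        have h2 : tri φ (c3 i) = v := h2
        have h4 : tri ψ (c3 j) = v := h4
        have key : ∀ c c' : Fc × Fin 3, Relation.EqvGen (Lk tri ed) c c' → tri c.1 c.2 = v →
            Relation.EqvGen (Multigraph.CornerLinked bd v) (c.1, (c.2 : ℕ)) (c'.1, (c'.2 : ℕ)) ∧ 
            tri c'.1 c'.2 = v := by
          intro c c' hcc
          have key2 : ∀ c c' : Fc × Fin 3, Lk tri ed c c' → tri c.1 c.2 = v → 
            Multigraph.CornerLinked bd v (c.1, (c.2 : ℕ)) (c'.1, (c'.2 : ℕ)) := by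
            rintro c c' ⟨h0, p, p', a1, a2, a3, a4⟩ hv
            refine ⟨⟨c.2.2, ?_⟩, ⟨c'.2.2, ?_⟩, ed p.1 p.2, (p.1, p.2), (p'.1, p'.2), ?_,
              ⟨p.2.2, ?_⟩, ⟨p'.2.2, ?_⟩, ⟨a3.1, ?_⟩, ⟨a4.1, ?_⟩⟩
            · show tri c.1 _ = v
              rw [hval]; exact hv
            · show tri c'.1 _ = v
              rw [hval, ← h0]; exact hv
            · intro h
              apply a1
              simp only [Prod.mk.injEq] at h
              exact Prod.ext h.1 (Fin.ext h.2)
            · show ed p.1 _ = _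
              rw [hval]
            · show ed p'.1 _ = _
              rw [hval]; exact a2.symm
            · rcases a3.2 with h | h
              · left; rw [h]
              · right; rw [h]; show ((p.2 + 1 : Fin 3) : ℕ) = (p.2.val + 1) % 3; simp [Fin.val_add]
            · rcases a4.2 with h | h
              · left; rw [h]
              · right; rw [h]; show ((p'.2 + 1 : Fin 3) : ℕ) = (p'.2.val + 1) % 3; simp [Fin.val_add]
          suffices hh : (tri c.1 c.2 = tri c'.1 c'.2) ∧ (tri c.1 c.2 = v → 
            Relation.EqvGen (Multigraph.CornerLinked bd v) (c.1, (c.2 : ℕ)) (c'.1, (c'.2 : ℕ))) from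
            fun h => ⟨hh.2 h, hh.1 ▸ h⟩
          induction hcc with
          | rel a b h => exact ⟨h.1, fun hv => Relation.EqvGen.rel _ _ (key2 a b h hv)⟩
          | refl => exact ⟨rfl, fun _ => Relation.EqvGen.refl _⟩
          | symm _ _ _ ih => exact ⟨ih.1.symm, fun hv => (ih.2 (ih.1.trans hv)).symm⟩
          | trans _ _ _ _ _ i1 i2 => 
            exact ⟨i1.1.trans i2.1, fun hv => (i1.2 hv).trans _ _ _ (i2.2 (i1.1 ▸ hv))⟩
        have := (key (φ, (c3 i)) (ψ, (c3 j)) (link _ _ (by rw [h2, h4])) h2).1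
        simpa only [hval' i h1, hval' j h3] using this }
  refine ⟨V', E', Fc, fV, fE, fF, M, emb, ?_, ⟨f, ?_⟩, hf⟩
  · simp only [Multigraph.Embedding.eulerGenus]
    push_cast
    omega
  · intro a b hab
    obtain ⟨φ, i, j, h1, h2⟩ := hH a b hab
    rw [← h1, ← h2]
    exact hadj φ i j (by rw [h1, h2]; exact hf.ne hab.ne)
end
end FLP

namespace FLP
open Classical

section
variable {V' Fc : Type}

def TD (tri : Fc → Fin 3 → V') : Prop :=
  ∃ (ι : Type) (Tr : SimpleGraph ι) (B : ι → Set V'), Tr.IsTree ∧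
    (∀ φ, ∃ n, ∀ i, tri φ i ∈ B n) ∧ (∀ v, (Tr.induce {n | v ∈ B n}).Connected) ∧
    ∀ n, (B n).encard ≤ 4

def leafGraph {ι : Type} (Tr : SimpleGraph ι) (n0 : ι) : SimpleGraph (Option ι) where
  Adj x y := (∃ a b, x = some a ∧ y = some b ∧ Tr.Adj a b) ∨ (x = none ∧ y = some n0) ∨
    (x = some n0 ∧ y = none)
  symm := by
    constructor
    rintro x y (⟨a, b, rfl, rfl, h⟩ | ⟨rfl, rfl⟩ | ⟨rfl, rfl⟩)
    · exact Or.inl ⟨b, a, rfl, rfl, h.symm⟩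
    · exact Or.inr (Or.inr ⟨rfl, rfl⟩)
    · exact Or.inr (Or.inl ⟨rfl, rfl⟩)
  loopless := by
    constructor
    rintro x (⟨a, b, rfl, h, h'⟩ | ⟨rfl, h⟩ | ⟨rfl, h⟩)
    · cases h; exact h'.ne rfl
    · cases h
    · cases h

theorem reach_pred {α : Type} {G : SimpleGraph α} (p : α → Prop) (hp : ∀ u v, G.Adj u v → p u → p v)
    {x y : α} (h : G.Reachable x y) (hx : p x) : p y := by
  obtain ⟨w⟩ := h
  induction w with
  | nil => exact hx
  | cons h _ ih => exact ih (hp _ _ h hx)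

theorem leafGraph_tree {ι : Type} {Tr : SimpleGraph ι} (h : Tr.IsTree) (n0 : ι) :
    (leafGraph Tr n0).IsTree := by
  refine ⟨?_, ?_⟩
  · have h1 : ∀ a b, (leafGraph Tr n0).Reachable (some a) (some b) := by
      intro a b
      refine reach_pred (fun w => (leafGraph Tr n0).Reachable (some a) (some w)) ?_
        (h.connected.preconnected a b) (SimpleGraph.Reachable.refl _)
      intro u v huv hu
      refine hu.trans (SimpleGraph.Adj.reachable ?_)
      exact Or.inl ⟨u, v, rfl, rfl, huv⟩
    have h2 : (leafGraph Tr n0).Reachable none (some n0) :=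
      SimpleGraph.Adj.reachable (Or.inr (Or.inl ⟨rfl, rfl⟩))
    rw [SimpleGraph.connected_iff_exists_forall_reachable]
    refine ⟨some n0, ?_⟩
    rintro (_ | x)
    · exact h2.symm
    · exact h1 _ _
  · have hac := h.isAcyclic
    rw [SimpleGraph.isAcyclic_iff_forall_adj_isBridge] at hac ⊢
    have hn : ∀ x y : Option ι, s(x, y) = s(none, some n0) → 
      ¬ ((leafGraph Tr n0).deleteEdges {s(x, y)}).Reachable none (some n0) := by
      intro x y hxy hr
      have := reach_pred (fun w => w = none) ?_ hr rfl
      · cases this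
      · rintro u v huv rfl
        rw [SimpleGraph.deleteEdges_adj] at huv
        obtain ⟨⟨a, b, h1, -, -⟩ | ⟨-, rfl⟩ | ⟨-, rfl⟩, h2⟩ := huv
        · cases h1
        · rw [hxy] at h2; exact absurd rfl h2
        · rfl
    rintro x y (⟨a, b, rfl, rfl, hab⟩ | ⟨rfl, rfl⟩ | ⟨rfl, rfl⟩)
    · have hb := hac hab
      rw [SimpleGraph.isBridge_iff] at hb ⊢
      intro hr
      apply hb
      refine reach_pred (fun w => (Tr.deleteEdges {s(a, b)}).Reachable a (w.getD n0)) ?_ hr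
        (SimpleGraph.Reachable.refl _)
      rintro u v huv hu
      rw [SimpleGraph.deleteEdges_adj] at huv
      obtain ⟨⟨c, d, rfl, rfl, hcd⟩ | ⟨rfl, rfl⟩ | ⟨rfl, rfl⟩, h2⟩ := huv
      · refine hu.trans (SimpleGraph.Adj.reachable ?_)
        rw [SimpleGraph.deleteEdges_adj]
        refine ⟨hcd, fun h3 => h2 ?_⟩
        simp only [Set.mem_singleton_iff] at h3 ⊢
        have := congrArg (Sym2.map some) h3
        simpa using this
      · exact hu
      · exact hu
    · rw [SimpleGraph.isBridge_iff]
      exact hn _ _ rfl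
    · rw [SimpleGraph.isBridge_iff]
      intro hr
      exact hn _ _ Sym2.eq_swap hr.symm

theorem TD_leaf {Fc₂ : Type} {tri : Fc → Fin 3 → V'} (h : TD tri) (tri₂ : Fc₂ → Fin 3 → Option V')
    (S : Set V') (hS : S.encard ≤ 3) (φ0 : Fc) (hS0 : ∀ x ∈ S, ∃ i, tri φ0 i = x)
    (hf : ∀ φ, (∃ ψ, ∀ i, tri₂ φ i = some (tri ψ i)) ∨
      ∀ i, tri₂ φ i = none ∨ ∃ x ∈ S, tri₂ φ i = some x) : TD tri₂ := by
  obtain ⟨ι, Tr, B, h1, h2, h3, h4⟩ := h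
  obtain ⟨n0, hn0⟩ := h2 φ0
  set B' : Option ι → Set (Option V') := fun n => match n with
    | some n => some '' B n
    | none => insert none (some '' S) with hB'
  refine ⟨Option ι, leafGraph Tr n0, B', leafGraph_tree h1 n0, ?_, ?_, ?_⟩
  · intro φ
    rcases hf φ with ⟨ψ, hψ⟩ | hφ
    · obtain ⟨n, hn⟩ := h2 ψ
      exact ⟨some n, fun i => by rw [hψ]; exact ⟨_, hn i, rfl⟩⟩
    · refine ⟨none, fun i => ?_⟩
      rcases hφ i with h | ⟨x, hx, h⟩
      · rw [h]; exact Or.inl rfl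
      · rw [h]; exact Or.inr ⟨x, hx, rfl⟩
  · rintro (_ | v)
    · rw [SimpleGraph.connected_iff_exists_forall_reachable]
      refine ⟨⟨none, Or.inl rfl⟩, ?_⟩
      rintro ⟨_ | n, hn⟩
      · exact SimpleGraph.Reachable.refl _
      · obtain ⟨x, -, hx⟩ := hn; cases hx
    · have hm : ∀ n, some v ∈ B' (some n) ↔ v ∈ B n := by
        intro n
        exact ⟨fun ⟨x, hx, hxv⟩ => by cases hxv; exact hx, fun h => ⟨v, h, rfl⟩⟩
      have hm' : some v ∈ B' none ↔ v ∈ S := by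
        refine ⟨?_, fun h => Or.inr ⟨v, h, rfl⟩⟩
        rintro (h | ⟨x, hx, hxv⟩)
        · cases h
        · cases hxv; exact hx
      have hc := h3 v
      rw [SimpleGraph.connected_iff_exists_forall_reachable] at hc ⊢
      obtain ⟨⟨a, ha⟩, hr⟩ := hc
      have key : ∀ n (hn : v ∈ B n), ((leafGraph Tr n0).induce {n | some v ∈ B' n}).Reachable
          ⟨some a, (hm a).2 ha⟩ ⟨some n, (hm n).2 hn⟩ := by
        intro n hn
        refine reach_pred (G := Tr.induce {n | v ∈ B n})
          (fun w => ((leafGraph Tr n0).induce {n | some v ∈ B' n}).Reachable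
          ⟨some a, (hm a).2 ha⟩ ⟨some w.1, (hm w.1).2 w.2⟩) ?_ (hr ⟨n, hn⟩)
          (SimpleGraph.Reachable.refl _)
        rintro ⟨u, hu⟩ ⟨w, hw⟩ huw h
        refine h.trans (SimpleGraph.Adj.reachable ?_)
        exact Or.inl ⟨u, w, rfl, rfl, huw⟩
      refine ⟨⟨some a, (hm a).2 ha⟩, ?_⟩
      rintro ⟨_ | n, hn⟩
      · have hv : v ∈ S := hm'.1 hn
        obtain ⟨i, hi⟩ := hS0 v hv
        refine (key n0 (hi ▸ hn0 i)).trans (SimpleGraph.Adj.reachable ?_)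
        exact Or.inr (Or.inr ⟨rfl, rfl⟩)
      · exact key n ((hm n).1 hn)
  · rintro (_ | n)
    · refine (Set.encard_insert_le _ _).trans ?_
      rw [(Option.some_injective _).encard_image]
      calc S.encard + 1 ≤ 3 + 1 := by gcongr
        _ = 4 := by norm_num
    · show (some '' B n).encard ≤ 4
      rw [(Option.some_injective _).encard_image]
      exact h4 n

theorem TD_A {tri : Fc → Fin 3 → V'} (h : TD tri) (φ0 : Fc) : TD (triA tri φ0) := by
  refine TD_leaf h _ (Set.range (tri φ0)) ?_ φ0 (by rintro _ ⟨i, rfl⟩; exact ⟨i, rfl⟩) ?_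
  · rw [← Set.image_univ]
    refine (Set.encard_image_le _ _).trans ?_
    simp
  · rintro (φ | j)
    · exact Or.inl ⟨φ.1, fun i => rfl⟩
    · right
      intro i
      rcases fin3_cases i with rfl | rfl | rfl
      · exact Or.inr ⟨_, ⟨j, rfl⟩, by simp [triA]⟩
      · exact Or.inr ⟨_, ⟨j+1, rfl⟩, by simp [triA]⟩
      · exact Or.inl (by simp [triA])

theorem TD_B {tri : Fc → Fin 3 → V'} (h : TD tri) (φ0 : Fc) (i0 : Fin 3) : TD (triB tri φ0 i0) := by
  refine TD_leaf h _ (Set.range (tri φ0)) ?_ φ0 (by rintro _ ⟨i, rfl⟩; exact ⟨i, rfl⟩) ?_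
  · rw [← Set.image_univ]
    refine (Set.encard_image_le _ _).trans ?_
    simp
  · rintro (φ | j)
    · exact Or.inl ⟨φ, fun i => rfl⟩
    · right
      intro i
      rcases fin3_cases i with rfl | rfl | rfl
      · exact Or.inr ⟨_, ⟨i0, rfl⟩, by simp [triB]⟩
      · exact Or.inr ⟨_, ⟨i0+1, rfl⟩, by simp [triB]⟩
      · exact Or.inl (by simp [triB])

theorem TD_init : TD (fun (_ : Fin 2) (i : Fin 3) => i) := by
  refine ⟨Unit, ⊥, fun _ => Set.univ, SimpleGraph.IsTree.of_subsingleton, ?_, ?_, ?_⟩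
  · exact fun φ => ⟨(), fun i => trivial⟩
  · intro v
    rw [SimpleGraph.connected_iff_exists_forall_reachable]
    refine ⟨⟨(), trivial⟩, ?_⟩
    rintro ⟨⟨⟩, _⟩
    exact SimpleGraph.Reachable.refl _
  · intro n
    simp
    norm_num

theorem TD_tw {tri : Fc → Fin 3 → V'} (h : TD tri) {α : Type} (H : SimpleGraph α) (f : α → V')
    (hf : Function.Injective f) (hH : ∀ a b, H.Adj a b → MA tri (f a) (f b)) : TreewidthLE H 3 := by
  obtain ⟨ι, Tr, B, h1, h2, h3, h4⟩ := h
  refine ⟨ι, Tr, fun n => f ⁻¹' B n, h1, ?_, ?_, fun v => h3 (f v), ?_⟩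
  · intro v
    obtain ⟨⟨n, hn⟩⟩ := (h3 (f v)).nonempty
    exact ⟨n, hn⟩
  · intro u v huv
    obtain ⟨φ, i, j, h5, h6⟩ := hH u v huv
    obtain ⟨n, hn⟩ := h2 φ
    exact ⟨n, by show f u ∈ B n; rw [← h5]; exact hn i, by show f v ∈ B n; rw [← h6]; exact hn j⟩
  · intro n
    have := h4 n
    rw [← hf.encard_image]
    refine (Set.encard_le_encard (Set.image_preimage_subset _ _)).trans (this.trans ?_)
    norm_num
end
end FLP

namespace FLP
open Classical
variable {W E T : Type}
namespace Cx
variable {X : Cx W E T}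

theorem K5' [Finite W] [Fintype E] [Fintype T] (hU : X.Cn Set.univ) (A : Fin 3 → Set W) (B C : Set W)
    (hA : ∀ k, X.Cn (A k)) (hB : X.Cn B) (hC : X.Cn C)
    (hd : ∀ k l w, w ∈ A k → w ∈ A l → k = l) (hAB : ∀ k w, w ∈ A k → w ∉ B)
    (hAC : ∀ k w, w ∈ A k → w ∉ C) (hBC : ∀ w ∈ B, w ∉ C)
    (ha : ∀ k l, k ≠ l → X.Ad (A k) (A l)) (haB : ∀ k, X.Ad (A k) B) (haC : ∀ k, X.Ad (A k) C)
    (hbc : X.Ad B C) : False := by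
  refine K5 hU ![A 0, A 1, A 2, B, C] ?_ ?_ ?_
  · intro k; fin_cases k <;> simp [hA, hB, hC]
  · intro k l w hk hl
    fin_cases k <;> fin_cases l <;> simp at hk hl ⊢ <;>
    first
      | exact absurd (hd _ _ w hk hl) (by decide)
      | exact hAB _ w hk hl
      | exact hAB _ w hl hk
      | exact hAC _ w hk hl
      | exact hAC _ w hl hk
      | exact hBC w hk hl
      | exact hBC w hl hk
  · intro k l hkl
    fin_cases k <;> fin_cases l <;> simp at hkl ⊢ <;>
    first
      | exact ha _ _ (by decide)
      | exact haB _
      | exact haC _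
      | exact hbc
      | exact (haB _).symm
      | exact (haC _).symm
      | exact hbc.symm

theorem K33' [Finite W] [Fintype E] [Fintype T] (hU : X.Cn Set.univ) (A B : Fin 3 → Set W)
    (hA : ∀ k, X.Cn (A k)) (hB : ∀ k, X.Cn (B k))
    (hd : ∀ k l w, w ∈ A k → w ∈ A l → k = l) (hdB : ∀ k l w, w ∈ B k → w ∈ B l → k = l)
    (hAB : ∀ k l w, w ∈ A k → w ∉ B l)
    (ha : ∀ k l, k ≠ l → X.Ad (A k) (A l)) (haB : ∀ k l, X.Ad (A k) (B l)) : False := by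
  refine K33 hU ![A 0, A 1, A 2, B 0, B 1, B 2] ?_ ?_ ?_
  · intro k; fin_cases k <;> simp [hA, hB]
  · intro k l w hk hl
    fin_cases k <;> fin_cases l <;> simp at hk hl ⊢ <;>
    first
      | exact absurd (hd _ _ w hk hl) (by decide)
      | exact absurd (hdB _ _ w hk hl) (by decide)
      | exact hAB _ _ w hk hl
      | exact hAB _ _ w hl hk
  · intro k l hkl hk3
    fin_cases k <;> fin_cases l <;> simp at hkl hk3 ⊢ <;>
    first
      | exact ha _ _ (by decide)
      | exact haB _ _


def Comp (X : Cx W E T) (Y C : Set W) : Prop :=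
  X.Cn C ∧ (∀ w ∈ C, w ∉ Y) ∧ ∀ u ∈ C, ∀ v, X.R u v → v ∈ C ∨ v ∈ Y

theorem Cn.mk' {S : Set W} (x0 : W) (h0 : x0 ∈ S)
    (h : ∀ p : W → Prop, (∀ u ∈ S, ∀ v ∈ S, X.R u v → p u → p v) → p x0 → ∀ y ∈ S, p y) : X.Cn S := by
  refine ⟨⟨x0, h0⟩, fun p hp x hx y hy px => h p hp ?_ y hy⟩
  by_contra hn
  exact h (fun w => ¬ p w) (fun u hu v hv r hu' hv' => hu' (hp v hv u hu r.symm hv')) hn x hx px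

theorem Comp.sub {Y C C' : Set W} (h : X.Comp Y C) (h' : X.Comp Y C') {x : W} (hx : x ∈ C) (hx' : x ∈ C') :
    C' ⊆ C := by
  intro y hy
  refine h'.1.2 (fun w => w ∈ C) (fun u hu v hv r hc => ?_) x hx' y hy hx
  rcases h.2.2 u hc v r with h1 | h1
  · exact h1
  · exact absurd h1 (h'.2.1 v hv)

theorem Comp.eq {Y C C' : Set W} (h : X.Comp Y C) (h' : X.Comp Y C') {x : W} (hx : x ∈ C) (hx' : x ∈ C') :
    C = C' := Set.Subset.antisymm (h'.sub h hx' hx) (h.sub h' hx hx')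

theorem exists_comp (Y : Set W) {w : W} (hw : w ∉ Y) : ∃ C, X.Comp Y C ∧ w ∈ C := by
  let r : W → W → Prop := fun a b => X.R a b ∧ b ∉ Y
  have hY : ∀ v, Relation.ReflTransGen r w v → v ∉ Y := by
    intro v hv
    cases hv with
    | refl => exact hw
    | tail _ h => exact h.2
  refine ⟨{v | Relation.ReflTransGen r w v}, ⟨?_, ?_, ?_⟩, Relation.ReflTransGen.refl⟩
  · refine Cn.mk' w Relation.ReflTransGen.refl ?_
    intro p hp p0 y hy
    change Relation.ReflTransGen r w y at hy
    induction hy with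
    | refl => exact p0
    | tail h1 h2 ih => exact hp _ h1 _ (h1.tail h2) h2.1 ih
  · exact fun v hv => hY v hv
  · intro u hu v huv
    by_cases hv : v ∈ Y
    · exact Or.inr hv
    · exact Or.inl (Relation.ReflTransGen.tail hu ⟨huv, hv⟩)

structure Inp (X : Cx W E T) (z : W) (par : W → W) (sp : W → Prop) : Prop where
  hU : X.Cn Set.univ
  hR : ∀ w, X.R w (par w)
  hz : ∀ w, ∃ n, par^[n] w = z
  hsp : ∀ s s', sp s → sp s' → X.R s s' → s = s'
  hps : ∀ w, ¬ sp (par w)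

section foot
variable {z : W} {par : W → W} {sp : W → Prop} (I : X.Inp z par sp) {C : Set W} (hzC : z ∉ C)
include I hzC

theorem ex_foot (w : W) : ∃ n, par^[n] w ∉ C := by
  obtain ⟨n, hn⟩ := I.hz w
  exact ⟨n, by rwa [hn]⟩

theorem foot_exists : ∃ ft : W → W, (∀ w, ft w ∉ C) ∧ (∀ w ∉ C, ft w = w) ∧
    (∀ w ∈ C, ∃ n, (∀ m ≤ n, par^[m] w ∈ C) ∧ X.R (par^[n] w) (ft w)) := by
  refine ⟨fun w => par^[Nat.find (ex_foot I hzC w)] w, fun w => Nat.find_spec (ex_foot I hzC w), ?_, ?_⟩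
  · intro w hw
    have : Nat.find (ex_foot I hzC w) = 0 := by
      rw [Nat.find_eq_zero]; exact hw
    simp [this]
  · intro w hw
    have hne : Nat.find (ex_foot I hzC w) ≠ 0 := by
      rw [Ne, Nat.find_eq_zero]; simpa using hw
    obtain ⟨n, hn⟩ := Nat.exists_eq_succ_of_ne_zero hne
    refine ⟨n, ?_, ?_⟩
    · intro m hm
      by_contra hc
      have := Nat.find_min' (ex_foot I hzC w) hc
      omega
    · simp only [hn, Function.iterate_succ_apply']
      exact I.hR _
end foot

def Bt (X : Cx W E T) (par : W → W) (sp : W → Prop) (t : T) : Set W :=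
  {x | (∃ i n, par^[n] (X.vt t i) = x) ∨ ∃ i, sp (X.vt t i) ∧ X.R (X.vt t i) x}

def Nt (X : Cx W E T) (par : W → W) (sp : W → Prop) (C : Set W) (t : T) : Set W :=
  {x | (∃ i n, par^[n] (X.vt t i) = x ∧ ∀ m ≤ n, par^[m] (X.vt t i) ∈ C) ∨
    (x ∈ C ∧ ∃ i, sp (X.vt t i) ∧ X.vt t i ∈ C ∧ X.R (X.vt t i) x)}

theorem Nt_sub {par : W → W} {sp : W → Prop} {C : Set W} {t : T} : X.Nt par sp C t ⊆ C := by
  rintro x (⟨i, n, rfl, h⟩ | ⟨h, -⟩)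
  · exact h n le_rfl
  · exact h
theorem Nt_Bt {par : W → W} {sp : W → Prop} {C : Set W} {t : T} : X.Nt par sp C t ⊆ X.Bt par sp t := by
  rintro x (⟨i, n, rfl, h⟩ | ⟨h, i, h1, h2, h3⟩)
  · exact Or.inl ⟨i, n, rfl⟩
  · exact Or.inr ⟨i, h1, h3⟩
theorem Nt_mem {par : W → W} {sp : W → Prop} {C : Set W} {t : T} {i : Fin 3} (h : X.vt t i ∈ C) :
    X.vt t i ∈ X.Nt par sp C t :=
  Or.inl ⟨i, 0, rfl, fun m hm => by obtain rfl : m = 0 := by omega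
                                    exact h⟩

theorem Nt_cn {z : W} {par : W → W} {sp : W → Prop} (I : X.Inp z par sp) {C : Set W} {t : T} {i0 : Fin 3}
    (h0 : X.vt t i0 ∈ C) : X.Cn (X.Nt par sp C t) := by
  refine Cn.mk' (X.vt t i0) (Nt_mem h0) ?_
  intro p hp p0 y hy
  have hi : ∀ i, X.vt t i ∈ C → p (X.vt t i) := fun i hi =>
    hp _ (Nt_mem h0) _ (Nt_mem hi) ⟨t, i0, i, rfl, rfl⟩ p0
  have hy' := hy
  rcases hy with ⟨i, n, rfl, h⟩ | ⟨h, i, h1, h2, h3⟩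
  · clear hy'
    induction n with
    | zero => exact hi i (h 0 le_rfl)
    | succ n ih =>
      refine hp _ (Or.inl ⟨i, n, rfl, fun m hm => h m (by omega)⟩) _ (Or.inl ⟨i, n+1, rfl, h⟩) ?_
        (ih fun m hm => h m (by omega))
      rw [Function.iterate_succ_apply']; exact I.hR _
  · exact hp _ (Nt_mem h2) _ hy' h3 (hi i h2)

/-- neighbours of specials in N -/
theorem Nt_sp {z : W} {par : W → W} {sp : W → Prop} (I : X.Inp z par sp) {C : Set W} {t : T}
    {s u : W} (hs : s ∈ X.Nt par sp C t) (hsp : sp s) (r : X.R s u) (hu : u ∈ C) : u ∈ X.Nt par sp C t := by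
  rcases hs with ⟨i, n, rfl, h⟩ | ⟨h, i, h1, h2, h3⟩
  · cases n with
    | zero => exact Or.inr ⟨hu, i, hsp, h 0 le_rfl, r⟩
    | succ n => rw [Function.iterate_succ_apply'] at hsp; exact absurd hsp (I.hps _)
  · obtain rfl := I.hsp _ _ h1 hsp h3
    exact Or.inr ⟨hu, i, h1, h2, r⟩

section
variable {V' : Type}
def Pt (Y : Set W) (lab : W → V') (p : V') : Set W := {y | y ∈ Y ∧ lab y = p}
def Tc (X : Cx W E T) (Y : Set W) (lab : W → V') (C : Set W) : Set V' :=
  {p | ∃ y ∈ Y, lab y = p ∧ ∃ u ∈ C, X.R u y}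

theorem Tc_ad {Y : Set W} {lab : W → V'} {C : Set W} {p : V'} : p ∈ X.Tc Y lab C ↔ X.Ad (Pt Y lab p) C := by
  constructor
  · rintro ⟨y, hy, h1, u, hu, r⟩; exact ⟨y, ⟨hy, h1⟩, u, hu, r.symm⟩
  · rintro ⟨y, ⟨hy, h1⟩, u, hu, r⟩; exact ⟨y, hy, h1, u, hu, r.symm⟩

theorem Tc_nonempty (hU : X.Cn Set.univ) {Y C : Set W} (lab : W → V') (hC : X.Comp Y C) {z : W} (hz : z ∈ Y) :
    (X.Tc Y lab C).Nonempty := by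
  obtain ⟨x, hx⟩ := hC.1.1
  obtain ⟨u, -, v, -, r, h1, h2⟩ := hU.cross (fun w => w ∈ C) (Set.mem_univ x) (Set.mem_univ z) hx
    (fun h => hC.2.1 z h hz)
  exact ⟨lab v, v, (hC.2.2 u h1 v r).resolve_left h2, rfl, u, h1, r⟩

theorem enum3 {S : Set V'} (h : S.encard = 3) : ∃ f : Fin 3 → V', Function.Injective f ∧ Set.range f = S := by
  obtain ⟨a, b, c, h1, h2, h3, rfl⟩ := Set.encard_eq_three.1 h
  refine ⟨![a,b,c], ?_, ?_⟩
  · intro i j hij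
    fin_cases i <;> fin_cases j <;> simp_all
  · ext x; simp [eq_comm]; tauto

theorem le3_cases {S : Set V'} (h : S.encard ≤ 3) (hn : S.Nonempty) : S.encard = 3 ∨ ∃ p ∈ S, ∃ q ∈ S, S = {p, q} := by
  have hf : S.Finite := Set.finite_of_encard_le_coe (k := 3) h
  have hc := hf.cast_ncard_eq
  have : S.ncard = 0 ∨ S.ncard = 1 ∨ S.ncard = 2 ∨ S.ncard = 3 := by
    rw [← hc] at h
    have : S.ncard ≤ 3 := by exact_mod_cast h
    omega
  rcases this with h | h | h | h
  · rw [Set.ncard_eq_zero hf] at h; exact absurd h hn.ne_empty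
  · obtain ⟨a, rfl⟩ := Set.ncard_eq_one.1 h; right; exact ⟨a, by simp, a, by simp, by simp⟩
  · obtain ⟨a, b, -, rfl⟩ := Set.ncard_eq_two.1 h; right; exact ⟨a, by simp, b, by simp, rfl⟩
  · left; rw [← hc, h]; rfl

theorem spAll [Finite W] [Fintype E] [Fintype T] {z : W} {par : W → W} {sp : W → Prop} (I : X.Inp z par sp)
    {Y C : Set W} {lab : W → V'} (hz : z ∈ Y) (hC : X.Comp Y C)
    (cn : ∀ y ∈ Y, X.Cn (Pt Y lab (lab y)))
    (t3 : (X.Tc Y lab C).encard ≤ 3)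
    (tad : ∀ p ∈ X.Tc Y lab C, ∀ q ∈ X.Tc Y lab C, p ≠ q → X.Ad (Pt Y lab p) (Pt Y lab q)) :
    ∃ t, (∃ i, X.vt t i ∈ C) ∧ ∀ p ∈ X.Tc Y lab C, X.Ad (Pt Y lab p) (X.Nt par sp C t) := by
  have hzC : z ∉ C := fun h => hC.2.1 z h hz
  obtain ⟨ft, hf1, hf2, hf3⟩ := foot_exists I hzC
  have hadC : ∀ w ∈ C, lab (ft w) ∈ X.Tc Y lab C ∧ ft w ∈ Y := by
    intro w hw
    obtain ⟨n, h1, h2⟩ := hf3 w hw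
    have h3 : ft w ∈ Y := (hC.2.2 _ (h1 n le_rfl) _ h2).resolve_left (hf1 w)
    exact ⟨⟨ft w, h3, rfl, _, h1 n le_rfl, h2⟩, h3⟩
  suffices h : ∃ t, (∃ i, X.vt t i ∈ C) ∧ ∀ p ∈ X.Tc Y lab C, ∃ i, lab (ft (X.vt t i)) = p by
    obtain ⟨t, ⟨i0, hi0⟩, h⟩ := h
    refine ⟨t, ⟨i0, hi0⟩, fun p hp => ?_⟩
    obtain ⟨i, rfl⟩ := h p hp
    by_cases hi : X.vt t i ∈ C
    · obtain ⟨n, h1, h2⟩ := hf3 _ hi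
      exact ⟨_, ⟨(hadC _ hi).2, rfl⟩, _, Or.inl ⟨i, n, rfl, h1⟩, h2.symm⟩
    · rw [hf2 _ hi]
      have r : X.R (X.vt t i0) (X.vt t i) := ⟨t, i0, i, rfl, rfl⟩
      exact ⟨X.vt t i, ⟨(hC.2.2 _ hi0 _ r).resolve_left hi, rfl⟩, _, Nt_mem hi0, r.symm⟩
  rcases le3_cases t3 (Tc_nonempty I.hU lab hC hz) with h3 | ⟨p, hp, q, hq, hpq⟩
  · obtain ⟨f, fi, fr⟩ := enum3 h3
    have fm : ∀ k, f k ∈ X.Tc Y lab C := fun k => fr ▸ ⟨k, rfl⟩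
    let χ : W → Fin 3 := fun w => if h : ∃ i, f i = lab (ft w) then h.choose else 0
    have hχ : ∀ w, lab (ft w) ∈ X.Tc Y lab C → f (χ w) = lab (ft w) := by
      intro w hw
      have h : ∃ i, f i = lab (ft w) := by rw [← fr] at hw; exact hw
      simp only [χ, dif_pos h]
      exact h.choose_spec
    have hYC : ∀ y ∈ Y, y ∉ C := fun y hy hc => hC.2.1 y hc hy
    obtain ⟨t, ⟨i0, hi0⟩, ht⟩ := sperner I.hU (fun k => Pt Y lab (f k)) C
      (fun k => by
        obtain ⟨y, hy, h1, -⟩ := fm k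
        rw [← h1]; exact cn y hy) hC.1
      (fun k l w h1 h2 => fi (h1.2.symm.trans h2.2)) (fun k w h1 => hYC w h1.1)
      (fun k l hkl => tad _ (fm k) _ (fm l) (fi.ne hkl)) (fun k => Tc_ad.1 (fm k))
      (fun u hu v r => by
        rcases hC.2.2 u hu v r with h | h
        · exact Or.inl h
        · right
          have : lab v ∈ X.Tc Y lab C := ⟨v, h, rfl, u, hu, r⟩
          rw [← fr] at this
          obtain ⟨i, hi⟩ := this
          exact ⟨i, h, hi.symm⟩) χ
      (fun i w hw => by
        apply fi
        have := hf2 w (hYC w hw.1)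
        rw [hχ w (by rw [this, hw.2]; exact fm i), this, hw.2])
    refine ⟨t, ⟨i0, hi0⟩, fun p hp => ?_⟩
    rw [← fr] at hp
    obtain ⟨c, rfl⟩ := hp
    obtain ⟨i, hi⟩ := ht c
    refine ⟨i, ?_⟩
    rw [← hi, hχ]
    by_cases hc : X.vt t i ∈ C
    · exact (hadC _ hc).1
    · rw [hf2 _ hc]
      have r : X.R (X.vt t i0) (X.vt t i) := ⟨t, i0, i, rfl, rfl⟩
      exact ⟨_, (hC.2.2 _ hi0 _ r).resolve_left hc, rfl, _, hi0, r⟩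
  · have key : ∀ p q, X.Tc Y lab C = {p, q} → p ∈ X.Tc Y lab C → ∀ u ∈ C, lab (ft u) = q → (∃ y ∈ Y, lab y = p ∧ X.R u y) →
        ∃ t, (∃ i, X.vt t i ∈ C) ∧ ∀ p ∈ X.Tc Y lab C, ∃ i, lab (ft (X.vt t i)) = p := by
      rintro p q hpq hp u hu h1 ⟨y, hy, h2, t, i, j, rfl, rfl⟩
      refine ⟨t, ⟨i, hu⟩, fun r hr => ?_⟩
      rw [hpq] at hr
      rcases hr with rfl | rfl
      · exact ⟨j, by rw [hf2 _ (fun h => hC.2.1 _ h hy)]; exact h2⟩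
      · exact ⟨i, h1⟩
    obtain ⟨y, hy, h1, u, hu, r⟩ := id hp
    obtain ⟨y', hy', h1', u', hu', r'⟩ := id hq
    by_cases e1 : lab (ft u) = q
    · exact key p q hpq hp u hu e1 ⟨y, hy, h1, r⟩
    by_cases e2 : lab (ft u') = p
    · exact key q p (by rw [hpq, Set.pair_comm]) hq u' hu' e2 ⟨y', hy', h1', r'⟩
    have a1 : lab (ft u) = p := by
      have := (hadC u hu).1; rw [hpq] at this; exact this.resolve_right e1
    obtain ⟨a, ha, b, hb, ⟨t, i, j, rfl, rfl⟩, h5, h6⟩ := hC.1.cross (fun w => lab (ft w) = p) hu hu' a1 e2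
    have h7 : lab (ft (X.vt t j)) = q := by
      have := (hadC _ hb).1; rw [hpq] at this; exact this.resolve_left h6
    refine ⟨t, ⟨i, ha⟩, fun r hr => ?_⟩
    rw [hpq] at hr
    rcases hr with rfl | rfl
    · exact ⟨i, h5⟩
    · exact ⟨j, h7⟩
end
end Cx
end FLP

namespace FLP
open Classical
variable {W E T : Type}
namespace Cx
variable {X : Cx W E T}

structure St (X : Cx W E T) (z : W) (par : W → W) (sp : W → Prop) {V' Fc : Type}
    (Y : Set W) (lab : W → V') (tri : Fc → Fin 3 → V') (σ : Set W → Fc) : Prop where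
  sph : Sphere tri
  td : TD tri
  hz : z ∈ Y
  cn : ∀ y ∈ Y, X.Cn (Pt Y lab (lab y))
  wd : ∀ y ∈ Y, Pt Y lab (lab y) = {z} ∨ (z ∉ Pt Y lab (lab y) ∧ ∃ t, Pt Y lab (lab y) ⊆ X.Bt par sp t)
  adj : ∀ u ∈ Y, ∀ v ∈ Y, X.R u v → MA tri (lab u) (lab v)
  spc : ∀ s ∈ Y, sp s → ∀ u v, X.R s u → X.R s v → u ∈ Y ∧ v ∈ Y ∧ MA tri (lab u) (lab v)
  t3 : ∀ C, X.Comp Y C → (X.Tc Y lab C).encard ≤ 3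
  tad : ∀ C, X.Comp Y C → ∀ p ∈ X.Tc Y lab C, ∀ q ∈ X.Tc Y lab C, p ≠ q → X.Ad (Pt Y lab p) (Pt Y lab q)
  rng : ∀ C, X.Comp Y C → (X.Tc Y lab C).encard = 3 → Set.range (tri (σ C)) = X.Tc Y lab C
  inj : ∀ C C', X.Comp Y C → X.Comp Y C' → (X.Tc Y lab C).encard = 3 → (X.Tc Y lab C').encard = 3 →
    σ C = σ C' → C = C'

theorem MA.symm' {V' Fc : Type} {tri : Fc → Fin 3 → V'} {p q : V'} (h : MA tri p q) : MA tri q p := by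
  obtain ⟨a, b, c, h1, h2⟩ := h; exact ⟨a, c, b, h2, h1⟩

section step
variable {z : W} {par : W → W} {sp : W → Prop} {V' Fc : Type} {Y : Set W} {lab : W → V'}
  {C N : Set W}

noncomputable def lb (N : Set W) (lab : W → V') (w : W) : Option V' := if w ∈ N then none else some (lab w)

theorem lb_in {w : W} (h : w ∈ N) : lb N lab w = none := if_pos h
theorem lb_out {w : W} (h : w ∉ N) : lb N lab w = some (lab w) := if_neg h

theorem Pt_none : Pt (Y ∪ N) (lb N lab) none = N := by
  ext w
  by_cases h : w ∈ N
  · simp [Pt, h, lb_in h]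
  · simp [Pt, h, lb_out h]
theorem Pt_some (hN : ∀ w ∈ N, w ∉ Y) (p : V') : Pt (Y ∪ N) (lb N lab) (some p) = Pt Y lab p := by
  ext w
  by_cases h : w ∈ N
  · simp [Pt, lb_in h, hN w h]
  · simp [Pt, h, lb_out h]

theorem Tc_some (hN : ∀ w ∈ N, w ∉ Y) (C1 : Set W) (p : V') :
    some p ∈ X.Tc (Y ∪ N) (lb N lab) C1 ↔ p ∈ X.Tc Y lab C1 := by
  rw [Tc_ad, Tc_ad, Pt_some hN]
theorem Tc_none (C1 : Set W) :
    none ∈ X.Tc (Y ∪ N) (lb N lab) C1 ↔ X.Ad N C1 := by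
  rw [Tc_ad, Pt_none]

/-- new component inside C -/
theorem comp_in (hC : X.Comp Y C) (hNC : N ⊆ C) {C1 : Set W} (h1 : X.Comp (Y ∪ N) C1) {x : W} (hx : x ∈ C)
    (hx1 : x ∈ C1) : C1 ⊆ C := by
  intro y hy
  refine h1.1.2 (fun w => w ∈ C) (fun u hu v hv r hc => ?_) x hx1 y hy hx
  exact (hC.2.2 u hc v r).resolve_right fun h => h1.2.1 v hv (Or.inl h)

theorem comp_out (hC : X.Comp Y C) (hNC : N ⊆ C) {C1 : Set W} (h1 : X.Comp (Y ∪ N) C1) (h : ¬ C1 ⊆ C) :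
    X.Comp Y C1 ∧ (∀ w ∈ C1, w ∉ C) ∧ ¬ X.Ad N C1 := by
  have hd : ∀ w ∈ C1, w ∉ C := fun w hw hc => h (comp_in hC hNC h1 hc hw)
  have ha : ∀ u ∈ C1, ∀ v ∈ C, ¬ X.R u v := by
    intro u hu v hv r
    rcases hC.2.2 v hv u r.symm with h2 | h2
    · exact hd u hu h2
    · exact h1.2.1 u hu (Or.inl h2)
  refine ⟨⟨h1.1, fun w hw hY => h1.2.1 w hw (Or.inl hY), fun u hu v r => ?_⟩, hd, ?_⟩
  · rcases h1.2.2 u hu v r with h2 | h2 | h2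
    · exact Or.inl h2
    · exact Or.inr h2
    · exact absurd r (ha u hu v (hNC h2))
  · rintro ⟨u, hu, v, hv, r⟩
    exact ha v hv u (hNC hu) r.symm

theorem comp_in_ad (hC : X.Comp Y C) (hNC : N ⊆ C) (hN : N.Nonempty) {C1 : Set W} (h1 : X.Comp (Y ∪ N) C1)
    (h : C1 ⊆ C) : X.Ad N C1 := by
  obtain ⟨x, hx⟩ := h1.1.1
  obtain ⟨y, hy⟩ := hN
  obtain ⟨u, hu, v, hv, r, h2, h3⟩ := hC.1.cross (fun w => w ∈ C1) (h hx) (hNC hy) hx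
    (fun h => h1.2.1 y h (Or.inr hy))
  refine ⟨v, ?_, u, h2, r.symm⟩
  rcases h1.2.2 u h2 v r with h4 | h4 | h4
  · exact absurd h4 h3
  · exact absurd h4 (hC.2.1 v hv)
  · exact h4

theorem Tc_in (hNY : ∀ w ∈ N, w ∉ Y) {C1 : Set W} (h : C1 ⊆ C) :
    X.Tc (Y ∪ N) (lb N lab) C1 ⊆ insert none (some '' X.Tc Y lab C) := by
  rintro (_ | p) hp
  · exact Or.inl rfl
  · rw [Tc_some hNY] at hp
    obtain ⟨y, hy, e, u, hu, r⟩ := hp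
    exact Or.inr ⟨p, ⟨y, hy, e, u, h hu, r⟩, rfl⟩

theorem Tc_out {C1 : Set W} (hNY : ∀ w ∈ N, w ∉ Y) (h : ¬ X.Ad N C1) :
    X.Tc (Y ∪ N) (lb N lab) C1 = some '' X.Tc Y lab C1 := by
  ext (_ | p)
  · rw [Tc_none]; simp [h]
  · rw [Tc_some hNY]; simp

variable [Finite W] [Fintype E] [Fintype T]

theorem Tc_miss {tri : Fc → Fin 3 → V'} {σ : Set W → Fc} (I : X.Inp z par sp) (S : X.St z par sp Y lab tri σ)
    (hC : X.Comp Y C) (hNC : N ⊆ C) (hN : X.Cn N) (hNa : ∀ p ∈ X.Tc Y lab C, X.Ad (Pt Y lab p) N)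
    {C1 : Set W} (h1 : X.Comp (Y ∪ N) C1) (h : C1 ⊆ C) (h3 : (X.Tc Y lab C).encard = 3) :
    ∃ p ∈ X.Tc Y lab C, p ∉ X.Tc Y lab C1 := by
  by_contra hcon
  push Not at hcon
  obtain ⟨f, fi, fr⟩ := enum3 h3
  have fm : ∀ k, f k ∈ X.Tc Y lab C := fun k => fr ▸ ⟨k, rfl⟩
  refine K5' I.hU (fun k => Pt Y lab (f k)) N C1 ?_ hN h1.1 ?_ ?_ ?_ ?_ ?_ ?_ ?_ ?_
  · intro k
    obtain ⟨y, hy, e, -⟩ := fm k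
    rw [← e]; exact S.cn y hy
  · exact fun k l w h1 h2 => fi (h1.2.symm.trans h2.2)
  · exact fun k w h1 h2 => hC.2.1 w (hNC h2) h1.1
  · exact fun k w h2 h3 => hC.2.1 w (h h3) h2.1
  · exact fun w h2 h3 => h1.2.1 w h3 (Or.inr h2)
  · exact fun k l hkl => S.tad C hC _ (fm k) _ (fm l) (fi.ne hkl)
  · exact fun k => hNa _ (fm k)
  · exact fun k => Tc_ad.1 (hcon _ (fm k))
  · exact comp_in_ad hC hNC hN.1 h1 h

/-- general step given the new sphere -/
theorem step_gen {tri : Fc → Fin 3 → V'} {σ : Set W → Fc} (I : X.Inp z par sp) (S : X.St z par sp Y lab tri σ)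
    (hC : X.Comp Y C) (t : T) (ht : N = X.Nt par sp C t) (hN : X.Cn N)
    (hNa : ∀ p ∈ X.Tc Y lab C, X.Ad (Pt Y lab p) N)
    {Fc2 : Type} {tri2 : Fc2 → Fin 3 → Option V'} (sph : Sphere tri2) (td : TD tri2)
    (m1 : ∀ p q, MA tri p q → MA tri2 (some p) (some q)) (m2 : ∀ p ∈ X.Tc Y lab C, MA tri2 none (some p))
    (σ2 : Set W → Fc2)
    (rng : ∀ C1, X.Comp (Y ∪ N) C1 → (X.Tc (Y ∪ N) (lb N lab) C1).encard = 3 →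
      Set.range (tri2 (σ2 C1)) = X.Tc (Y ∪ N) (lb N lab) C1)
    (inj : ∀ C1 C', X.Comp (Y ∪ N) C1 → X.Comp (Y ∪ N) C' → (X.Tc (Y ∪ N) (lb N lab) C1).encard = 3 →
      (X.Tc (Y ∪ N) (lb N lab) C').encard = 3 → σ2 C1 = σ2 C' → C1 = C') :
    X.St z par sp (Y ∪ N) (lb N lab) tri2 σ2 := by
  have hNC : N ⊆ C := ht ▸ Nt_sub
  have hNY : ∀ w ∈ N, w ∉ Y := fun w hw => hC.2.1 w (hNC hw)
  have hYN : ∀ w ∈ Y, w ∉ N := fun w hw h => hNY w h hw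
  have mnn : MA tri2 none none := by
    obtain ⟨p, hp⟩ := Tc_nonempty I.hU lab hC S.hz
    obtain ⟨φ, i, j, h1, h2⟩ := m2 p hp
    exact ⟨φ, i, i, h1, h1⟩
  have hNn : ∀ u ∈ N, ∀ v ∈ Y, X.R u v → lab v ∈ X.Tc Y lab C := fun u hu v hv r => ⟨v, hv, rfl, u, hNC hu, r⟩
  have tcma : ∀ p ∈ X.Tc Y lab C, ∀ q ∈ X.Tc Y lab C, MA tri p q := by
    intro p hp q hq
    by_cases e : p = q
    · subst e
      obtain ⟨y, hy, e, u, hu, ta, i, j, h1, h2⟩ := hp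
      have := S.adj y hy y hy ⟨ta, j, j, h2, h2⟩
      rwa [e] at this
    · obtain ⟨u, hu, v, hv, r⟩ := S.tad C hC p hp q hq e
      have := S.adj u hu.1 v hv.1 r
      rwa [hu.2, hv.2] at this
  refine ⟨sph, td, Or.inl S.hz, ?_, ?_, ?_, ?_, ?_, ?_, rng, inj⟩
  · rintro y (hy | hy)
    · rw [lb_out (hYN y hy), Pt_some hNY]; exact S.cn y hy
    · rw [lb_in hy, Pt_none]; exact hN
  · rintro y (hy | hy)
    · rw [lb_out (hYN y hy), Pt_some hNY]; exact S.wd y hy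
    · rw [lb_in hy, Pt_none]; right
      exact ⟨hYN z S.hz, t, ht ▸ Nt_Bt⟩
  · rintro u (hu | hu) v (hv | hv) r
    · rw [lb_out (hYN u hu), lb_out (hYN v hv)]; exact m1 _ _ (S.adj u hu v hv r)
    · rw [lb_out (hYN u hu), lb_in hv]; exact MA.symm' (m2 _ (hNn v hv u hu r.symm))
    · rw [lb_in hu, lb_out (hYN v hv)]; exact m2 _ (hNn u hu v hv r)
    · rw [lb_in hu, lb_in hv]; exact mnn
  · rintro s (hs | hs) hsp u v ru rv
    · obtain ⟨h1, h2, h3⟩ := S.spc s hs hsp u v ru rv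
      refine ⟨Or.inl h1, Or.inl h2, ?_⟩
      rw [lb_out (hYN u h1), lb_out (hYN v h2)]; exact m1 _ _ h3
    · have key : ∀ u, X.R s u → u ∈ N ∨ u ∈ Y := by
        intro u r
        rcases hC.2.2 s (hNC hs) u r with h | h
        · left; rw [ht] at hs ⊢; exact Nt_sp I hs hsp r h
        · exact Or.inr h
      refine ⟨(key u ru).symm, (key v rv).symm, ?_⟩
      rcases key u ru with hu | hu <;> rcases key v rv with hv | hv
      · rw [lb_in hu, lb_in hv]; exact mnn
      · rw [lb_in hu, lb_out (hYN v hv)]; exact m2 _ (hNn s hs v hv rv)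
      · rw [lb_out (hYN u hu), lb_in hv]; exact MA.symm' (m2 _ (hNn s hs u hu ru))
      · rw [lb_out (hYN u hu), lb_out (hYN v hv)]
        exact m1 _ _ (tcma _ (hNn s hs u hu ru) _ (hNn s hs v hv rv))
  · intro C1 h1
    by_cases h : C1 ⊆ C
    · have hsub := Tc_in (X := X) (lab := lab) hNY h
      rcases le3_cases (S.t3 C hC) (Tc_nonempty I.hU lab hC S.hz) with h3 | ⟨p, hp, q, hq, hpq⟩
      · obtain ⟨p, hp, hp1⟩ := Tc_miss I S hC hNC hN hNa h1 h h3
        have : X.Tc (Y ∪ N) (lb N lab) C1 ⊆ insert none (some '' (X.Tc Y lab C \ {p})) := by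
          intro q hq
          rcases hsub hq with rfl | ⟨q', hq', rfl⟩
          · exact Or.inl rfl
          · refine Or.inr ⟨q', ⟨hq', ?_⟩, rfl⟩
            rintro rfl
            exact hp1 ((Tc_some hNY _ _).1 hq)
        refine (Set.encard_le_encard this).trans ((Set.encard_insert_le _ _).trans ?_)
        rw [(Option.some_injective _).encard_image]
        rw [Set.encard_sdiff_singleton_add_one hp]
        exact h3.le
      · rw [hpq] at hsub
        refine (Set.encard_le_encard hsub).trans ((Set.encard_insert_le _ _).trans ?_)
        rw [(Option.some_injective _).encard_image]
        have : ({p, q} : Set V').encard ≤ 2 := by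
          refine (Set.encard_insert_le _ _).trans ?_
          rw [Set.encard_singleton]; norm_num
        calc ({p, q} : Set V').encard + 1 ≤ 2 + 1 := by gcongr
          _ = 3 := by norm_num
    · obtain ⟨g1, g2, g3⟩ := comp_out hC hNC h1 h
      rw [Tc_out hNY g3, (Option.some_injective _).encard_image]
      exact S.t3 C1 g1
  · intro C1 h1 p hp q hq hpq
    by_cases h : C1 ⊆ C
    · have hsub := Tc_in (X := X) (lab := lab) hNY h
      rcases hsub hp with rfl | ⟨p, hp', rfl⟩ <;> rcases hsub hq with rfl | ⟨q, hq', rfl⟩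
      · exact absurd rfl hpq
      · rw [Pt_none, Pt_some hNY]; exact (hNa q hq').symm
      · rw [Pt_none, Pt_some hNY]; exact (hNa p hp')
      · rw [Pt_some hNY, Pt_some hNY]; exact S.tad C hC p hp' q hq' (by rintro rfl; exact hpq rfl)
    · obtain ⟨g1, g2, g3⟩ := comp_out hC hNC h1 h
      rw [Tc_out hNY g3] at hp hq
      obtain ⟨p, hp, rfl⟩ := hp
      obtain ⟨q, hq, rfl⟩ := hq
      rw [Pt_some hNY, Pt_some hNY]; exact S.tad C1 g1 p hp q hq (by rintro rfl; exact hpq rfl)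

end step
end Cx
end FLP

namespace FLP
open Classical
variable {W E T : Type}
namespace Cx
variable {X : Cx W E T}
section step
variable {z : W} {par : W → W} {sp : W → Prop} {V' Fc : Type} {Y : Set W} {lab : W → V'}
  {C N : Set W} [Finite W] [Fintype E] [Fintype T]

theorem no3 {tri : Fc → Fin 3 → V'} {σ : Set W → Fc} (I : X.Inp z par sp) (S : X.St z par sp Y lab tri σ)
    (hC : X.Comp Y C) (hNC : N ⊆ C) (hN : X.Cn N) (hNa : ∀ p ∈ X.Tc Y lab C, X.Ad (Pt Y lab p) N)
    {p q : V'} (hp : p ∈ X.Tc Y lab C) (hq : q ∈ X.Tc Y lab C) (hpq : p ≠ q) (B : Fin 3 → Set W)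
    (hB : ∀ k, X.Cn (B k)) (hdB : ∀ k l w, w ∈ B k → w ∈ B l → k = l)
    (h1 : ∀ k w, w ∈ B k → w ∉ Pt Y lab p ∧ w ∉ Pt Y lab q ∧ w ∉ N)
    (h2 : ∀ k, X.Ad (Pt Y lab p) (B k) ∧ X.Ad (Pt Y lab q) (B k) ∧ X.Ad N (B k)) : False := by
  have cnp : ∀ p ∈ X.Tc Y lab C, X.Cn (Pt Y lab p) := by
    intro p hp
    obtain ⟨y, hy, e, -⟩ := hp
    rw [← e]; exact S.cn y hy
  have d1 : ∀ w, w ∈ Pt Y lab p → w ∈ Pt Y lab q → False := fun w h h' => hpq (h.2.symm.trans h'.2)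
  have d2 : ∀ w p, w ∈ Pt Y lab p → w ∈ N → False := fun w p h h' => hC.2.1 w (hNC h') h.1
  have a1 := S.tad C hC p hp q hq hpq
  refine K33' I.hU ![Pt Y lab p, Pt Y lab q, N] B ?_ hB ?_ hdB ?_ ?_ ?_
  · intro k; fin_cases k
    · exact cnp p hp
    · exact cnp q hq
    · exact hN
  · intro k l w hk hl
    fin_cases k <;> fin_cases l <;> simp at hk hl ⊢ <;>
    first
      | exact d1 w hk hl
      | exact d1 w hl hk
      | exact d2 w _ hk hl
      | exact d2 w _ hl hk
  · intro k l w hk hl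
    have := h1 l w hl
    fin_cases k <;> simp at hk <;> tauto
  · intro k l hkl
    fin_cases k <;> fin_cases l <;> simp at hkl ⊢ <;>
    first
      | exact a1
      | exact a1.symm
      | exact hNa _ hp
      | exact hNa _ hq
      | exact (hNa _ hp).symm
      | exact (hNa _ hq).symm
  · intro k l
    have := h2 l
    fin_cases k <;> simp <;> tauto

theorem eq_of_sub3 {α : Type} {S : Set α} {a b c : α} (h : S ⊆ {a, b, c}) (h3 : S.encard = 3) :
    S = {a, b, c} ∧ a ≠ b ∧ a ≠ c ∧ b ≠ c := by
  have hle : ({a, b, c} : Set α).encard ≤ 3 := by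
    have := Finset.card_le_three (a := a) (b := b) (c := c)
    have e : ({a, b, c} : Set α) = (({a, b, c} : Finset α) : Set α) := by simp
    rw [e, Set.encard_coe_eq_coe_finsetCard]
    exact_mod_cast this
  have he : S = {a, b, c} := by
    refine Set.Finite.eq_of_subset_of_encard_le ((Set.toFinite _).subset h) h ?_
    rw [h3]; exact hle
  refine ⟨he, ?_⟩
  have two : ∀ x y : α, ({x, y} : Set α).encard ≠ 3 := by
    intro x y h
    have : ({x, y} : Set α).encard ≤ 2 := by
      refine (Set.encard_insert_le _ _).trans ?_
      rw [Set.encard_singleton]; norm_num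
    rw [h] at this
    exact absurd this (by decide)
  rw [he] at h3
  refine ⟨?_, ?_, ?_⟩ <;> rintro rfl
  · apply two a c; rw [← h3]; congr 1; ext; simp
  · apply two a b; rw [← h3]; congr 1; ext; simp; tauto
  · apply two a b; rw [← h3]; congr 1; ext; simp

theorem stepA {tri : Fc → Fin 3 → V'} {σ : Set W → Fc} (I : X.Inp z par sp) (S : X.St z par sp Y lab tri σ)
    (hC : X.Comp Y C) (t : T) (ht : N = X.Nt par sp C t) (hN : X.Cn N)
    (hNa : ∀ p ∈ X.Tc Y lab C, X.Ad (Pt Y lab p) N) (h3 : (X.Tc Y lab C).encard = 3) :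
    ∃ σ2, X.St z par sp (Y ∪ N) (lb N lab) (triA tri (σ C)) σ2 := by
  have hNC : N ⊆ C := ht ▸ Nt_sub
  have hNY : ∀ w ∈ N, w ∉ Y := fun w hw => hC.2.1 w (hNC hw)
  have hr := S.rng C hC h3
  set φ0 := σ C with hφ0
  have fm : ∀ k, tri φ0 k ∈ X.Tc Y lab C := fun k => hr ▸ ⟨k, rfl⟩
  have fi : Function.Injective (tri φ0) := by
    have h33 := h3
    rw [← hr] at h33
    have := eq_of_sub3 (a := tri φ0 0) (b := tri φ0 1) (c := tri φ0 2) (S := Set.range (tri φ0)) (by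
      rintro _ ⟨i, rfl⟩; rcases fin3_cases i with rfl | rfl | rfl <;> simp) h33
    obtain ⟨-, a, b, c⟩ := this
    intro i j hij
    rcases fin3_cases i with rfl | rfl | rfl <;> rcases fin3_cases j with rfl | rfl | rfl <;>
      first | rfl | exact absurd hij ‹_› | exact absurd hij.symm ‹_›
  have ex : ∀ C1, ∃ φ, X.Comp (Y ∪ N) C1 → (X.Tc (Y ∪ N) (lb N lab) C1).encard = 3 →
      Set.range (triA tri φ0 φ) = X.Tc (Y ∪ N) (lb N lab) C1 ∧
      (C1 ⊆ C → ∃ m, φ = .inr m) ∧ (¬ C1 ⊆ C → ∃ h, φ = .inl ⟨σ C1, h⟩) := by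
    intro C1
    by_cases h1 : X.Comp (Y ∪ N) C1
    swap
    · exact ⟨.inr 0, fun h => absurd h h1⟩
    by_cases h13 : (X.Tc (Y ∪ N) (lb N lab) C1).encard = 3
    swap
    · exact ⟨.inr 0, fun _ h => absurd h h13⟩
    by_cases h : C1 ⊆ C
    · obtain ⟨p, hp, hp1⟩ := Tc_miss I S hC hNC hN hNa h1 h h3
      rw [← hr] at hp
      obtain ⟨m, rfl⟩ := hp
      refine ⟨.inr (m+1), fun _ _ => ⟨?_, fun _ => ⟨_, rfl⟩, fun hn => absurd h hn⟩⟩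
      have hs : X.Tc (Y ∪ N) (lb N lab) C1 ⊆ {some (tri φ0 (m+1)), some (tri φ0 (m+1+1)), none} := by
        intro q hq
        rcases Tc_in (X := X) (lab := lab) hNY h hq with rfl | ⟨q, hq', rfl⟩
        · simp
        · rw [← hr] at hq'
          obtain ⟨k, rfl⟩ := hq'
          have : k = m ∨ k = m + 1 ∨ k = m + 1 + 1 := by clear * -; revert k m; decide
          rcases this with rfl | rfl | rfl
          · exact absurd ((Tc_some hNY _ _).1 hq) hp1
          · simp
          · simp
      rw [(eq_of_sub3 hs h13).1]
      ext x
      simp [triA, Fin.exists_fin_succ, eq_comm]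
    · obtain ⟨g1, g2, g3⟩ := comp_out hC hNC h1 h
      have h14 : (X.Tc Y lab C1).encard = 3 := by
        rw [Tc_out hNY g3, (Option.some_injective _).encard_image] at h13; exact h13
      have hne : σ C1 ≠ φ0 := by
        intro e
        obtain rfl := S.inj C1 C g1 hC h14 h3 e
        exact h le_rfl
      refine ⟨.inl ⟨σ C1, hne⟩, fun _ _ => ⟨?_, fun hn => absurd hn h, fun _ => ⟨hne, rfl⟩⟩⟩
      rw [Tc_out hNY g3, ← S.rng C1 g1 h14]
      ext x
      simp [triA]
  choose σ2 hσ2 using ex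
  refine ⟨σ2, step_gen I S hC t ht hN hNa (sphere_A S.sph φ0) (TD_A S.td φ0) ?_ ?_ σ2
    (fun C1 h1 h2 => (hσ2 C1 h1 h2).1) ?_⟩
  · rintro p q ⟨φ, i, j, rfl, rfl⟩
    by_cases h : φ = φ0
    · subst h
      have : i = j ∨ j = i + 1 ∨ i = j + 1 := by clear * -; revert i j; decide
      rcases this with rfl | rfl | rfl
      · exact ⟨.inr i, 0, 0, rfl, rfl⟩
      · exact ⟨.inr i, 0, 1, rfl, rfl⟩
      · exact ⟨.inr j, 1, 0, rfl, rfl⟩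
    · exact ⟨.inl ⟨φ, h⟩, i, j, rfl, rfl⟩
  · intro p hp
    rw [← hr] at hp
    obtain ⟨i, rfl⟩ := hp
    exact ⟨.inr i, 2, 0, rfl, rfl⟩
  · intro C1 C2 h1 h2 h13 h23 he
    obtain ⟨r1, a1, b1⟩ := hσ2 C1 h1 h13
    obtain ⟨r2, a2, b2⟩ := hσ2 C2 h2 h23
    by_cases c1 : C1 ⊆ C <;> by_cases c2 : C2 ⊆ C
    · by_contra hne
      obtain ⟨m, hm⟩ := a1 c1
      have e2 := hm
      rw [he] at e2
      rw [hm] at r1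
      rw [e2] at r2
      have dis : ∀ w ∈ C1, w ∉ C2 := fun w hw1 hw2 => hne (h1.eq h2 hw1 hw2)
      have q1 : ∀ C1, Set.range (triA tri φ0 (.inr m)) = X.Tc (Y ∪ N) (lb N lab) C1 →
          X.Ad (Pt Y lab (tri φ0 m)) C1 ∧ X.Ad (Pt Y lab (tri φ0 (m+1))) C1 ∧ X.Ad N C1 := by
        intro C1 r1
        refine ⟨?_, ?_, ?_⟩
        · rw [← Tc_ad, ← Tc_some hNY, ← r1]; exact ⟨0, rfl⟩
        · rw [← Tc_ad, ← Tc_some hNY, ← r1]; exact ⟨1, rfl⟩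
        · rw [← Tc_none (lab := lab) (Y := Y), ← r1]; exact ⟨2, rfl⟩
      have n01 : m ≠ m + 1 := by clear * -; revert m; decide
      have n02 : m ≠ m + 2 := by clear * -; revert m; decide
      have n12 : m + 1 ≠ m + 2 := by clear * -; revert m; decide
      have hCY : ∀ w ∈ C, ∀ p, w ∉ Pt Y lab p := fun w hw p h => hC.2.1 w hw h.1
      refine no3 I S hC hNC hN hNa (fm m) (fm (m+1)) (fi.ne n01) ![Pt Y lab (tri φ0 (m+2)), C1, C2] ?_ ?_ ?_ ?_
      · intro k; fin_cases k
        · obtain ⟨y, hy, e, -⟩ := fm (m+2)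
          show X.Cn (Pt Y lab (tri φ0 (m+2)))
          rw [← e]; exact S.cn y hy
        · exact h1.1
        · exact h2.1
      · intro k l w hk hl
        fin_cases k <;> fin_cases l <;> simp at hk hl ⊢ <;>
        first
          | exact dis w hk hl
          | exact dis w hl hk
          | exact hCY w (c1 hk) _ hl
          | exact hCY w (c2 hk) _ hl
          | exact hCY w (c1 hl) _ hk
          | exact hCY w (c2 hl) _ hk
      · intro k w hw
        fin_cases k <;> simp at hw
        · refine ⟨fun h => n02 (fi (h.2.symm.trans hw.2)), fun h => n12 (fi (h.2.symm.trans hw.2)), fun h => hNY w h hw.1⟩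
        · exact ⟨hCY w (c1 hw) _, hCY w (c1 hw) _, fun h => h1.2.1 w hw (Or.inr h)⟩
        · exact ⟨hCY w (c2 hw) _, hCY w (c2 hw) _, fun h => h2.2.1 w hw (Or.inr h)⟩
      · intro k; fin_cases k
        · exact ⟨S.tad C hC _ (fm _) _ (fm _) (fi.ne n02), S.tad C hC _ (fm _) _ (fm _) (fi.ne n12), (hNa _ (fm _)).symm⟩
        · exact q1 C1 r1
        · exact q1 C2 r2
    · obtain ⟨m, hm⟩ := a1 c1
      obtain ⟨h, hm2⟩ := b2 c2
      rw [hm, hm2] at he; exact absurd he (by simp)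
    · obtain ⟨m, hm⟩ := a2 c2
      obtain ⟨h, hm2⟩ := b1 c1
      rw [hm, hm2] at he; exact absurd he (by simp)
    · obtain ⟨g1, g2, g3⟩ := comp_out hC hNC h1 c1
      obtain ⟨g1', g2', g3'⟩ := comp_out hC hNC h2 c2
      rw [Tc_out hNY g3, (Option.some_injective _).encard_image] at h13
      rw [Tc_out hNY g3', (Option.some_injective _).encard_image] at h23
      obtain ⟨_, e1⟩ := b1 c1
      obtain ⟨_, e2⟩ := b2 c2
      rw [e1, e2] at he
      exact S.inj _ _ g1 g1' h13 h23 (by simpa using he)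

theorem stepB {tri : Fc → Fin 3 → V'} {σ : Set W → Fc} (I : X.Inp z par sp) (S : X.St z par sp Y lab tri σ)
    (hC : X.Comp Y C) (t : T) (ht : N = X.Nt par sp C t) (hN : X.Cn N)
    (hNa : ∀ p ∈ X.Tc Y lab C, X.Ad (Pt Y lab p) N) (φ0 : Fc) (i0 : Fin 3)
    (hsd : X.Tc Y lab C ⊆ {tri φ0 i0, tri φ0 (i0+1)}) :
    ∃ σ2, X.St z par sp (Y ∪ N) (lb N lab) (triB tri φ0 i0) σ2 := by
  have hNC : N ⊆ C := ht ▸ Nt_sub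
  have hNY : ∀ w ∈ N, w ∉ Y := fun w hw => hC.2.1 w (hNC hw)
  set a := tri φ0 i0
  set b := tri φ0 (i0+1)
  let Q : Set W → Prop := fun C1 => X.Comp (Y ∪ N) C1 ∧ (X.Tc (Y ∪ N) (lb N lab) C1).encard = 3 ∧ C1 ⊆ C
  have hQ : ∀ C1, Q C1 → X.Tc (Y ∪ N) (lb N lab) C1 = {some a, some b, none} ∧ a ≠ b ∧
      a ∈ X.Tc Y lab C ∧ b ∈ X.Tc Y lab C := by
    rintro C1 ⟨h1, h13, h⟩
    have hs : X.Tc (Y ∪ N) (lb N lab) C1 ⊆ {some a, some b, none} := by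
      intro q hq
      rcases Tc_in (X := X) (lab := lab) hNY h hq with rfl | ⟨q, hq', rfl⟩
      · simp
      · rcases hsd hq' with rfl | rfl <;> simp
    obtain ⟨e, h4, -, -⟩ := eq_of_sub3 hs h13
    have hm : ∀ x, some x ∈ X.Tc (Y ∪ N) (lb N lab) C1 → x ∈ X.Tc Y lab C := by
      intro x hx
      rcases Tc_in (X := X) (lab := lab) hNY h hx with hx | ⟨q, hq', hx⟩
      · exact absurd hx (by simp)
      · cases hx; exact hq'
    exact ⟨e, fun h => h4 (by rw [h]), hm a (by rw [e]; simp), hm b (by rw [e]; simp)⟩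
  have hQ3 : ∀ C1 C2 C3, Q C1 → Q C2 → Q C3 → C1 = C2 ∨ C1 = C3 ∨ C2 = C3 := by
    intro C1 C2 C3 q1 q2 q3
    by_contra hcon
    push Not at hcon
    obtain ⟨n1, n2, n3⟩ := hcon
    obtain ⟨-, hab, ha, hb⟩ := hQ C1 q1
    have hB : ∀ k, Q (![C1, C2, C3] k) := by
      intro k; fin_cases k <;> assumption
    refine no3 I S hC hNC hN hNa ha hb hab ![C1, C2, C3] (fun k => (hB k).1.1) ?_ ?_ ?_
    · intro k l w hk hl
      have := (hB k).1.eq (hB l).1 hk hl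
      fin_cases k <;> fin_cases l <;> simp at this ⊢ <;> tauto
    · intro k w hw
      have hw' := (hB k).2.2 hw
      exact ⟨fun h => hC.2.1 w hw' h.1, fun h => hC.2.1 w hw' h.1, fun h => (hB k).1.2.1 w hw (Or.inr h)⟩
    · intro k
      have e := (hQ _ (hB k)).1
      refine ⟨?_, ?_, ?_⟩
      · rw [← Tc_ad, ← Tc_some hNY, e]; simp
      · rw [← Tc_ad, ← Tc_some hNY, e]; simp
      · rw [← Tc_none (lab := lab) (Y := Y), e]; simp
  obtain ⟨C0, hC0⟩ : ∃ C0, ∀ C1 C2, Q C1 → Q C2 → C1 ≠ C0 → C2 ≠ C0 → C1 = C2 := by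
    by_cases h : ∃ C0, Q C0
    · obtain ⟨C0, h0⟩ := h
      refine ⟨C0, fun C1 C2 q1 q2 n1 n2 => ?_⟩
      rcases hQ3 _ _ _ h0 q1 q2 with e | e | e
      · exact absurd e.symm n1
      · exact absurd e.symm n2
      · exact e
    · exact ⟨∅, fun C1 C2 q1 => absurd ⟨C1, q1⟩ h⟩
  let σ2 : Set W → Fc ⊕ Fin 2 := fun C1 => if C1 ⊆ C then (if C1 = C0 then .inr 0 else .inr 1) else .inl (σ C1)
  refine ⟨σ2, step_gen I S hC t ht hN hNa (sphere_B S.sph φ0 i0) (TD_B S.td φ0 i0) ?_ ?_ σ2 ?_ ?_⟩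
  · rintro p q ⟨φ, i, j, rfl, rfl⟩
    exact ⟨.inl φ, i, j, rfl, rfl⟩
  · intro p hp
    rcases hsd hp with rfl | rfl
    · exact ⟨.inr 0, 2, 0, rfl, rfl⟩
    · exact ⟨.inr 0, 2, 1, rfl, rfl⟩
  · intro C1 h1 h13
    by_cases h : C1 ⊆ C
    · have : ∃ k, σ2 C1 = .inr k := by
        simp only [σ2, if_pos h]; split_ifs <;> exact ⟨_, rfl⟩
      obtain ⟨k, hk⟩ := this
      rw [hk, (hQ C1 ⟨h1, h13, h⟩).1]
      ext x
      simp [triB, Fin.exists_fin_succ, eq_comm, a, b]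
    · obtain ⟨g1, g2, g3⟩ := comp_out hC hNC h1 h
      have h14 : (X.Tc Y lab C1).encard = 3 := by
        rw [Tc_out hNY g3, (Option.some_injective _).encard_image] at h13; exact h13
      simp only [σ2, if_neg h]
      rw [Tc_out hNY g3, ← S.rng C1 g1 h14]
      ext x
      simp [triB]
  · intro C1 C2 h1 h2 h13 h23 he
    by_cases c1 : C1 ⊆ C <;> by_cases c2 : C2 ⊆ C <;> simp only [σ2, c1, c2, if_true, if_false] at he
    · by_cases e1 : C1 = C0 <;> by_cases e2 : C2 = C0 <;> simp only [e1, e2, if_true, if_false] at he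
      · rw [e1, e2]
      · simp at he
      · simp at he
      · exact hC0 _ _ ⟨h1, h13, c1⟩ ⟨h2, h23, c2⟩ e1 e2
    · split_ifs at he
    · split_ifs at he
    · obtain ⟨g1, g2, g3⟩ := comp_out hC hNC h1 c1
      obtain ⟨g1', g2', g3'⟩ := comp_out hC hNC h2 c2
      rw [Tc_out hNY g3, (Option.some_injective _).encard_image] at h13
      rw [Tc_out hNY g3', (Option.some_injective _).encard_image] at h23
      exact S.inj _ _ g1 g1' h13 h23 (by simpa using he)

theorem step {tri : Fc → Fin 3 → V'} {σ : Set W → Fc} (I : X.Inp z par sp) (S : X.St z par sp Y lab tri σ)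
    (hY : Y ≠ Set.univ) : ∃ (V2 Fc2 : Type) (Y2 : Set W) (lab2 : W → V2) (tri2 : Fc2 → Fin 3 → V2) (σ2 : Set W → Fc2),
      X.St z par sp Y2 lab2 tri2 σ2 ∧ Y ⊂ Y2 := by
  obtain ⟨w, hw⟩ := (Set.ne_univ_iff_exists_notMem _).1 hY
  obtain ⟨C, hC, hwC⟩ := exists_comp (X := X) Y hw
  obtain ⟨t, ⟨i0, hi0⟩, hNa⟩ := spAll I S.hz hC S.cn (S.t3 C hC) (S.tad C hC)
  have hN := Nt_cn I hi0
  have hss : Y ⊂ Y ∪ X.Nt par sp C t := by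
    refine ⟨Set.subset_union_left, fun h => ?_⟩
    exact hC.2.1 _ hi0 (h (Or.inr (Nt_mem hi0)))
  rcases le3_cases (S.t3 C hC) (Tc_nonempty I.hU lab hC S.hz) with h3 | ⟨p, hp, q, hq, hpq⟩
  · obtain ⟨σ2, h⟩ := stepA I S hC t rfl hN hNa h3
    exact ⟨_, _, _, _, _, _, h, hss⟩
  · have hma : MA tri p q := by
      by_cases e : p = q
      · subst e
        obtain ⟨y, hy, e, u, hu, ta, i, j, h1, h2⟩ := hp
        have := S.adj y hy y hy ⟨ta, j, j, h2, h2⟩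
        rwa [e] at this
      · obtain ⟨u, hu, v, hv, r⟩ := S.tad C hC p hp q hq e
        have := S.adj u hu.1 v hv.1 r
        rwa [hu.2, hv.2] at this
    obtain ⟨φ, i, j, rfl, rfl⟩ := hma
    have : ∃ i0, X.Tc Y lab C ⊆ {tri φ i0, tri φ (i0+1)} := by
      have : i = j ∨ j = i + 1 ∨ i = j + 1 := by clear * -; revert i j; decide
      rcases this with rfl | rfl | rfl
      · exact ⟨i, by rw [hpq]; simp⟩
      · exact ⟨i, by rw [hpq]⟩
      · exact ⟨j, by rw [hpq, Set.pair_comm]⟩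
    obtain ⟨i0, hi⟩ := this
    obtain ⟨σ2, h⟩ := stepB I S hC t rfl hN hNa φ i0 hi
    exact ⟨_, _, _, _, _, _, h, hss⟩

theorem iter (I : X.Inp z par sp) : ∀ (n : ℕ) {V' Fc : Type} {Y : Set W} {lab : W → V'} {tri : Fc → Fin 3 → V'} {σ : Set W → Fc},
    X.St z par sp Y lab tri σ → Yᶜ.ncard ≤ n → ∃ (V2 Fc2 : Type) (lab2 : W → V2) (tri2 : Fc2 → Fin 3 → V2) (σ2 : Set W → Fc2),
      X.St z par sp Set.univ lab2 tri2 σ2 := by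
  intro n
  induction n with
  | zero =>
    intro V' Fc Y lab tri σ S h
    have : Yᶜ = ∅ := by rw [← Set.ncard_eq_zero (Set.toFinite _)]; omega
    rw [Set.compl_empty_iff] at this
    subst this
    exact ⟨_, _, _, _, _, S⟩
  | succ n ih =>
    intro V' Fc Y lab tri σ S h
    by_cases hY : Y = Set.univ
    · subst hY; exact ⟨_, _, _, _, _, S⟩
    · obtain ⟨V2, Fc2, Y2, lab2, tri2, σ2, S2, hss⟩ := step I S hY
      refine ih S2 ?_
      have : Y2ᶜ.ncard < Yᶜ.ncard := Set.ncard_lt_ncard (compl_lt_compl_iff_lt.2 hss) (Set.toFinite _)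
      omega

/-- the abstract decomposition theorem -/
theorem decomp (I : X.Inp z par sp) : ∃ (V' Fc : Type) (lab : W → V') (tri : Fc → Fin 3 → V'),
    Sphere tri ∧ TD tri ∧
    (∀ y, {w | lab w = lab y} = {z} ∨ (z ∉ {w | lab w = lab y} ∧ ∃ t, {w | lab w = lab y} ⊆ X.Bt par sp t)) ∧
    (∀ u v, X.R u v → MA tri (lab u) (lab v)) ∧
    (∀ s, sp s → ∀ u v, X.R s u → X.R s v → MA tri (lab u) (lab v)) := by
  have S0 : X.St z par sp {z} (fun _ => (0 : Fin 3)) (fun (_ : Fin 2) (i : Fin 3) => i) (fun _ => 0) := by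
    have hzsp : ¬ sp z := by
      obtain ⟨n, hn⟩ := I.hz (par z)
      rw [← hn]
      cases n with
      | zero => exact I.hps z
      | succ n => rw [Function.iterate_succ_apply']; exact I.hps _
    have hP : Pt {z} (fun _ : W => (0 : Fin 3)) 0 = {z} := by ext; simp [Pt]
    have hT : ∀ C, X.Tc {z} (fun _ => (0 : Fin 3)) C ⊆ {0} := by
      rintro C p ⟨y, hy, e, -⟩; exact e.symm
    have h1 : ∀ C, (X.Tc {z} (fun _ => (0 : Fin 3)) C).encard ≤ 1 := by
      intro C; refine (Set.encard_le_encard (hT C)).trans ?_; simp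
    have h3 : ∀ C, (X.Tc {z} (fun _ => (0 : Fin 3)) C).encard ≠ 3 := by
      intro C h
      have := h1 C
      rw [h] at this
      exact absurd this (by decide)
    refine ⟨sphere_init, TD_init, rfl, ?_, ?_, ?_, ?_, ?_, ?_, ?_, ?_⟩
    · intro y hy
      show X.Cn (Pt {z} (fun _ : W => (0 : Fin 3)) 0)
      rw [hP]
      refine ⟨⟨z, rfl⟩, ?_⟩
      rintro p - x rfl y rfl h; exact h
    · exact fun y hy => Or.inl hP
    · exact fun u hu v hv r => ⟨0, 0, 0, rfl, rfl⟩
    · rintro s rfl h; exact absurd h hzsp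
    · exact fun C _ => (h1 C).trans (by decide)
    · intro C _ p hp q hq hpq
      exact absurd ((hT C hp).trans (hT C hq).symm) hpq
    · exact fun C _ h => absurd h (h3 C)
    · exact fun C _ _ _ h => absurd h (h3 C)
  obtain ⟨V', Fc, lab, tri, σ, S⟩ := iter I _ S0 le_rfl
  have hP : ∀ p, Pt Set.univ lab p = {w | lab w = p} := by intro p; ext; simp [Pt]
  refine ⟨V', Fc, lab, tri, S.sph, S.td, ?_, fun u v r => S.adj u trivial v trivial r,
    fun s h u v ru rv => (S.spc s trivial h u v ru rv).2.2⟩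
  intro y
  have := S.wd y trivial
  rwa [hP] at this

end step
end Cx
end FLP

namespace FLP
open Classical
set_option linter.unusedSectionVars false
variable {V E F : Type}

theorem exists_test {k E : Type} [Field k] [Finite E] : ∀ (n : ℕ) (K : Submodule k (E → k)), Module.finrank k K ≤ n →
    ∃ X : Finset E, X.card ≤ n ∧ ∀ c ∈ K, (∀ e ∈ X, c e = 0) → c = 0 := by
  intro n
  induction n with
  | zero =>
    intro K h
    refine ⟨∅, le_rfl, fun c hc _ => ?_⟩
    have : K = ⊥ := Submodule.finrank_eq_zero.1 (by omega)
    rw [this] at hc; simpa using hc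
  | succ n ih =>
    intro K h
    by_cases hK : ∃ c ∈ K, c ≠ 0
    · obtain ⟨c, hc, h0⟩ := hK
      obtain ⟨e, he⟩ := Function.ne_iff.1 h0
      let K1 : Submodule k (E → k) := K ⊓ LinearMap.ker (LinearMap.proj e)
      have hlt : K1 < K := by
        refine lt_of_le_of_ne inf_le_left fun h => ?_
        rw [← h] at hc
        exact he hc.2
      have := Submodule.finrank_lt_finrank_of_lt hlt
      obtain ⟨X, hX, hX'⟩ := ih K1 (by omega)
      refine ⟨insert e X, (Finset.card_insert_le _ _).trans (by omega), fun c hc h => ?_⟩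
      exact hX' c ⟨hc, h e (by simp)⟩ fun e' he' => h e' (by simp [he'])
    · push Not at hK
      exact ⟨∅, by simp, fun c hc _ => hK c hc⟩

section
variable {G : Multigraph V E} (emb : G.Embedding F)

abbrev Sd := Σ f : F, Fin (emb.boundary f).len
def eg (s : Sd emb) : E := (emb.boundary s.1).edge s.2

theorem eg_two (e : E) : ∃ p q : Sd emb, p ≠ q ∧ ∀ s, eg emb s = e ↔ s = p ∨ s = q := by
  obtain ⟨p, q, hpq, h⟩ := Set.ncard_eq_two.1 (emb.edge_twice e)
  have hp : Multigraph.IsOcc emb.boundary e p := by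
    have : p ∈ {p | Multigraph.IsOcc emb.boundary e p} := by rw [h]; simp
    exact this
  have hq : Multigraph.IsOcc emb.boundary e q := by
    have : q ∈ {p | Multigraph.IsOcc emb.boundary e p} := by rw [h]; simp
    exact this
  refine ⟨⟨p.1, p.2, hp.1⟩, ⟨q.1, q.2, hq.1⟩, ?_, ?_⟩
  · intro he
    apply hpq
    obtain ⟨p1, p2⟩ := p
    obtain ⟨q1, q2⟩ := q
    simp only [Sigma.mk.injEq] at he
    obtain ⟨rfl, he⟩ := he
    simp at he
    simp [he]
  · rintro ⟨f, i, hi⟩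
    constructor
    · intro he
      have : (f, i) ∈ {p | Multigraph.IsOcc emb.boundary e p} := ⟨hi, he⟩
      rw [h] at this
      rcases this with h | h
      · left; subst h; rfl
      · right
        rw [Set.mem_singleton_iff] at h
        subst h; rfl
    · rintro (h | h)
      · cases h; exact hp.2
      · cases h; exact hq.2

theorem occ_eq {v : V} (y : F → ZMod 2)
    (hy : ∀ p q : Sd emb, eg emb p = eg emb q → y p.1 = y q.1) {f f' : F} {i i' : ℕ}
    (h : Multigraph.IsCorner emb.boundary v (f, i)) (h' : Multigraph.IsCorner emb.boundary v (f', i')) : y f = y f' := by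
  have := emb.link_conn v _ _ h h'
  have key : ∀ c c' : F × ℕ, Relation.EqvGen (Multigraph.CornerLinked emb.boundary v) c c' → y c.1 = y c'.1 := by
    intro c c' h
    induction h with
    | rel c c' h =>
      obtain ⟨_, _, e, p, p', _, h1, h2, h3, h4⟩ := h
      rw [h3.1, h4.1]
      exact hy ⟨p.1, p.2, h1.1⟩ ⟨p'.1, p'.2, h2.1⟩ (h1.2.trans h2.2.symm)
    | refl => rfl
    | symm _ _ _ ih => exact ih.symm
    | trans _ _ _ _ _ ih1 ih2 => exact ih1.trans ih2
  exact key _ _ this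

theorem corner_mod (f : F) (i : ℕ) :
    Multigraph.IsCorner emb.boundary ((emb.boundary f).vtx i) (f, i % (emb.boundary f).len) := by
  refine ⟨Nat.mod_lt _ (emb.boundary f).len_pos, ?_⟩
  have : Function.Periodic (emb.boundary f).vtx (emb.boundary f).len := (emb.boundary f).vtx_per
  exact this.map_mod_nat i

theorem face_const (y : F → ZMod 2)
    (hy : ∀ p q : Sd emb, eg emb p = eg emb q → y p.1 = y q.1) (f f' : F) : y f = y f' := by
  let p : V → Prop := fun v => ∀ g i, Multigraph.IsCorner emb.boundary v (g, i) → y f = y g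
  have c0 : ∀ f, Multigraph.IsCorner emb.boundary ((emb.boundary f).vtx 0) (f, 0) := fun f =>
    ⟨(emb.boundary f).len_pos, rfl⟩
  have hp : ∀ u v, G.simple.Adj u v → p u → p v := by
    rintro u v ⟨-, e, he⟩ hu g i hc
    obtain ⟨⟨h, j⟩, _, _, hs⟩ := eg_two emb e
    have e1 : (emb.boundary h).edge j = e := (hs ⟨h, j⟩).2 (Or.inl rfl)
    have e2 := (emb.boundary h).compat j
    rw [e1, he, Sym2.eq_iff] at e2
    have c1 := corner_mod emb h j
    have c2 := corner_mod emb h (j+1)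
    rcases e2 with ⟨rfl, rfl⟩ | ⟨rfl, rfl⟩
    · rw [hu _ _ c1]; exact occ_eq emb y hy c2 hc
    · rw [hu _ _ c2]; exact occ_eq emb y hy c1 hc
  have p0 : p ((emb.boundary f).vtx 0) := fun g i hc => occ_eq emb y hy (c0 f) hc
  exact reach_pred p hp (emb.conn.preconnected _ ((emb.boundary f').vtx 0)) p0 f' 0 (c0 f')

variable [Fintype V] [Fintype E] [Fintype F]

noncomputable def Am : Matrix F E (ZMod 2) := fun f e => ∑ i : Fin (emb.boundary f).len, if eg emb ⟨f, i⟩ = e then 1 else 0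

theorem Am_mul (c : E → ZMod 2) (f : F) : (Am emb).mulVec c f = ∑ i : Fin (emb.boundary f).len, c (eg emb ⟨f, i⟩) := by
  simp only [Matrix.mulVec, dotProduct, Am, Finset.sum_mul]
  rw [Finset.sum_comm]
  refine Finset.sum_congr rfl fun i _ => ?_
  simp

theorem Am_tmul (y : F → ZMod 2) (h : (Am emb).transpose.mulVec y = 0) (p q : Sd emb) (hpq : eg emb p = eg emb q) :
    y p.1 = y q.1 := by
  by_cases hne : p = q
  · rw [hne]
  have h1 := congrFun h (eg emb p)
  simp only [Matrix.mulVec, dotProduct, Matrix.transpose_apply, Am, Finset.sum_mul] at h1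
  have h2 : ∑ s : Sd emb, (if eg emb s = eg emb p then (1 : ZMod 2) else 0) * y s.1 = 0 := by
    rw [Fintype.sum_sigma]; exact h1
  simp only [ite_mul, one_mul, zero_mul] at h2
  rw [← Finset.sum_filter] at h2
  have : Finset.univ.filter (fun s : Sd emb => eg emb s = eg emb p) = {p, q} := by
    obtain ⟨a, b, hab, h⟩ := eg_two emb (eg emb p)
    have hp := (h p).1 rfl
    have hq := (h q).1 hpq.symm
    ext s
    simp only [Finset.mem_filter, Finset.mem_univ, true_and, h, Finset.mem_insert, Finset.mem_singleton]
    rcases hp with rfl | rfl <;> rcases hq with rfl | rfl <;> tauto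
  rw [this, Finset.sum_pair hne] at h2
  exact Cx.zeq_of_add h2

theorem rank_Am [Nonempty F] : Fintype.card F ≤ (Am emb).rank + 1 := by
  rw [← Matrix.rank_transpose]
  have h1 := LinearMap.finrank_range_add_finrank_ker (Am emb).transpose.mulVecLin
  rw [Module.finrank_fintype_fun_eq_card] at h1
  have h2 : Module.finrank (ZMod 2) (LinearMap.ker (Am emb).transpose.mulVecLin) ≤ 1 := by
    have hle : LinearMap.ker (Am emb).transpose.mulVecLin ≤ Submodule.span (ZMod 2) {fun _ => 1} := by
      intro y hy
      rw [LinearMap.mem_ker, Matrix.mulVecLin_apply] at hy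
      have := face_const emb y (Am_tmul emb y hy)
      obtain ⟨f0⟩ := ‹Nonempty F›
      rw [Submodule.mem_span_singleton]
      exact ⟨y f0, by ext f; simp [this f f0]⟩
    exact (Submodule.finrank_mono hle).trans ((finrank_span_le_card _).trans (by simp))
  have h3 : (Am emb).transpose.rank = Module.finrank (ZMod 2) (LinearMap.range (Am emb).transpose.mulVecLin) := rfl
  omega

structure Tree (G : Multigraph V E) where
  r : V
  dp : V → ℕ
  par : V → V
  pe : V → E
  dr : dp r = 0
  pr : par r = r
  he : ∀ v, v ≠ r → G.ends (pe v) = s(v, par v)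
  hd : ∀ v, v ≠ r → dp (par v) + 1 = dp v
  lip : ∀ e u v, G.ends e = s(u, v) → dp u ≤ dp v + 1

theorem exists_tree [Nonempty E] (hc : G.simple.Connected) (r : V) : ∃ Tr : Tree G, Tr.r = r := by
  have h : ∀ v, ∃ (u : V) (e : E), (v = r → u = r) ∧ (v ≠ r → G.ends e = s(v, u) ∧ G.simple.dist r u + 1 = G.simple.dist r v) := by
    intro v
    by_cases hv : v = r
    · exact ⟨r, Classical.arbitrary E, fun _ => rfl, fun h => absurd hv h⟩
    · obtain ⟨p, hp⟩ := hc.exists_walk_length_eq_dist v r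
      cases p with
      | nil => exact absurd rfl hv
      | cons h q =>
        rename_i u
        obtain ⟨hne, e, he⟩ := id h
        refine ⟨u, e, fun h => absurd h hv, fun _ => ⟨he, ?_⟩⟩
        rw [G.simple.dist_comm (u := r), G.simple.dist_comm (u := r)]
        simp only [SimpleGraph.Walk.length_cons] at hp
        have h1 := SimpleGraph.dist_le q
        have h2 := hc.dist_triangle (u := v) (v := u) (w := r)
        have h3 : G.simple.dist v u = 1 := SimpleGraph.dist_eq_one_iff_adj.2 h
        omega
  choose par pe h1 h2 using h
  refine ⟨⟨r, G.simple.dist r, par, pe, SimpleGraph.dist_self, h1 r rfl, fun v hv => (h2 v hv).1, fun v hv => (h2 v hv).2, ?_⟩, rfl⟩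
  intro e u v he
  by_cases huv : u = v
  · subst huv; omega
  · have h3 : G.simple.dist v u = 1 := SimpleGraph.dist_eq_one_iff_adj.2 (G.simple.symm.symm _ _ ⟨huv, e, he⟩)
    have := hc.dist_triangle (u := r) (v := v) (w := u)
    omega

namespace Tree
variable {G : Multigraph V E} (Tr : Tree G)
theorem r_of_dp {v : V} (h : Tr.dp v = 0) : v = Tr.r := by
  by_contra hv
  have := Tr.hd v hv
  omega
theorem dp_par (v : V) : Tr.dp (Tr.par v) = Tr.dp v - 1 := by
  by_cases h : v = Tr.r
  · rw [h, Tr.pr, Tr.dr]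
  · have := Tr.hd v h; omega
theorem dp_iter (n : ℕ) (v : V) : Tr.dp (Tr.par^[n] v) = Tr.dp v - n := by
  induction n with
  | zero => rfl
  | succ n ih => rw [Function.iterate_succ_apply', dp_par, ih]; omega
theorem iter_r (v : V) : Tr.par^[Tr.dp v] v = Tr.r := by
  apply r_of_dp; rw [dp_iter]; omega
theorem ind {p : V → Prop} (h0 : p Tr.r) (h : ∀ v, v ≠ Tr.r → p (Tr.par v) → p v) (v : V) : p v := by
  generalize hn : Tr.dp v = n
  induction n generalizing v with
  | zero => rw [Tr.r_of_dp hn]; exact h0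
  | succ n ih =>
    have hv : v ≠ Tr.r := by rintro rfl; rw [Tr.dr] at hn; omega
    exact h v hv (ih _ (by rw [dp_par]; omega))
theorem exists_psi (c : E → ZMod 2) : ∃ ψ : V → ZMod 2, ψ Tr.r = 0 ∧ ∀ v, v ≠ Tr.r → c (Tr.pe v) = ψ v + ψ (Tr.par v) := by
  refine ⟨fun v => ∑ k ∈ Finset.range (Tr.dp v), c (Tr.pe (Tr.par^[k] v)), by simp [Tr.dr], fun v hv => ?_⟩
  simp only
  rw [← Tr.hd v hv, Finset.sum_range_succ']
  simp only [Function.iterate_succ_apply, Function.iterate_zero, id]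
  rw [add_right_comm, Cx.zadd_self, zero_add]
end Tree

/-- cocycles -/
noncomputable def Kc : Submodule (ZMod 2) (E → ZMod 2) := LinearMap.ker (Am emb).mulVecLin
theorem mem_Kc (c : E → ZMod 2) : c ∈ Kc emb ↔ ∀ f, ∑ i : Fin (emb.boundary f).len, c (eg emb ⟨f, i⟩) = 0 := by
  rw [Kc, LinearMap.mem_ker, Matrix.mulVecLin_apply, funext_iff]
  simp [Am_mul]

def dl (G : Multigraph V E) (ψ : V → ZMod 2) (e : E) : ZMod 2 :=
  Sym2.lift ⟨fun u v => ψ u + ψ v, fun _ _ => add_comm _ _⟩ (G.ends e)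
theorem dl_eq {G : Multigraph V E} (ψ : V → ZMod 2) {e : E} {u v : V} (h : G.ends e = s(u, v)) : dl G ψ e = ψ u + ψ v := by
  simp [dl, h]

theorem dl_Kc (ψ : V → ZMod 2) : dl G ψ ∈ Kc emb := by
  rw [mem_Kc]
  intro f
  have : ∀ i : Fin (emb.boundary f).len, dl G ψ (eg emb ⟨f, i⟩) = ψ ((emb.boundary f).vtx i) + ψ ((emb.boundary f).vtx (i+1)) :=
    fun i => dl_eq ψ ((emb.boundary f).compat i)
  simp only [this]
  rw [Fin.sum_univ_eq_sum_range (fun i => ψ ((emb.boundary f).vtx i) + ψ ((emb.boundary f).vtx (i+1)))]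
  rw [Finset.sum_add_distrib]
  have h1 := Finset.sum_range_succ (fun i => ψ ((emb.boundary f).vtx i)) (emb.boundary f).len
  have h2 := Finset.sum_range_succ' (fun i => ψ ((emb.boundary f).vtx i)) (emb.boundary f).len
  have h3 : (emb.boundary f).vtx (emb.boundary f).len = (emb.boundary f).vtx 0 := by
    have := (emb.boundary f).vtx_per 0; rwa [zero_add] at this
  rw [h2, h3] at h1
  have h4 := add_right_cancel h1
  rw [h4, Cx.zadd_self]

theorem exists_X [Nonempty F] (Tr : Tree G) {g : ℕ} (hg : emb.eulerGenus = (g : ℤ)) :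
    ∃ X : Finset E, X.card ≤ g ∧ ∀ c ∈ Kc emb, (∀ v, v ≠ Tr.r → c (Tr.pe v) = 0) → (∀ e ∈ X, c e = 0) → c = 0 := by
  let K0 : Submodule (ZMod 2) (E → ZMod 2) := Kc emb ⊓ LinearMap.ker
    (LinearMap.pi fun v : {v // v ≠ Tr.r} => (LinearMap.proj (Tr.pe v) : (E → ZMod 2) →ₗ[ZMod 2] ZMod 2))
  have hK0 : ∀ c, c ∈ K0 ↔ c ∈ Kc emb ∧ ∀ v, v ≠ Tr.r → c (Tr.pe v) = 0 := by
    intro c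
    simp only [K0, Submodule.mem_inf, LinearMap.mem_ker, funext_iff, LinearMap.pi_apply, LinearMap.proj_apply, Subtype.forall, Pi.zero_apply]
  let ex : ({v // v ≠ Tr.r} → ZMod 2) → V → ZMod 2 := fun ψ v => if h : v ≠ Tr.r then ψ ⟨v, h⟩ else 0
  have exr : ∀ ψ, ex ψ Tr.r = 0 := fun ψ => dif_neg (by simp)
  let Φ : (K0 × ({v // v ≠ Tr.r} → ZMod 2)) →ₗ[ZMod 2] Kc emb :=
    { toFun := fun x => ⟨x.1.1 + dl G (ex x.2), (Kc emb).add_mem ((hK0 _).1 x.1.2).1 (dl_Kc emb _)⟩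
      map_add' := by
        rintro ⟨a, b⟩ ⟨a', b'⟩
        ext e
        have hb : ex (b + b') = ex b + ex b' := by
          funext v; simp only [ex, Pi.add_apply]; split_ifs <;> simp
        simp only [Prod.mk_add_mk, hb, Submodule.coe_add, Pi.add_apply]
        have : dl G (ex b + ex b') e = dl G (ex b) e + dl G (ex b') e := by
          unfold dl
          induction G.ends e with | _ u v => simp; ring
        rw [this]; ring
      map_smul' := by
        rintro m ⟨a, b⟩
        ext e
        have hb : ex (m • b) = m • ex b := by
          funext v; simp only [ex, Pi.smul_apply]; split_ifs <;> simp
        simp only [Prod.smul_mk, hb, Submodule.coe_smul, Pi.smul_apply, Pi.add_apply, RingHom.id_apply]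
        have : dl G (m • ex b) e = m • dl G (ex b) e := by
          unfold dl
          induction G.ends e with | _ u v => simp; ring
        rw [this, smul_add] }
  have hinj : Function.Injective Φ := by
    rw [← LinearMap.ker_eq_bot, LinearMap.ker_eq_bot']
    rintro ⟨c, ψ⟩ h
    have h1 : ∀ e, c.1 e + dl G (ex ψ) e = 0 := fun e => congrFun (congrArg Subtype.val h) e
    have h2 : ∀ v, ex ψ v = 0 := by
      refine Tr.ind (exr ψ) fun v hv ih => ?_
      have := h1 (Tr.pe v)
      rw [((hK0 _).1 c.2).2 v hv, dl_eq _ (Tr.he v hv), ih] at this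
      simpa using this
    have h3 : ψ = 0 := by
      funext v
      have := h2 v.1
      simpa [ex, v.2] using this
    have h4 : c = 0 := by
      ext e
      have := h1 e
      have h5 : dl G (ex ψ) e = 0 := by
        unfold dl
        induction G.ends e with | _ u v => simp [h2]
      rw [h5, add_zero] at this
      exact this
    rw [h3, h4]; rfl
  have hdim := LinearMap.finrank_le_finrank_of_injective hinj
  rw [Module.finrank_prod, Module.finrank_fintype_fun_eq_card] at hdim
  have hv : Fintype.card {v // v ≠ Tr.r} + 1 = Fintype.card V := by
    have := Fintype.card_subtype_compl (fun v => v = Tr.r)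
    rw [Fintype.card_subtype_eq] at this
    have h0 : 0 < Fintype.card V := Fintype.card_pos_iff.2 ⟨Tr.r⟩
    have h1 : Fintype.card {v // v ≠ Tr.r} = Fintype.card V - 1 := this
    omega
  have h1 := LinearMap.finrank_range_add_finrank_ker (Am emb).mulVecLin
  rw [Module.finrank_fintype_fun_eq_card] at h1
  have h3 : (Am emb).rank = Module.finrank (ZMod 2) (LinearMap.range (Am emb).mulVecLin) := rfl
  have h4 := rank_Am emb
  have h5 : Module.finrank (ZMod 2) (Kc emb) = Module.finrank (ZMod 2) (LinearMap.ker (Am emb).mulVecLin) := rfl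
  unfold Multigraph.Embedding.eulerGenus at hg
  rw [Nat.card_eq_fintype_card, Nat.card_eq_fintype_card, Nat.card_eq_fintype_card] at hg
  obtain ⟨X, hX1, hX2⟩ := exists_test g K0 (by omega)
  exact ⟨X, hX1, fun c h1 h2 h3 => hX2 c ((hK0 c).2 ⟨h1, h2⟩) h3⟩
end
end FLP

namespace FLP
open Classical
set_option linter.unusedSectionVars false
section
variable {V E F : Type} [Fintype V] [Fintype E] [Fintype F] {G : Multigraph V E} (emb : G.Embedding F)
  (Tr : Tree G) (X : Finset E)

def Zs (Tr : Tree G) (X : Finset E) : Set V := {v | v = Tr.r ∨ ∃ e ∈ X, ∃ u, u ∈ G.ends e ∧ ∃ n, Tr.par^[n] u = v}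
theorem Zs_r : Tr.r ∈ Zs Tr X := Or.inl rfl
theorem Zs_par {v : V} (h : v ∈ Zs Tr X) : Tr.par v ∈ Zs Tr X := by
  rcases h with rfl | ⟨e, he, u, hu, n, rfl⟩
  · rw [Tr.pr]; exact Or.inl rfl
  · exact Or.inr ⟨e, he, u, hu, n+1, Function.iterate_succ_apply' _ _ _⟩
theorem Zs_X {e : E} (he : e ∈ X) {u : V} (hu : u ∈ G.ends e) : u ∈ Zs Tr X := Or.inr ⟨e, he, u, hu, 0, rfl⟩

noncomputable def pi0 (v : V) : V := if v ∈ Zs Tr X then Tr.r else v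
theorem pi0_in {v : V} (h : v ∈ Zs Tr X) : pi0 Tr X v = Tr.r := if_pos h
theorem pi0_out {v : V} (h : v ∉ Zs Tr X) : pi0 Tr X v = v := if_neg h
theorem pi0_pi0 (v : V) : pi0 Tr X (pi0 Tr X v) = pi0 Tr X v := by
  by_cases h : v ∈ Zs Tr X
  · rw [pi0_in _ _ h, pi0_in _ _ (Zs_r _ _)]
  · rw [pi0_out _ _ h, pi0_out _ _ h]

abbrev W0 := {v : V // pi0 Tr X v = v}
noncomputable def pj (v : V) : W0 Tr X := ⟨pi0 Tr X v, pi0_pi0 Tr X v⟩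
theorem pj_in {v : V} (h : v ∈ Zs Tr X) : pj Tr X v = pj Tr X Tr.r := by
  apply Subtype.ext; simp only [pj]; rw [pi0_in _ _ h, pi0_in _ _ (Zs_r _ _)]
theorem pj_val (w : W0 Tr X) : pj Tr X w.1 = w := Subtype.ext w.2
theorem pj_par (v : V) : pj Tr X (Tr.par (pj Tr X v).1) = pj Tr X (Tr.par v) := by
  by_cases h : v ∈ Zs Tr X
  · have e : (pj Tr X v).1 = Tr.r := pi0_in _ _ h
    rw [e, Tr.pr, pj_in _ _ (Zs_par _ _ h)]
  · have e : (pj Tr X v).1 = v := pi0_out _ _ h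
    rw [e]
theorem pj_inj {u v : V} (h : pj Tr X u = pj Tr X v) (hv : v ∉ Zs Tr X) : u = v := by
  have e := congrArg Subtype.val h
  simp only [pj] at e
  rw [pi0_out _ _ hv] at e
  by_cases hu : u ∈ Zs Tr X
  · rw [pi0_in _ _ hu] at e; exact absurd (e ▸ Zs_r Tr X) hv
  · rwa [pi0_out _ _ hu] at e

noncomputable def qs (f : F) (n : ℕ) : Sd emb := ⟨f, n % (emb.boundary f).len, Nat.mod_lt _ (emb.boundary f).len_pos⟩
theorem qs_self (s : Sd emb) : qs emb s.1 s.2 = s := by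
  obtain ⟨f, i, hi⟩ := s
  simp [qs, Nat.mod_eq_of_lt hi]
theorem eg_qs (f : F) (n : ℕ) : eg emb (qs emb f n) = (emb.boundary f).edge n := by
  have : Function.Periodic (emb.boundary f).edge (emb.boundary f).len := (emb.boundary f).edge_per
  exact this.map_mod_nat n
theorem vtx_mod (f : F) (n : ℕ) : (emb.boundary f).vtx (n % (emb.boundary f).len) = (emb.boundary f).vtx n := by
  have : Function.Periodic (emb.boundary f).vtx (emb.boundary f).len := (emb.boundary f).vtx_per
  exact this.map_mod_nat n
theorem vtx_mod1 (f : F) (n : ℕ) : (emb.boundary f).vtx (n % (emb.boundary f).len + 1) = (emb.boundary f).vtx (n+1) := by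
  rw [← vtx_mod, Nat.mod_add_mod, vtx_mod]

noncomputable def nx (s : Sd emb) : Sd emb := qs emb s.1 (s.2 + 1)
theorem nx_qs (f : F) (n : ℕ) : nx emb (qs emb f n) = qs emb f (n+1) := by
  simp [nx, qs]
theorem nx_inj : Function.Injective (nx emb) := by
  rintro ⟨f, i, hi⟩ ⟨f', j, hj⟩ h
  simp only [nx, qs, Sigma.mk.injEq] at h
  obtain ⟨rfl, h⟩ := h
  simp only [heq_eq_eq, Fin.mk.injEq] at h
  have : i = j := by
    have h1 : (i + 1 : ℕ) ≡ j + 1 [MOD (emb.boundary f).len] := h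
    have h2 := Nat.ModEq.add_right_cancel' 1 h1
    have h3 : i % _ = j % _ := h2
    rwa [Nat.mod_eq_of_lt hi, Nat.mod_eq_of_lt hj] at h3
  subst this; rfl

noncomputable def vtC (s : Sd emb) : Fin 3 → W0 Tr X ⊕ F :=
  ![.inl (pj Tr X ((emb.boundary s.1).vtx s.2)), .inl (pj Tr X ((emb.boundary s.1).vtx (s.2+1))), .inr s.1]
noncomputable def edC (s : Sd emb) : Fin 3 → E ⊕ Sd emb := ![.inl (eg emb s), .inr (nx emb s), .inr s]
noncomputable def enC : E ⊕ Sd emb → Sym2 (W0 Tr X ⊕ F) :=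
  Sum.elim (fun e => (G.ends e).map fun v => .inl (pj Tr X v))
    (fun s => s(.inl (pj Tr X ((emb.boundary s.1).vtx s.2)), .inr s.1))

theorem enC_ends (s : Sd emb) (i : Fin 3) : enC emb Tr X (edC emb s i) = s(vtC emb Tr X s i, vtC emb Tr X s (i+1)) := by
  fin_cases i
  · simp only [edC, vtC, enC]
    have := (emb.boundary s.1).compat s.2
    simp [eg, this]
  · simp only [edC, vtC, enC]
    simp [nx, qs, vtx_mod]
  · simp only [edC, vtC, enC]
    simp [Sym2.eq_swap]

theorem edC_two (e : E ⊕ Sd emb) : ∃ p q : Sd emb × Fin 3, p ≠ q ∧ ∀ s : Sd emb × Fin 3, edC emb s.1 s.2 = e ↔ s = p ∨ s = q := by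
  rcases e with e | s0
  · obtain ⟨p, q, hpq, h⟩ := eg_two emb e
    refine ⟨(p, 0), (q, 0), by simp [hpq], ?_⟩
    rintro ⟨s, i⟩
    fin_cases i <;> simp [edC, h]
  · obtain ⟨p, hp⟩ := (Finite.surjective_of_injective (nx_inj emb)) s0
    refine ⟨(p, 1), (s0, 2), by simp, ?_⟩
    rintro ⟨s, i⟩
    fin_cases i
    · simp [edC]
    · simp [edC, ← hp, (nx_inj emb).eq_iff]
    · simp [edC]

theorem coC (hX : ∀ c ∈ Kc emb, (∀ v, v ≠ Tr.r → c (Tr.pe v) = 0) → (∀ e ∈ X, c e = 0) → c = 0)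
    (D : E ⊕ Sd emb → ZMod 2) (h1 : ∀ t, ∑ i, D (edC emb t i) = 0)
    (h2 : ∀ e, (enC emb Tr X e).IsDiag → D e = 0) :
    ∃ φ : W0 Tr X ⊕ F → ZMod 2, ∀ t i, D (edC emb t i) = φ (vtC emb Tr X t i) + φ (vtC emb Tr X t (i+1)) := by
  let c : E → ZMod 2 := fun e => D (.inl e)
  let a : F → ℕ → ZMod 2 := fun f n => D (.inr (qs emb f n))
  have hs : ∀ f n, c ((emb.boundary f).edge n) + a f (n+1) + a f n = 0 := by
    intro f n
    have := h1 (qs emb f n)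
    rw [Fin.sum_univ_three] at this
    simpa [edC, nx_qs, eg_qs, c, a] using this
  have hs' : ∀ f n, c ((emb.boundary f).edge n) = a f n + a f (n+1) := by
    intro f n
    rw [add_comm (a f n)]
    exact Cx.zeq_of_add (by rw [← add_assoc]; exact hs f n)
  have hK : c ∈ Kc emb := by
    rw [mem_Kc]
    intro f
    show ∑ i : Fin (emb.boundary f).len, c ((emb.boundary f).edge i) = 0
    simp only [hs']
    rw [Fin.sum_univ_eq_sum_range (fun i => a f i + a f (i+1)), Finset.sum_add_distrib]
    have g1 := Finset.sum_range_succ (a f) (emb.boundary f).len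
    have g2 := Finset.sum_range_succ' (a f) (emb.boundary f).len
    have g3 : a f (emb.boundary f).len = a f 0 := by simp [a, qs]
    rw [g2, g3] at g1
    have g4 := add_right_cancel g1
    rw [g4, Cx.zadd_self]
  obtain ⟨ψ, p0, pp⟩ := Tr.exists_psi c
  have hdg : ∀ e u v, G.ends e = s(u, v) → u ∈ Zs Tr X → v ∈ Zs Tr X → c e = 0 := by
    intro e u v he hu hv
    apply h2
    simp [enC, he, pj_in Tr X hu, pj_in Tr X hv]
  have hz : ∀ v, v ∈ Zs Tr X → ψ v = 0 := by
    refine Tr.ind (fun _ => p0) fun v hv ih hz => ?_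
    have hz' := Zs_par _ _ hz
    have := pp v hv
    rw [ih hz', hdg _ _ _ (Tr.he v hv) hz hz', add_zero] at this
    exact this.symm
  have hc : c + dl G ψ = 0 := by
    refine hX _ ((Kc emb).add_mem hK (dl_Kc emb ψ)) ?_ ?_
    · intro v hv
      rw [Pi.add_apply, dl_eq _ (Tr.he v hv), pp v hv, Cx.zadd_self]
    · intro e he
      obtain ⟨u, v, huv⟩ : ∃ u v, G.ends e = s(u, v) := by
        induction h : G.ends e with | _ u v => exact ⟨u, v, rfl⟩
      have hu := Zs_X Tr X he (u := u) (by rw [huv]; simp)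
      have hv := Zs_X Tr X he (u := v) (by rw [huv]; simp)
      rw [Pi.add_apply, dl_eq _ huv, hz u hu, hz v hv, hdg e u v huv hu hv]; simp
  have hce : ∀ e u v, G.ends e = s(u, v) → c e = ψ u + ψ v := by
    intro e u v h
    rw [← dl_eq ψ h]
    exact Cx.zeq_of_add (congrFun hc e)
  have hpj : ∀ v, ψ (pj Tr X v).1 = ψ v := by
    intro v
    by_cases h : v ∈ Zs Tr X
    · have e : (pj Tr X v).1 = Tr.r := pi0_in _ _ h
      rw [e, p0, hz v h]
    · have e : (pj Tr X v).1 = v := pi0_out _ _ h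
      rw [e]
  have hsp : ∀ f n, a f n = ψ ((emb.boundary f).vtx n) + (ψ ((emb.boundary f).vtx 0) + a f 0) := by
    intro f n
    induction n with
    | zero => rw [← add_assoc, Cx.zadd_self, zero_add]
    | succ n ih =>
      have h := hs f n
      rw [hce _ _ _ ((emb.boundary f).compat n), ih] at h
      generalize ψ ((emb.boundary f).vtx n) = x1 at *
      generalize ψ ((emb.boundary f).vtx (n+1)) = x2 at *
      generalize ψ ((emb.boundary f).vtx 0) = x3 at *
      generalize a f 0 = x4 at *
      generalize a f (n+1) = x5 at *
      clear * - h
      revert x1 x2 x3 x4 x5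
      decide
  refine ⟨Sum.elim (fun w => ψ w.1) (fun f => ψ ((emb.boundary f).vtx 0) + a f 0), ?_⟩
  intro t i
  have hq := qs_self emb t
  fin_cases i
  · simp only [edC, vtC]
    simp only [Fin.zero_eta, Matrix.cons_val_zero, zero_add, Matrix.cons_val_one, Sum.elim_inl, hpj]
    exact hce _ _ _ ((emb.boundary t.1).compat t.2)
  · simp only [edC, vtC]
    simp [hpj]
    exact hsp t.1 (t.2 + 1)
  · simp only [edC, vtC]
    simp [hpj]
    have := hsp t.1 t.2
    simp only [a, hq] at this
    rw [this]; ring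

noncomputable def CX (hX : ∀ c ∈ Kc emb, (∀ v, v ≠ Tr.r → c (Tr.pe v) = 0) → (∀ e ∈ X, c e = 0) → c = 0) :
    Cx (W0 Tr X ⊕ F) (E ⊕ Sd emb) (Sd emb) where
  vt := vtC emb Tr X
  ed := edC emb
  ends := enC emb Tr X
  hends := enC_ends emb Tr X
  two := edC_two emb
  coh := coC emb Tr X hX

noncomputable def parC : W0 Tr X ⊕ F → W0 Tr X ⊕ F :=
  Sum.elim (fun w => .inl (pj Tr X (Tr.par w.1))) (fun f => .inl (pj Tr X ((emb.boundary f).vtx 0)))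
def spC (d : ℕ) : W0 Tr X ⊕ F → Prop := Sum.elim (fun _ => False) (fun f => (emb.boundary f).len ≤ d)

theorem parC_iter (n : ℕ) (v : V) : (parC emb Tr X)^[n] (.inl (pj Tr X v)) = .inl (pj Tr X (Tr.par^[n] v)) := by
  induction n with
  | zero => rfl
  | succ n ih =>
    rw [Function.iterate_succ_apply', ih, Function.iterate_succ_apply']
    simp only [parC, Sum.elim_inl, pj_par]

variable (hX : ∀ c ∈ Kc emb, (∀ v, v ≠ Tr.r → c (Tr.pe v) = 0) → (∀ e ∈ X, c e = 0) → c = 0)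

theorem CX_vt (t : Sd emb) (i : Fin 3) : (CX emb Tr X hX).vt t i = vtC emb Tr X t i := rfl
theorem R_qs (f : F) (n : ℕ) : (CX emb Tr X hX).R (.inl (pj Tr X ((emb.boundary f).vtx n))) (.inl (pj Tr X ((emb.boundary f).vtx (n+1)))) := by
  refine ⟨qs emb f n, 0, 1, ?_, ?_⟩
  · rw [CX_vt]
    simp [vtC, qs, vtx_mod]
  · rw [CX_vt]
    simp [vtC, qs, vtx_mod1]
theorem R_spoke (f : F) (n : ℕ) : (CX emb Tr X hX).R (.inr f) (.inl (pj Tr X ((emb.boundary f).vtx n))) := by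
  refine ⟨qs emb f n, 2, 0, ?_, ?_⟩
  · rw [CX_vt]
    simp [vtC, qs]
  · rw [CX_vt]
    simp [vtC, qs, vtx_mod]
theorem R_edge {e : E} {u v : V} (h : G.ends e = s(u, v)) : (CX emb Tr X hX).R (.inl (pj Tr X u)) (.inl (pj Tr X v)) := by
  obtain ⟨s, _, _, hs⟩ := eg_two emb e
  have e1 : (emb.boundary s.1).edge s.2 = e := (hs s).2 (Or.inl rfl)
  have e2 := (emb.boundary s.1).compat s.2
  rw [e1, h, Sym2.eq_iff] at e2
  rcases e2 with ⟨rfl, rfl⟩ | ⟨rfl, rfl⟩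
  · exact R_qs ..
  · exact (R_qs ..).symm

theorem inpC (d : ℕ) (f0 : F) (hr : Tr.r = (emb.boundary f0).vtx 0) :
    (CX emb Tr X hX).Inp (.inl (pj Tr X Tr.r)) (parC emb Tr X) (spC emb Tr X d) := by
  have hR : ∀ w, (CX emb Tr X hX).R w (parC emb Tr X w) := by
    rintro (w | f)
    · by_cases h : w.1 = Tr.r
      · have e : w = pj Tr X Tr.r := by rw [← pj_val Tr X w, h]
        have : parC emb Tr X (.inl w) = .inl (pj Tr X Tr.r) := by simp [parC, h, Tr.pr]
        rw [this, e, hr]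
        obtain ⟨t, i, j, h1, h2⟩ := R_qs emb Tr X hX f0 0
        exact ⟨t, i, i, h1, h1⟩
      · have := R_edge emb Tr X hX (Tr.he _ h)
        rw [pj_val] at this
        exact this
    · exact R_spoke emb Tr X hX f 0
  have hz : ∀ w, ∃ n, (parC emb Tr X)^[n] w = .inl (pj Tr X Tr.r) := by
    have key : ∀ v, ∃ n, (parC emb Tr X)^[n] (.inl (pj Tr X v)) = .inl (pj Tr X Tr.r) := fun v =>
      ⟨Tr.dp v, by rw [parC_iter, Tr.iter_r]⟩
    rintro (w | f)
    · have := key w.1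
      rwa [pj_val] at this
    · obtain ⟨n, hn⟩ := key ((emb.boundary f).vtx 0)
      exact ⟨n+1, by rw [Function.iterate_succ_apply]; exact hn⟩
  refine ⟨?_, hR, hz, ?_, ?_⟩
  · refine Cx.Cn.mk' (.inl (pj Tr X Tr.r)) trivial ?_
    intro p hp p0 y _
    obtain ⟨n, hn⟩ := hz y
    induction n generalizing y with
    | zero => rw [show y = _ from hn]; exact p0
    | succ n ih =>
      rw [Function.iterate_succ_apply] at hn
      exact hp _ trivial _ trivial (hR y).symm (ih _ trivial hn)
  · rintro (w | f) (w' | f') h1 h2 r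
    · exact absurd h1 id
    · exact absurd h1 id
    · exact absurd h2 id
    · obtain ⟨t, i, j, e1, e2⟩ := r
      change vtC emb Tr X t i = _ at e1
      change vtC emb Tr X t j = _ at e2
      have key : ∀ i f, vtC emb Tr X t i = .inr f → f = t.1 := by
        intro i f h
        fin_cases i <;> simp [vtC] at h
        exact h.symm
      rw [key _ _ e1, key _ _ e2]
  · rintro (w | f) h <;> exact h
end
end FLP

namespace FLP
open Classical
set_option linter.unusedSectionVars false
section
variable {V E F : Type} [Fintype V] [Fintype E] [Fintype F] {G : Multigraph V E} (emb : G.Embedding F)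
  (Tr : Tree G) (X : Finset E)

noncomputable def An (v : V) : Finset V := Finset.univ.filter fun x => ∃ n, Tr.par^[n] v = x
theorem mem_An {v x : V} : x ∈ An Tr v ↔ ∃ n, Tr.par^[n] v = x := by simp [An]

theorem An_inj {v x y : V} (hx : x ∈ An Tr v) (hy : y ∈ An Tr v) (h : Tr.dp x = Tr.dp y) : x = y := by
  obtain ⟨n, rfl⟩ := (mem_An Tr).1 hx
  obtain ⟨m, rfl⟩ := (mem_An Tr).1 hy
  by_cases h0 : Tr.dp (Tr.par^[n] v) = 0
  · exact (Tr.r_of_dp h0).trans (Tr.r_of_dp (h.symm.trans h0)).symm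
  · rw [Tr.dp_iter] at h h0
    rw [Tr.dp_iter] at h
    have : n = m := by omega
    rw [this]

theorem An_card (v : V) {k : ℕ} (hk : 1 ≤ k) (j : ℕ) : ((An Tr v).filter fun x => Tr.dp x / k = j).card ≤ k := by
  have : ((An Tr v).filter fun x => Tr.dp x / k = j).card ≤ (Finset.Ico (j*k) (j*k+k)).card := by
    refine Finset.card_le_card_of_injOn Tr.dp ?_ ?_
    · intro x hx
      have hx2 := (Finset.mem_filter.1 hx).2
      have h1 := Nat.div_add_mod (Tr.dp x) k
      have h2 := Nat.mod_lt (Tr.dp x) hk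
      rw [hx2, mul_comm] at h1
      simp only [Finset.coe_Ico, Set.mem_Ico]
      omega
    · intro x hx y hy h
      exact An_inj Tr (Finset.mem_filter.1 hx).1 (Finset.mem_filter.1 hy).1 h
  simpa using this

theorem An_card' (v : V) {k : ℕ} (hk : 1 ≤ k) (j : ℕ) :
    (((An Tr v).filter fun x => Tr.dp x / k = j).erase v).card + (if Tr.dp v / k = j then 1 else 0) ≤ k := by
  have := An_card Tr v hk j
  split_ifs with h
  · have hm : v ∈ (An Tr v).filter fun x => Tr.dp x / k = j :=
      Finset.mem_filter.2 ⟨(mem_An Tr).2 ⟨0, rfl⟩, h⟩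
    rw [Finset.card_erase_add_one hm]; exact this
  · exact (Finset.card_erase_le).trans this

theorem cnt_S (S : Finset V) {k : ℕ} (hk : 1 ≤ k) (j : ℕ) :
    ((S.biUnion (An Tr)).filter fun x => Tr.dp x / k = j).card ≤ S.card * k := by
  rw [Finset.filter_biUnion]
  exact Finset.card_biUnion_le_card_mul _ _ _ fun x _ => An_card Tr x hk j

theorem cnt_face (S P : Finset V) (hSP : S ⊆ P) {k d : ℕ} (hk : 1 ≤ k) (j : ℕ) (hS : S.card ≤ 3) (hP : P.card ≤ d) :
    ((P ∪ S.biUnion (An Tr)).filter fun x => Tr.dp x / k = j).card ≤ d + 3 * k - 3 := by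
  let S1 := S.filter fun x => Tr.dp x / k = j
  let S2 := S.filter fun x => ¬ Tr.dp x / k = j
  have hsub : ((P ∪ S.biUnion (An Tr)).filter fun x => Tr.dp x / k = j) ⊆
      (P \ S2) ∪ S.biUnion fun v => ((An Tr v).filter fun x => Tr.dp x / k = j).erase v := by
    intro x hx
    obtain ⟨h1, h2⟩ := Finset.mem_filter.1 hx
    have h3 : x ∉ S2 := fun h => (Finset.mem_filter.1 h).2 h2
    rw [Finset.mem_union, Finset.mem_sdiff]
    by_cases hxP : x ∈ P
    · exact Or.inl ⟨hxP, h3⟩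
    · right
      rcases Finset.mem_union.1 h1 with h | h
      · exact absurd h hxP
      · obtain ⟨v, hv, hx⟩ := Finset.mem_biUnion.1 h
        refine Finset.mem_biUnion.2 ⟨v, hv, Finset.mem_erase.2 ⟨?_, Finset.mem_filter.2 ⟨hx, h2⟩⟩⟩
        rintro rfl
        exact hxP (hSP hv)
  have c1 := (Finset.card_le_card hsub).trans (Finset.card_union_le _ _)
  have c2 : (P \ S2).card + S2.card = P.card :=
    Finset.card_sdiff_add_card_eq_card ((Finset.filter_subset _ _).trans hSP)
  have c3 := Finset.card_biUnion_le (s := S) (t := fun v => ((An Tr v).filter fun x => Tr.dp x / k = j).erase v)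
  have c4 := Finset.sum_le_sum (s := S) (fun v _ => An_card' Tr v hk j)
  rw [Finset.sum_add_distrib, ← Finset.card_filter, Finset.sum_const, smul_eq_mul] at c4
  have c5 : S1.card + S2.card = S.card := Finset.card_filter_add_card_filter_not _
  have c6 : S.card * k = S.card * (k-1) + S.card := by
    obtain ⟨m, rfl⟩ : ∃ m, k = m + 1 := ⟨k-1, by omega⟩
    simp; ring
  have c7 : S.card * (k-1) ≤ 3 * (k-1) := Nat.mul_le_mul_right _ hS
  change _ + S1.card ≤ _ at c4
  omega

theorem cnt_Z {k g : ℕ} (hk : 1 ≤ k) (j : ℕ) (hXg : X.card ≤ g) (Q : Finset V) (hQ : ∀ v ∈ Q, v ∈ Zs Tr X) :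
    (Q.filter fun x => Tr.dp x / k = j).card ≤ max (2 * g * k) 1 := by
  by_cases hX : X = ∅
  · refine le_trans ?_ (le_max_right _ _)
    refine (Finset.card_le_card (t := {Tr.r}) ?_).trans (by simp)
    intro x hx
    rcases hQ x (Finset.mem_filter.1 hx).1 with h | ⟨e, he, _⟩
    · simp [h]
    · simp [hX] at he
  · refine le_trans ?_ (le_max_left _ _)
    obtain ⟨e0, he0⟩ := Finset.nonempty_iff_ne_empty.2 hX
    have hsub : Q.filter (fun x => Tr.dp x / k = j) ⊆
        X.biUnion fun e => (((Finset.univ.filter fun u => u ∈ G.ends e).biUnion (An Tr)).filter fun x => Tr.dp x / k = j) := by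
      intro x hx
      obtain ⟨h1, h2⟩ := Finset.mem_filter.1 hx
      rw [Finset.mem_biUnion]
      rcases hQ x h1 with rfl | ⟨e, he, u, hu, n, hn⟩
      · obtain ⟨u, hu⟩ : ∃ u, u ∈ G.ends e0 := ⟨_, Sym2.out_fst_mem _⟩
        refine ⟨e0, he0, Finset.mem_filter.2 ⟨Finset.mem_biUnion.2 ⟨u, by simpa using hu, ?_⟩, h2⟩⟩
        exact (mem_An Tr).2 ⟨_, Tr.iter_r u⟩
      · exact ⟨e, he, Finset.mem_filter.2 ⟨Finset.mem_biUnion.2 ⟨u, by simpa using hu, (mem_An Tr).2 ⟨n, hn⟩⟩, h2⟩⟩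
    refine (Finset.card_le_card hsub).trans ?_
    refine (Finset.card_biUnion_le_card_mul _ _ (2 * k) fun e _ => ?_).trans ?_
    · refine (cnt_S Tr _ hk j).trans (Nat.mul_le_mul_right _ ?_)
      induction h : G.ends e with | _ u v =>
      refine (Finset.card_le_card (t := {u, v}) ?_).trans Finset.card_le_two
      intro x hx
      simpa using hx
    · calc X.card * (2*k) ≤ g * (2*k) := Nat.mul_le_mul_right _ hXg
        _ = 2 * g * k := by ring

theorem lip_face (f : F) (i n : ℕ) : Tr.dp ((emb.boundary f).vtx i) ≤ Tr.dp ((emb.boundary f).vtx (i+n)) + n ∧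
    Tr.dp ((emb.boundary f).vtx (i+n)) ≤ Tr.dp ((emb.boundary f).vtx i) + n := by
  induction n with
  | zero => simp
  | succ n ih =>
    have h := (emb.boundary f).compat (i+n)
    have h1 := Tr.lip _ _ _ h
    have h2 := Tr.lip _ _ _ (h.trans Sym2.eq_swap)
    rw [show i + (n+1) = i + n + 1 from rfl]
    omega

theorem lip_face2 (f : F) {d i j : ℕ} (hl : (emb.boundary f).len ≤ d) (hi : i < (emb.boundary f).len)
    (hj : j < (emb.boundary f).len) : Tr.dp ((emb.boundary f).vtx i) ≤ Tr.dp ((emb.boundary f).vtx j) + d/2 := by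
  rcases le_total i j with h | h
  · obtain ⟨n, rfl⟩ := Nat.exists_eq_add_of_le h
    have h1 := lip_face emb Tr f i n
    have h2 := lip_face emb Tr f (i+n) ((emb.boundary f).len - n)
    rw [show i + n + ((emb.boundary f).len - n) = i + (emb.boundary f).len by omega, (emb.boundary f).vtx_per] at h2
    omega
  · obtain ⟨n, rfl⟩ := Nat.exists_eq_add_of_le h
    have h1 := lip_face emb Tr f j n
    have h2 := lip_face emb Tr f (j+n) ((emb.boundary f).len - n)
    rw [show j + n + ((emb.boundary f).len - n) = j + (emb.boundary f).len by omega, (emb.boundary f).vtx_per] at h2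
    omega

theorem framed_dp {d : ℕ} (hd : 3 ≤ d) {u v : V} (h : (Multigraph.framedGraph emb d).Adj u v) :
    Tr.dp u ≤ Tr.dp v + d/2 := by
  obtain ⟨-, ⟨e, he⟩ | ⟨f, hf, ⟨i, hi, rfl⟩, ⟨j, hj, rfl⟩⟩⟩ := h
  · have := Tr.lip _ _ _ he
    omega
  · exact lip_face2 emb Tr f hf hi hj

theorem layering {d : ℕ} (hd : 3 ≤ d) :
    IsLayering (Multigraph.framedGraph emb d) (fun j => {v | Tr.dp v / (d/2) = j}) := by
  have key : ∀ u v, (Multigraph.framedGraph emb d).Adj u v → Tr.dp u / (d/2) ≤ Tr.dp v / (d/2) + 1 := by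
    intro u v h
    rw [← Nat.add_div_right _ (by omega : 0 < d/2)]
    exact Nat.div_le_div_right (framed_dp emb Tr hd h)
  refine ⟨fun v => ⟨_, rfl, fun j h => h.symm⟩, ?_⟩
  rintro u v h i j rfl rfl
  exact ⟨key u v h, key v u h.symm⟩

variable (hX : ∀ c ∈ Kc emb, (∀ v, v ≠ Tr.r → c (Tr.pe v) = 0) → (∀ e ∈ X, c e = 0) → c = 0)

noncomputable def FV (f : F) : Finset V := (Finset.range (emb.boundary f).len).image (emb.boundary f).vtx
theorem mem_FV (f : F) (n : ℕ) : (emb.boundary f).vtx n ∈ FV emb f :=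
  Finset.mem_image.2 ⟨n % (emb.boundary f).len, Finset.mem_range.2 (Nat.mod_lt _ (emb.boundary f).len_pos), vtx_mod emb f n⟩

noncomputable def S3 (t : Sd emb) : Finset V :=
  {(emb.boundary t.1).vtx t.2, (emb.boundary t.1).vtx (t.2+1), (emb.boundary t.1).vtx 0}
theorem S3_sub (t : Sd emb) : S3 emb t ⊆ FV emb t.1 := by
  intro x hx
  simp only [S3, Finset.mem_insert, Finset.mem_singleton] at hx
  rcases hx with rfl | rfl | rfl <;> exact mem_FV _ _ _

theorem vt_inr {t : Sd emb} {i : Fin 3} {f : F} (h : vtC emb Tr X t i = .inr f) : f = t.1 := by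
  fin_cases i <;> simp [vtC] at h
  exact h.symm

theorem Bt_sub (d : ℕ) (t : Sd emb) (v : V) (hv : v ∉ Zs Tr X)
    (h : (.inl (pj Tr X v) : W0 Tr X ⊕ F) ∈ (CX emb Tr X hX).Bt (parC emb Tr X) (spC emb Tr X d) t) :
    v ∈ (S3 emb t).biUnion (An Tr) ∨ ((emb.boundary t.1).len ≤ d ∧ v ∈ FV emb t.1) := by
  have key : ∀ u n, u ∈ S3 emb t → (parC emb Tr X)^[n] (.inl (pj Tr X u)) = .inl (pj Tr X v) →
      v ∈ (S3 emb t).biUnion (An Tr) := by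
    intro u n hu h
    rw [parC_iter] at h
    have := pj_inj Tr X (Sum.inl.inj h) hv
    exact Finset.mem_biUnion.2 ⟨u, hu, (mem_An Tr).2 ⟨n, this⟩⟩
  rcases h with ⟨i, n, h⟩ | ⟨i, hs, ⟨t', a, b, ha, hb⟩⟩
  · left
    rw [CX_vt] at h
    fin_cases i
    · exact key _ n (by simp [S3]) h
    · exact key _ n (by simp [S3]) h
    · change (parC emb Tr X)^[n] (.inr t.1) = _ at h
      cases n with
      | zero => exact absurd h (by simp)
      | succ n =>
        rw [Function.iterate_succ_apply] at h
        exact key _ n (by simp [S3]) h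
  · right
    rw [CX_vt] at hs hb
    rw [CX_vt, CX_vt] at ha
    have hi : vtC emb Tr X t i = .inr t.1 := by
      fin_cases i
      · exact absurd hs id
      · exact absurd hs id
      · rfl
    rw [hi] at hs ha
    have e := vt_inr emb Tr X ha
    refine ⟨hs, ?_⟩
    rw [e]
    fin_cases b
    · have := pj_inj Tr X (Sum.inl.inj hb) hv
      rw [← this]; exact mem_FV _ _ _
    · have := pj_inj Tr X (Sum.inl.inj hb) hv
      rw [← this]; exact mem_FV _ _ _
    · exact absurd hb (by simp [vtC])

theorem width_Bt {d : ℕ} (hd : 3 ≤ d) (j : ℕ) (t : Sd emb) (Q : Finset V)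
    (hQ : ∀ v ∈ Q, v ∉ Zs Tr X ∧ (.inl (pj Tr X v) : W0 Tr X ⊕ F) ∈ (CX emb Tr X hX).Bt (parC emb Tr X) (spC emb Tr X d) t) :
    (Q.filter fun x => Tr.dp x / (d/2) = j).card ≤ d + 3 * (d/2) - 3 := by
  have hk : 1 ≤ d/2 := by omega
  have h3 : (S3 emb t).card ≤ 3 := Finset.card_le_three
  by_cases hl : (emb.boundary t.1).len ≤ d
  · refine (Finset.card_le_card (Finset.filter_subset_filter _ ?_)).trans
      (cnt_face Tr (S3 emb t) (FV emb t.1) (S3_sub emb t) hk j h3 ?_)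
    · intro v hv
      rw [Finset.mem_union]
      rcases Bt_sub emb Tr X hX d t v (hQ v hv).1 (hQ v hv).2 with h | h
      · exact Or.inr h
      · exact Or.inl h.2
    · exact Finset.card_image_le.trans (by simpa using hl)
  · refine (Finset.card_le_card (Finset.filter_subset_filter _ (t := (S3 emb t).biUnion (An Tr)) ?_)).trans ((cnt_S Tr _ hk j).trans ?_)
    · intro v hv
      rcases Bt_sub emb Tr X hX d t v (hQ v hv).1 (hQ v hv).2 with h | h
      · exact h
      · exact absurd h.1 hl
    · have := Nat.mul_le_mul_right (d/2) h3
      omega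
end

theorem main (g d : ℕ) (hd : 3 ≤ d)
    {V E F : Type} [Fintype V] [Fintype E] [Fintype F]
    (G : Multigraph V E) (emb : G.Embedding F)
    (hg : emb.eulerGenus = (g : ℤ)) :
    ∃ (W : Type) (H : SimpleGraph W) (A : W → Set V) (L : ℕ → Set V),
      IsHPartition (Multigraph.framedGraph emb d) H A ∧
      IsLayering (Multigraph.framedGraph emb d) L ∧
      (∀ x j, (A x ∩ L j).encard ≤
        ((max (2 * g * (d / 2)) (d + 3 * (d / 2) - 3) : ℕ) : ℕ∞)) ∧
      IsPlanar H ∧ TreewidthLE H 3 := by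
  rcases isEmpty_or_nonempty F with hF | hF
  · have hE : IsEmpty E := ⟨fun e => by
      obtain ⟨p, _⟩ := eg_two emb e
      exact hF.false p.1⟩
    have hV : Nonempty V := emb.conn.nonempty
    have hs : Subsingleton V := by
      refine ⟨fun u v => ?_⟩
      exact reach_pred (G := G.simple) (fun w => u = w) (fun a b h _ => hE.elim h.2.choose) (emb.conn.preconnected u v) rfl
    refine ⟨Unit, ⊥, fun _ => Set.univ, fun j => {_v | j = 0}, ⟨fun _ => Set.univ_nonempty, fun v => ⟨(), trivial, fun _ _ => rfl⟩, fun x y h => absurd rfl h⟩, ⟨fun v => ⟨0, rfl, fun j h => h⟩, ?_⟩, ?_, ?_, ?_⟩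
    · intro u v h
      exact absurd (Subsingleton.elim u v) h.1
    · intro x j
      refine (Set.encard_le_one_iff_subsingleton.2 (Set.subsingleton_of_subsingleton)).trans ?_
      have : 1 ≤ max (2 * g * (d / 2)) (d + 3 * (d / 2) - 3) := le_max_of_le_right (by omega)
      exact_mod_cast this
    · exact sphere_planar sphere_init ⊥ (fun _ => 0) (fun _ _ _ => rfl) (fun a b h => absurd h (by simp))
    · exact TD_tw TD_init ⊥ (fun _ => 0) (fun _ _ _ => rfl) (fun a b h => absurd h (by simp))
  · obtain ⟨f0⟩ := hF
    have hE : Nonempty E := ⟨(emb.boundary f0).edge 0⟩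
    have hF : Nonempty F := ⟨f0⟩
    obtain ⟨Tr, hr⟩ := exists_tree emb.conn ((emb.boundary f0).vtx 0)
    obtain ⟨X, hXg, hX⟩ := exists_X emb Tr hg
    have I := inpC emb Tr X hX d f0 hr
    obtain ⟨V', Fc, lab, tri, hSp, hTD, hpt, hadj, hspc⟩ := Cx.decomp I
    let lb : V → V' := fun v => lab (.inl (pj Tr X v))
    have hMA : ∀ u v, (Multigraph.framedGraph emb d).Adj u v → MA tri (lb u) (lb v) := by
      rintro u v ⟨-, ⟨e, he⟩ | ⟨f, hf, ⟨i, hi, rfl⟩, ⟨j, hj, rfl⟩⟩⟩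
      · exact hadj _ _ (R_edge emb Tr X hX he)
      · exact hspc (.inr f) hf _ _ (R_spoke emb Tr X hX f i) (R_spoke emb Tr X hX f j)
    let H : SimpleGraph {x : V' // ∃ v, lb v = x} :=
      { Adj := fun x y => x ≠ y ∧ ∃ u v, lb u = x.1 ∧ lb v = y.1 ∧ (Multigraph.framedGraph emb d).Adj u v
        symm := ⟨fun x y ⟨h, u, v, h1, h2, h3⟩ => ⟨h.symm, v, u, h2, h1, h3.symm⟩⟩
        loopless := ⟨fun x h => h.1 rfl⟩ }
    have hH : ∀ x y, H.Adj x y → MA tri x.1 y.1 := by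
      rintro x y ⟨-, u, v, h1, h2, h3⟩
      rw [← h1, ← h2]; exact hMA u v h3
    have : Nonempty V' := ⟨lb Tr.r⟩
    refine ⟨_, H, fun x => {v | lb v = x.1}, fun j => {v | Tr.dp v / (d/2) = j}, ⟨?_, ?_, ?_⟩, layering emb Tr hd, ?_,
      sphere_planar hSp H Subtype.val Subtype.val_injective hH, TD_tw hTD H Subtype.val Subtype.val_injective hH⟩
    · rintro ⟨x, v, hv⟩; exact ⟨v, hv⟩
    · intro v
      exact ⟨⟨lb v, v, rfl⟩, rfl, fun y h => Subtype.ext h.symm⟩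
    · intro x y hxy
      constructor
      · rintro ⟨-, u, v, h1, h2, h3⟩; exact ⟨u, h1, v, h2, h3⟩
      · rintro ⟨u, h1, v, h2, h3⟩; exact ⟨hxy, u, v, h1, h2, h3⟩
    · rintro ⟨x, v0, rfl⟩ j
      let Q : Finset V := Finset.univ.filter fun v => lb v = lb v0
      have e : ({v | lb v = lb v0} ∩ {v | Tr.dp v / (d/2) = j} : Set V) =
          ((Q.filter fun x => Tr.dp x / (d/2) = j : Finset V) : Set V) := by
        ext v; simp [Q]
      show ({v | lb v = lb v0} ∩ {v | Tr.dp v / (d/2) = j} : Set V).encard ≤ _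
      rw [e, Set.encard_coe_eq_coe_finsetCard]
      have main : (Q.filter fun x => Tr.dp x / (d/2) = j).card ≤ max (2 * g * (d / 2)) (d + 3 * (d / 2) - 3) := by
        rcases hpt (.inl (pj Tr X v0)) with h | ⟨hz, t, ht⟩
        · refine (cnt_Z Tr X (by omega) j hXg Q ?_).trans (max_le_max le_rfl (by omega))
          intro v hv
          have hv : lb v = lb v0 := (Finset.mem_filter.1 hv).2
          have : (.inl (pj Tr X v) : W0 Tr X ⊕ F) ∈ ({.inl (pj Tr X Tr.r)} : Set (W0 Tr X ⊕ F)) := by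
            rw [← h]; exact hv
          by_contra hn
          have := pj_inj Tr X (Sum.inl.inj this).symm hn
          exact hn (this ▸ Zs_r Tr X)
        · refine (width_Bt emb Tr X hX hd j t Q ?_).trans (le_max_right _ _)
          intro v hv
          have hv : lb v = lb v0 := (Finset.mem_filter.1 hv).2
          refine ⟨fun hn => hz ?_, ht hv⟩
          show lab _ = _
          rw [← pj_in Tr X hn]; exact hv
      exact_mod_cast main
end FLP

/-- Let `G` be a multigraph embedded in a surface of Euler genus `g` without crossings,
where each face is bounded by a cycle, and let `d ≥ 3`.  Then `G^{(d)}` has a layered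
`H`-partition `(𝒫, ℒ)` with width at most `max{2g⌊d/2⌋, d + 3⌊d/2⌋ − 3}`, such that
`H` is planar with treewidth at most 3. -/
theorem framed_layered_partition (g d : ℕ) (hd : 3 ≤ d)
    {V E F : Type} [Fintype V] [Fintype E] [Fintype F]
    (G : Multigraph V E) (emb : G.Embedding F)
    (hcyc : ∀ f, (emb.boundary f).IsCycle)
    (hg : emb.eulerGenus = (g : ℤ)) :
    ∃ (W : Type) (H : SimpleGraph W) (A : W → Set V) (L : ℕ → Set V),
      IsHPartition (Multigraph.framedGraph emb d) H A ∧
      IsLayering (Multigraph.framedGraph emb d) L ∧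
      (∀ x j, (A x ∩ L j).encard ≤
        ((max (2 * g * (d / 2)) (d + 3 * (d / 2) - 3) : ℕ) : ℕ∞)) ∧
      IsPlanar H ∧ TreewidthLE H 3 := by
  exact FLP.main g d hd G emb hg
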